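/- arXiv:2501.16807 — 2 statements merged into one kernel-verified Lean document; each statement's English description precedes it below -/
import Mathlib

section
/- Let n ≥ 1, t_o ≥ 0. Assume (η) and (v) hold. Then for every initial datum ρ_o ∈ (L¹ ∩ BV)(ℝ; ℝⁿ) and every T > t_o, the nonlocal system ∂_t ρ_i + ∂_x(ρ_i v_i(t, x, (η_i * ρ)(t, x))) = 0, ρ_i(t_o, ·) = ρ_{o,i} (i = 1, …, n) admits a solution ρ ∈ C⁰([t_o, T]; L¹(ℝ; ℝⁿ)) in the sense of the weak (test-function) formulation, this solution is unique, and for every t ∈ [t_o, T] the value ρ(t) belongs to (L¹ ∩ BV)(ℝ; ℝⁿ). -/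
open MeasureTheory Set
open scoped ENNReal NNReal

noncomputable section

/-- `f` belongs to `W^{2,∞}(ℝ;ℝ)` with norm at most `C`. -/
def W2infBound (f : ℝ → ℝ) (C : ℝ) : Prop :=
  ContDiff ℝ 2 f ∧ ∀ x : ℝ,
    |f x| ≤ C ∧ |deriv f x| ≤ C ∧ |deriv (deriv f) x| ≤ C

/-- Assumption (η), quantitative form: every kernel `η_{ij} ∈ W^{2,∞}(ℝ)` with norm `≤ C`. -/
def EtaBound (n : ℕ) (η : Fin n → Fin n → ℝ → ℝ) (C : ℝ) : Prop :=
  ∀ i j : Fin n, W2infBound (η i j) C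

/-- Assumption (η). -/
def EtaAssumption (n : ℕ) (η : Fin n → Fin n → ℝ → ℝ) : Prop :=
  ∃ C : ℝ, EtaBound n η C

/-- `V ∈ 𝒱` with `‖V‖_𝒱 ≤ C`: `V (·, 0)` is bounded and the full space–density
derivative `(∂ₓ V, ∇_ρ V)` lies in `W^{2,∞}`, i.e. all derivatives of order `1,2,3`
of `V` are bounded by `C`. -/
def VBound (n : ℕ) (V : ℝ → (Fin n → ℝ) → ℝ) (C : ℝ) : Prop :=
  ContDiff ℝ 3 (Function.uncurry V) ∧ (∀ x : ℝ, |V x 0| ≤ C) ∧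
    ∀ k : ℕ, 1 ≤ k → k ≤ 3 → ∀ p : ℝ × (Fin n → ℝ),
      ‖iteratedFDeriv ℝ k (Function.uncurry V) p‖ ≤ C

/-- `‖V - W‖_𝒱 ≤ ε`. -/
def VDistLE (n : ℕ) (V W : ℝ → (Fin n → ℝ) → ℝ) (ε : ℝ) : Prop :=
  (∀ x : ℝ, |V x 0 - W x 0| ≤ ε) ∧
    ∀ k : ℕ, 1 ≤ k → k ≤ 3 → ∀ p : ℝ × (Fin n → ℝ),
      ‖iteratedFDeriv ℝ k (Function.uncurry V) p
        - iteratedFDeriv ℝ k (Function.uncurry W) p‖ ≤ ε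

/-- Assumption (v) on the time interval `[t0, T]`: each `v t i ∈ 𝒱` and
`t ↦ v t` is continuous for the `𝒱ⁿ` norm. -/
def VAssumption (n : ℕ) (t0 T : ℝ) (v : ℝ → Fin n → ℝ → (Fin n → ℝ) → ℝ) : Prop :=
  (∀ t ∈ Icc t0 T, ∀ i : Fin n, ∃ C : ℝ, VBound n (v t i) C) ∧
    ∀ t ∈ Icc t0 T, ∀ ε > (0:ℝ), ∃ δ > (0:ℝ), ∀ s ∈ Icc t0 T, |s - t| < δ →
      ∀ i : Fin n, VDistLE n (v s i) (v t i) ε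

/-- The nonlocal term `(η_i * ρ)(x) ∈ ℝⁿ`, `(η_i * ρ)_j (x) = ∫ η_{ij}(ξ) ρ_j (x-ξ) dξ`. -/
def convTerm (n : ℕ) (η : Fin n → Fin n → ℝ → ℝ) (ρ : ℝ → Fin n → ℝ)
    (i : Fin n) (x : ℝ) : Fin n → ℝ :=
  fun j => ∫ ξ : ℝ, η i j ξ * ρ (x - ξ) j

/-- Distributional (weak) solution of `∂_t u + ∂_x (u w) = 0` on `[t0,T] × ℝ`
with initial datum `u0`, tested against all `φ ∈ C_c^∞([t0,T) × ℝ)`. -/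
def IsWeakSol (t0 T : ℝ) (w : ℝ → ℝ → ℝ) (u0 : ℝ → ℝ) (u : ℝ → ℝ → ℝ) : Prop :=
  ∀ φ : ℝ → ℝ → ℝ, ContDiff ℝ (⊤ : ℕ∞) (Function.uncurry φ) →
    HasCompactSupport (Function.uncurry φ) →
    (∀ t : ℝ, T ≤ t → ∀ x : ℝ, φ t x = 0) →
    (∫ t in Icc t0 T, ∫ x : ℝ,
        u t x * (deriv (fun s => φ s x) t + w t x * deriv (fun y => φ t y) x))
      + (∫ x : ℝ, u0 x * φ t0 x) = 0

/-- `ρ ∈ C⁰([t0,T]; L¹(ℝ;ℝⁿ))`. -/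
def ContL1 (n : ℕ) (t0 T : ℝ) (ρ : ℝ → ℝ → Fin n → ℝ) : Prop :=
  (∀ t ∈ Icc t0 T, Integrable (fun x => ρ t x) volume) ∧
    ∀ t ∈ Icc t0 T, ∀ ε > (0:ℝ), ∃ δ > (0:ℝ), ∀ s ∈ Icc t0 T, |s - t| < δ →
      (∫ x : ℝ, ‖ρ s x - ρ t x‖) ≤ ε

/-- Solution of the nonlocal system `∂_t ρ_i + ∂_x (ρ_i v_i(t, x, (η_i * ρ)(t,x))) = 0`
on `[t0,T]`, in the sense of Definition 2.2 of the paper. -/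
def IsSol (n : ℕ) (t0 T : ℝ) (η : Fin n → Fin n → ℝ → ℝ)
    (v : ℝ → Fin n → ℝ → (Fin n → ℝ) → ℝ)
    (ρ0 : ℝ → Fin n → ℝ) (ρ : ℝ → ℝ → Fin n → ℝ) : Prop :=
  ContL1 n t0 T ρ ∧
    ∀ i : Fin n,
      IsWeakSol t0 T (fun t x => v t i x (convTerm n η (ρ t) i x))
        (fun x => ρ0 x i) (fun t x => ρ t x i)

/-- `ρ0 ∈ (L¹ ∩ BV)(ℝ;ℝⁿ)`. -/
def L1BV (n : ℕ) (ρ0 : ℝ → Fin n → ℝ) : Prop :=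
  Integrable (fun x => ρ0 x) volume ∧
    ∀ i : Fin n, BoundedVariationOn (fun x => ρ0 x i) Set.univ

/-- Total variation of an `ℝⁿ`-valued function (componentwise, summed), with values in `ℝ≥0∞`. -/
def TVe (n : ℕ) (u : ℝ → Fin n → ℝ) : ℝ≥0∞ :=
  ∑ i : Fin n, eVariationOn (fun x => u x i) Set.univ

/-- Total variation, real-valued. -/
def TVn (n : ℕ) (u : ℝ → Fin n → ℝ) : ℝ := (TVe n u).toReal

/-- `L¹` norm of an `ℝⁿ`-valued function. -/
def L1n (n : ℕ) (u : ℝ → Fin n → ℝ) : ℝ := ∫ x : ℝ, ‖u x‖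

section Helpers
open Filter Topology

structure NiceField (w w' : ℝ → ℝ → ℝ) (M L L2 : ℝ) : Prop where
  cont : ∀ x, Continuous fun t => w t x
  bdd : ∀ t x, |w t x| ≤ M
  der : ∀ t x, HasDerivAt (w t) (w' t x) x
  dbdd : ∀ t x, |w' t x| ≤ L
  dlip : ∀ t x y, |w' t x - w' t y| ≤ L2 * |x - y|

structure IsFlow (t0 T : ℝ) (w X : ℝ → ℝ → ℝ) : Prop where
  init : ∀ y, X t0 y = y
  cont : ∀ y, Continuous fun t => X t y
  der : ∀ y, ∀ t ∈ Icc t0 T, HasDerivAt (fun s => X s y) (w t (X t y)) t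

namespace NiceField
variable {w w' : ℝ → ℝ → ℝ} {M L L2 : ℝ}

lemma M0 (h : NiceField w w' M L L2) : 0 ≤ M := (abs_nonneg _).trans (h.bdd 0 0)
lemma L0 (h : NiceField w w' M L L2) : 0 ≤ L := (abs_nonneg _).trans (h.dbdd 0 0)
lemma L20 (h : NiceField w w' M L L2) : 0 ≤ L2 := by
  have := (abs_nonneg _).trans (h.dlip 0 1 0)
  simpa using this

lemma lip (h : NiceField w w' M L L2) (t x y : ℝ) : |w t x - w t y| ≤ L * |x - y| := by
  have := Convex.norm_image_sub_le_of_norm_hasDerivWithin_le (f := w t) (f' := w' t) (C := L)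
    (s := univ) (fun x _ => (h.der t x).hasDerivWithinAt) (fun x _ => h.dbdd t x) convex_univ
    (mem_univ y) (mem_univ x)
  simpa [Real.norm_eq_abs] using this

lemma taylor (h : NiceField w w' M L L2) (t x d : ℝ) :
    |w t (x + d) - w t x - w' t x * d| ≤ L2 * |d| * |d| := by
  have := Convex.norm_image_sub_le_of_norm_hasDerivWithin_le
    (f := fun z => w t z - w' t x * z) (f' := fun z => w' t z - w' t x) (C := L2 * |d|)
    (s := segment ℝ x (x + d)) (x := x) (y := x + d)
    (fun z _ => ((h.der t z).sub (by simpa using (hasDerivAt_id z).const_mul (w' t x))).hasDerivWithinAt)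
    (fun z hz => by
      refine (h.dlip t z x).trans ?_
      have h1 := norm_sub_le_of_mem_segment hz
      have : |z - x| ≤ |d| := by
        simpa [Real.norm_eq_abs] using h1
      exact mul_le_mul_of_nonneg_left this h.L20)
    (convex_segment _ _) (left_mem_segment _ _ _) (right_mem_segment _ _ _)
  simp only [Real.norm_eq_abs, add_sub_cancel_left] at this
  refine le_trans (le_of_eq ?_) this
  congr 1; ring

lemma cont2 (h : NiceField w w' M L L2) : Continuous (fun p : ℝ × ℝ => w p.1 p.2) := by
  refine continuous_prod_of_continuous_lipschitzWith' (fun p : ℝ × ℝ => w p.1 p.2) L.toNNReal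
    (fun a => ?_) (fun b => h.cont b)
  refine LipschitzWith.of_dist_le_mul fun x y => ?_
  rw [Real.coe_toNNReal _ h.L0]; simpa [Real.dist_eq] using h.lip a x y

lemma dcont (h : NiceField w w' M L L2) (x : ℝ) : Continuous fun t => w' t x := by
  have hu : TendstoUniformly (fun (k : ℕ) t => (k + 1 : ℝ) * (w t (x + 1 / (k + 1 : ℝ)) - w t x))
      (fun t => w' t x) atTop := by
    rw [Metric.tendstoUniformly_iff]
    intro ε hε
    have hl : Tendsto (fun k : ℕ => L2 * (1 / (k + 1 : ℝ))) atTop (𝓝 (L2 * 0)) :=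
      tendsto_one_div_add_atTop_nhds_zero_nat.const_mul _
    rw [mul_zero] at hl
    filter_upwards [hl.eventually (gt_mem_nhds hε)] with k hk t
    have hk0 : (0 : ℝ) < k + 1 := by positivity
    have := h.taylor t x (1 / (k + 1 : ℝ))
    rw [abs_of_pos (show (0 : ℝ) < 1 / (k + 1) by positivity)] at this
    refine lt_of_le_of_lt ?_ hk
    rw [dist_comm, Real.dist_eq]
    have e : (k + 1 : ℝ) * (w t (x + 1 / (k + 1 : ℝ)) - w t x) - w' t x
      = (k + 1) * (w t (x + 1 / (k + 1 : ℝ)) - w t x - w' t x * (1 / (k + 1 : ℝ))) := by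
      field_simp
    rw [e, abs_mul, abs_of_pos hk0]
    calc _ ≤ (k + 1 : ℝ) * (L2 * (1 / (k + 1 : ℝ)) * (1 / (k + 1 : ℝ))) :=
          mul_le_mul_of_nonneg_left this hk0.le
      _ = _ := by field_simp
  refine hu.continuous (Frequently.of_forall fun k => ?_)
  exact continuous_const.mul ((h.cont _).sub (h.cont _))

lemma dcont2 (h : NiceField w w' M L L2) : Continuous (fun p : ℝ × ℝ => w' p.1 p.2) := by
  refine continuous_prod_of_continuous_lipschitzWith' (fun p : ℝ × ℝ => w' p.1 p.2) L2.toNNReal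
    (fun a => ?_) (fun b => h.dcont b)
  refine LipschitzWith.of_dist_le_mul fun x y => ?_
  rw [Real.coe_toNNReal _ h.L20]; simpa [Real.dist_eq] using h.dlip a x y

/-- averaged slope -/
def slp (w' : ℝ → ℝ → ℝ) (t x y : ℝ) : ℝ := ∫ θ in (0:ℝ)..1, w' t (y + θ * (x - y))

lemma slp_eq (h : NiceField w w' M L L2) (t x y : ℝ) :
    w t x - w t y = slp w' t x y * (x - y) := by
  have h1 : ∫ θ in (0:ℝ)..1, w' t (y + θ * (x - y)) * (x - y)
      = w t (y + 1 * (x - y)) - w t (y + 0 * (x - y)) := by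
    refine intervalIntegral.integral_eq_sub_of_hasDerivAt
      (f := fun θ => w t (y + θ * (x - y))) (fun θ _ => ?_) ?_
    · have := (h.der t (y + θ * (x - y))).comp θ
        (((hasDerivAt_id θ).mul_const (x - y)).const_add y)
      simpa [Function.comp_def] using this
    · apply Continuous.intervalIntegrable
      exact (h.dcont2.comp (g := fun p : ℝ × ℝ => w' p.1 p.2) (f := fun θ => (t, y + θ * (x - y))) (by fun_prop)).mul continuous_const
  rw [intervalIntegral.integral_mul_const] at h1
  rw [slp, h1]; simp

lemma slp_cont (h : NiceField w w' M L L2) {α : Type*} [TopologicalSpace α]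
    {t x y : α → ℝ} (ht : Continuous t) (hx : Continuous x) (hy : Continuous y) :
    Continuous fun a => slp w' (t a) (x a) (y a) := by
  have h0 : Continuous (fun p : ℝ × ℝ × ℝ => slp w' p.1 p.2.1 p.2.2) := by
    unfold slp
    refine intervalIntegral.continuous_parametric_intervalIntegral_of_continuous' ?_ 0 1
    exact h.dcont2.comp (g := fun p : ℝ × ℝ => w' p.1 p.2)
      (f := fun q : (ℝ × ℝ × ℝ) × ℝ => (q.1.1, q.1.2.2 + q.2 * (q.1.2.1 - q.1.2.2))) (by fun_prop)
  exact h0.comp (ht.prodMk (hx.prodMk hy))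

lemma slp_bdd (h : NiceField w w' M L L2) (t x y : ℝ) : |slp w' t x y| ≤ L := by
  have := intervalIntegral.norm_integral_le_of_norm_le_const (a := (0:ℝ)) (b := 1) (C := L)
    (f := fun θ => w' t (y + θ * (x - y))) (fun θ _ => h.dbdd _ _)
  simpa [slp] using this

lemma slp_sub (h : NiceField w w' M L L2) (t x y : ℝ) :
    |slp w' t x y - w' t y| ≤ L2 * |x - y| := by
  have hc : Continuous fun θ => w' t (y + θ * (x - y)) :=
    h.dcont2.comp (g := fun p : ℝ × ℝ => w' p.1 p.2) (f := fun θ => (t, y + θ * (x - y))) (by fun_prop)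
  have e : slp w' t x y - w' t y = ∫ θ in (0:ℝ)..1, (w' t (y + θ * (x - y)) - w' t y) := by
    rw [intervalIntegral.integral_sub (hc.intervalIntegrable _ _) (by simp)]
    simp [slp]
  rw [e]
  have := intervalIntegral.norm_integral_le_of_norm_le_const (a := (0:ℝ)) (b := 1)
    (C := L2 * |x - y|)
    (f := fun θ => w' t (y + θ * (x - y)) - w' t y) (fun θ hθ => by
      refine (h.dlip t _ _).trans ?_
      rw [add_sub_cancel_left, abs_mul]
      rw [uIoc_of_le zero_le_one] at hθ
      refine mul_le_mul_of_nonneg_left ?_ h.L20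
      have : |θ| ≤ 1 := by rw [abs_of_pos hθ.1]; exact hθ.2
      exact mul_le_of_le_one_left (abs_nonneg _) this)
  simpa using this

end NiceField

namespace IsFlow
variable {w w' X : ℝ → ℝ → ℝ} {M L L2 t0 T : ℝ}
open NiceField

lemma slope (hF : IsFlow t0 T w X) (h : NiceField w w' M L L2) (a b : ℝ) {t : ℝ}
    (ht : t ∈ Icc t0 T) :
    X t a - X t b = (a - b) * Real.exp (∫ s in t0..t, slp w' s (X s a) (X s b)) := by
  have hq : Continuous fun s => slp w' s (X s a) (X s b) :=
    h.slp_cont continuous_id (hF.cont a) (hF.cont b)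
  have hd : ∀ s, HasDerivAt (fun s => ∫ r in t0..s, slp w' r (X r a) (X r b))
      (slp w' s (X s a) (X s b)) s := fun s => hq.integral_hasStrictDerivAt t0 s |>.hasDerivAt
  set Q := fun s => ∫ r in t0..s, slp w' r (X r a) (X r b) with hQ
  set P := fun s => (X s a - X s b) * Real.exp (-Q s) with hP
  have hPd : ∀ s ∈ Icc t0 T, HasDerivAt P 0 s := by
    intro s hs
    have h1 := ((hF.der a s hs).sub (hF.der b s hs)).mul ((hd s).neg.exp)
    refine h1.congr_deriv ?_
    rw [h.slp_eq s]
    simp only [Pi.sub_apply, Pi.neg_apply]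
    ring
  have hconst : P t = P t0 := by
    refine (constant_of_has_deriv_right_zero (f := P) (a := t0) (b := T) ?_ ?_) t ht
    · exact fun s hs => (hPd s hs).continuousAt.continuousWithinAt
    · exact fun s hs => (hPd s (Ico_subset_Icc_self hs)).hasDerivWithinAt
  have e0 : P t0 = a - b := by simp [hP, hQ, hF.init]
  rw [e0] at hconst
  rw [← hconst, hP]
  simp only
  rw [mul_assoc, ← Real.exp_add]; simp [hQ]

lemma slope_bdd (hF : IsFlow t0 T w X) (h : NiceField w w' M L L2) (a b : ℝ) {t : ℝ}
    (ht : t ∈ Icc t0 T) : |∫ s in t0..t, slp w' s (X s a) (X s b)| ≤ L * (T - t0) := by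
  have := intervalIntegral.norm_integral_le_of_norm_le_const (a := t0) (b := t) (C := L)
    (f := fun s => slp w' s (X s a) (X s b)) (fun θ _ => h.slp_bdd _ _ _)
  rw [Real.norm_eq_abs] at this
  refine this.trans ?_
  rw [abs_of_nonneg (by linarith [ht.1])]
  exact mul_le_mul_of_nonneg_left (by linarith [ht.2]) h.L0

lemma lipy (hF : IsFlow t0 T w X) (h : NiceField w w' M L L2) (a b : ℝ) {t : ℝ}
    (ht : t ∈ Icc t0 T) : |X t a - X t b| ≤ Real.exp (L * (T - t0)) * |a - b| := by
  rw [hF.slope h a b ht, abs_mul, mul_comm, abs_of_pos (Real.exp_pos _)]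
  gcongr
  exact (abs_le.1 (hF.slope_bdd h a b ht)).2

lemma lipinv (hF : IsFlow t0 T w X) (h : NiceField w w' M L L2) (a b : ℝ) {t : ℝ}
    (ht : t ∈ Icc t0 T) : |a - b| ≤ Real.exp (L * (T - t0)) * |X t a - X t b| := by
  rw [hF.slope h a b ht, abs_mul, abs_of_pos (Real.exp_pos _), mul_left_comm, ← Real.exp_add]
  refine le_mul_of_one_le_right (abs_nonneg _) (Real.one_le_exp ?_)
  linarith [(abs_le.1 (hF.slope_bdd h a b ht)).1]

lemma lipt (hF : IsFlow t0 T w X) (h : NiceField w w' M L L2) (y : ℝ) {s t : ℝ}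
    (hs : s ∈ Icc t0 T) (ht : t ∈ Icc t0 T) : |X t y - X s y| ≤ M * |t - s| := by
  have := Convex.norm_image_sub_le_of_norm_hasDerivWithin_le (f := fun t => X t y)
    (f' := fun t => w t (X t y)) (C := M)
    (s := Icc t0 T) (fun x hx => (hF.der y x hx).hasDerivWithinAt) (fun x _ => h.bdd _ _)
    (convex_Icc _ _) hs ht
  simpa [Real.norm_eq_abs] using this

/-- log of the Jacobian -/
def lJ (w' X : ℝ → ℝ → ℝ) (t0 t y : ℝ) : ℝ := ∫ s in t0..t, w' s (X s y)

lemma wX_cont (hF : IsFlow t0 T w X) (h : NiceField w w' M L L2) (y : ℝ) :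
    Continuous fun s => w' s (X s y) :=
  h.dcont2.comp (g := fun p : ℝ × ℝ => w' p.1 p.2) (f := fun s => (s, X s y))
    (continuous_id.prodMk (hF.cont y))

lemma lJ_bdd (h : NiceField w w' M L L2) (y : ℝ) {t : ℝ}
    (ht : t ∈ Icc t0 T) : |lJ w' X t0 t y| ≤ L * (T - t0) := by
  have := intervalIntegral.norm_integral_le_of_norm_le_const (a := t0) (b := t) (C := L)
    (f := fun s => w' s (X s y)) (fun θ _ => h.dbdd _ _)
  rw [Real.norm_eq_abs] at this
  refine this.trans ?_
  rw [abs_of_nonneg (by linarith [ht.1])]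
  exact mul_le_mul_of_nonneg_left (by linarith [ht.2]) h.L0

lemma lJ_lipy (hF : IsFlow t0 T w X) (h : NiceField w w' M L L2) (a b : ℝ) {t : ℝ}
    (ht : t ∈ Icc t0 T) : |lJ w' X t0 t a - lJ w' X t0 t b|
      ≤ L2 * Real.exp (L * (T - t0)) * (T - t0) * |a - b| := by
  unfold lJ
  rw [← intervalIntegral.integral_sub ((hF.wX_cont h a).intervalIntegrable _ _)
    ((hF.wX_cont h b).intervalIntegrable _ _)]
  have := intervalIntegral.norm_integral_le_of_norm_le_const (a := t0) (b := t)
    (C := L2 * (Real.exp (L * (T - t0)) * |a - b|))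
    (f := fun s => w' s (X s a) - w' s (X s b)) (fun s hs => by
      rw [uIoc_of_le ht.1] at hs
      refine (h.dlip _ _ _).trans ?_
      exact mul_le_mul_of_nonneg_left (hF.lipy h a b ⟨hs.1.le, hs.2.trans ht.2⟩) h.L20)
  rw [Real.norm_eq_abs] at this
  refine this.trans ?_
  rw [abs_of_nonneg (by linarith [ht.1] : 0 ≤ t - t0)]
  have h1 : L2 * (Real.exp (L * (T - t0)) * |a - b|) * (t - t0) ≤
     L2 * (Real.exp (L * (T - t0)) * |a - b|) * (T - t0) := by
    have := h.L20
    have := ht.2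
    gcongr
  exact h1.trans (le_of_eq (by ring))

lemma lJ_lipt (hF : IsFlow t0 T w X) (h : NiceField w w' M L L2) (y s t : ℝ) :
    |lJ w' X t0 t y - lJ w' X t0 s y| ≤ L * |t - s| := by
  unfold lJ
  rw [intervalIntegral.integral_interval_sub_left ((hF.wX_cont h y).intervalIntegrable _ _)
    ((hF.wX_cont h y).intervalIntegrable _ _)]
  exact intervalIntegral.norm_integral_le_of_norm_le_const (f := fun s => w' s (X s y))
    (fun θ _ => h.dbdd _ _)

lemma slope_tendsto (hF : IsFlow t0 T w X) (h : NiceField w w' M L L2) (a b : ℝ) {t : ℝ}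
    (ht : t ∈ Icc t0 T) : |(∫ s in t0..t, slp w' s (X s a) (X s b)) - lJ w' X t0 t b|
      ≤ L2 * Real.exp (L * (T - t0)) * (T - t0) * |a - b| := by
  unfold lJ
  rw [← intervalIntegral.integral_sub
    (f := fun s => slp w' s (X s a) (X s b))
    ((h.slp_cont continuous_id (hF.cont a) (hF.cont b)).intervalIntegrable _ _)
    ((hF.wX_cont h b).intervalIntegrable _ _)]
  have := intervalIntegral.norm_integral_le_of_norm_le_const (a := t0) (b := t)
    (C := L2 * (Real.exp (L * (T - t0)) * |a - b|))
    (f := fun s => slp w' s (X s a) (X s b) - w' s (X s b)) (fun s hs => by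
      rw [uIoc_of_le ht.1] at hs
      refine (h.slp_sub _ _ _).trans ?_
      exact mul_le_mul_of_nonneg_left (hF.lipy h a b ⟨hs.1.le, hs.2.trans ht.2⟩) h.L20)
  rw [Real.norm_eq_abs] at this
  refine this.trans ?_
  rw [abs_of_nonneg (by linarith [ht.1] : 0 ≤ t - t0)]
  have h1 : L2 * (Real.exp (L * (T - t0)) * |a - b|) * (t - t0) ≤
     L2 * (Real.exp (L * (T - t0)) * |a - b|) * (T - t0) := by
    have := h.L20
    have := ht.2
    gcongr
  exact h1.trans (le_of_eq (by ring))

lemma hasDeriv (hF : IsFlow t0 T w X) (h : NiceField w w' M L L2) (y : ℝ) {t : ℝ}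
    (ht : t ∈ Icc t0 T) : HasDerivAt (X t) (Real.exp (lJ w' X t0 t y)) y := by
  rw [hasDerivAt_iff_tendsto_slope]
  have h1 : Tendsto (fun a => ∫ s in t0..t, slp w' s (X s a) (X s y)) (𝓝 y)
      (𝓝 (lJ w' X t0 t y)) := by
    rw [tendsto_iff_norm_sub_tendsto_zero]
    refine squeeze_zero (fun _ => norm_nonneg _) (fun a => hF.slope_tendsto h a y ht) ?_
    have : Continuous fun a => L2 * Real.exp (L * (T - t0)) * (T - t0) * |a - y| := by fun_prop
    simpa using this.tendsto y
  have h2 := ((Real.continuous_exp.tendsto _).comp h1).mono_left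
    (nhdsWithin_le_nhds (a := y) (s := {y}ᶜ))
  refine h2.congr' ?_
  filter_upwards [self_mem_nhdsWithin] with a ha
  rw [slope_def_field, hF.slope h a y ht]
  have : a - y ≠ 0 := sub_ne_zero.2 ha
  field_simp
  rfl

lemma strictMono (hF : IsFlow t0 T w X) (h : NiceField w w' M L L2) {t : ℝ}
    (ht : t ∈ Icc t0 T) : StrictMono (X t) := by
  intro a b hab
  have := hF.slope h b a ht
  have h2 : 0 < (b - a) * Real.exp (∫ s in t0..t, slp w' s (X s b) (X s a)) :=
    mul_pos (by linarith) (Real.exp_pos _)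
  linarith

lemma contX (hF : IsFlow t0 T w X) (h : NiceField w w' M L L2) {t : ℝ}
    (ht : t ∈ Icc t0 T) : Continuous (X t) :=
  continuous_iff_continuousAt.2 fun y => (hF.hasDeriv h y ht).continuousAt

lemma near (hF : IsFlow t0 T w X) (h : NiceField w w' M L L2) (y : ℝ) {t : ℝ}
    (ht : t ∈ Icc t0 T) : |X t y - y| ≤ M * (T - t0) := by
  have := hF.lipt h y (left_mem_Icc.2 (ht.1.trans ht.2)) ht
  rw [hF.init, abs_of_nonneg (by linarith [ht.1] : 0 ≤ t - t0)] at this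
  exact this.trans (mul_le_mul_of_nonneg_left (by linarith [ht.2]) h.M0)

lemma surj (hF : IsFlow t0 T w X) (h : NiceField w w' M L L2) {t : ℝ}
    (ht : t ∈ Icc t0 T) : Function.Surjective (X t) := by
  refine (hF.contX h ht).surjective ?_ ?_
  · refine tendsto_atTop_mono (fun y => ?_) (tendsto_atTop_add_const_right _ (-(M * (T - t0))) tendsto_id)
    have := abs_le.1 (hF.near h y ht)
    simp only [id]; linarith
  · refine tendsto_atBot_mono (fun y => ?_) (tendsto_atBot_add_const_right _ (M * (T - t0)) tendsto_id)
    have := abs_le.1 (hF.near h y ht)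
    simp only [id]; linarith

end IsFlow

lemma bv_of_dom {f G : ℝ → ℝ} {B : ℝ} (hB : ∀ x, |G x| ≤ B)
    (h : ∀ x y, x ≤ y → |f y - f x| ≤ G y - G x) : BoundedVariationOn f univ := by
  have : eVariationOn f univ ≤ ENNReal.ofReal (2 * B) := by
    refine iSup_le fun p => ?_
    obtain ⟨k, u, hu, hus⟩ := p
    simp only
    calc ∑ i ∈ Finset.range k, edist (f (u (i + 1))) (f (u i))
        ≤ ∑ i ∈ Finset.range k, ENNReal.ofReal (G (u (i + 1)) - G (u i)) := by
          refine Finset.sum_le_sum fun i _ => ?_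
          rw [edist_dist, Real.dist_eq]
          exact ENNReal.ofReal_le_ofReal (h _ _ (hu (Nat.le_succ i)))
      _ = ENNReal.ofReal (∑ i ∈ Finset.range k, (G (u (i + 1)) - G (u i))) := by
          rw [ENNReal.ofReal_sum_of_nonneg]
          intro i _
          exact (abs_nonneg _).trans (h _ _ (hu (Nat.le_succ i)))
      _ ≤ _ := by
          rw [Finset.sum_range_sub (fun i => G (u i))]
          refine ENNReal.ofReal_le_ofReal ?_
          have h1 := abs_le.1 (hB (u k))
          have h2 := abs_le.1 (hB (u 0))
          linarith
  exact ne_top_of_le_ne_top ENNReal.ofReal_ne_top this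

lemma bv_mul {f E : ℝ → ℝ} {K Λ : ℝ} (hf : BoundedVariationOn f univ) (hi : Integrable f)
    (hK : ∀ x, |E x| ≤ K) (hE : ∀ x y, |E x - E y| ≤ Λ * |x - y|) :
    BoundedVariationOn (fun x => f x * E x) univ := by
  have hK0 : 0 ≤ K := (abs_nonneg _).trans (hK 0)
  have hΛ0 : 0 ≤ Λ := by simpa using (abs_nonneg _).trans (hE 1 0)
  have hl := hf.locallyBoundedVariationOn
  set V := fun z => variationOnFromTo f univ 0 z with hV
  set S := fun z => ∫ r in (0:ℝ)..z, |f r| with hS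
  have hVd : ∀ x y, x ≤ y → |f y - f x| ≤ V y - V x := by
    intro x y hxy
    have h1 := variationOnFromTo.add hl (mem_univ 0) (mem_univ x) (mem_univ y)
    have h3 : V y - V x = variationOnFromTo f univ x y := by simp only [hV]; linarith
    rw [h3, variationOnFromTo.eq_of_le f univ hxy]
    have h4 := eVariationOn.edist_le f (s := univ ∩ Icc x y) (x := y) (y := x)
      ⟨mem_univ _, right_mem_Icc.2 hxy⟩ ⟨mem_univ _, left_mem_Icc.2 hxy⟩
    rw [edist_dist, Real.dist_eq] at h4
    exact (ENNReal.ofReal_le_iff_le_toReal (hl x y (mem_univ _) (mem_univ _))).1 h4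
  have hVm : Monotone V := fun x y hxy => by
    have := (abs_nonneg _).trans (hVd x y hxy); linarith
  have hVb : ∀ z, |V z| ≤ (eVariationOn f univ).toReal := by
    intro z
    simp only [hV]
    rcases le_total 0 z with hz | hz
    · rw [variationOnFromTo.eq_of_le f univ hz, abs_of_nonneg ENNReal.toReal_nonneg]
      exact ENNReal.toReal_mono hf (eVariationOn.mono _ inter_subset_left)
    · rw [variationOnFromTo.eq_of_ge f univ hz, abs_neg, abs_of_nonneg ENNReal.toReal_nonneg]
      exact ENNReal.toReal_mono hf (eVariationOn.mono _ inter_subset_left)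
  have hii : ∀ a b, IntervalIntegrable (fun r => |f r|) volume a b := fun a b =>
    hi.abs.intervalIntegrable
  have hSb : ∀ z, |S z| ≤ ∫ r, |f r| := by
    intro z
    simp only [hS]
    rw [intervalIntegral.abs_integral_eq_abs_integral_uIoc,
      abs_of_nonneg (integral_nonneg fun _ => abs_nonneg _)]
    exact setIntegral_le_integral hi.abs (Eventually.of_forall fun _ => abs_nonneg _)
  have hSd : ∀ x y, S y - S x = ∫ r in x..y, |f r| := fun x y =>
    intervalIntegral.integral_interval_sub_left (hii _ _) (hii _ _)
  refine bv_of_dom (G := fun z => 3 * K * V z + Λ * S z)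
    (B := 3 * K * (eVariationOn f univ).toReal + Λ * ∫ r, |f r|) (fun z => ?_) (fun x y hxy => ?_)
  · refine (abs_add_le _ _).trans ?_
    rw [abs_mul (3 * K), abs_mul Λ, abs_of_nonneg hΛ0, abs_of_nonneg (by positivity : 0 ≤ 3 * K)]
    gcongr
    · exact hVb z
    · exact hSb z
  rcases hxy.eq_or_lt with rfl | hlt
  · simp
  have hV0 : 0 ≤ V y - V x := by have := hVm hxy; linarith
  have h1 : (y - x) * |f x| ≤ (S y - S x) + (y - x) * (V y - V x) := by
    rw [hSd]
    have e1 : ∫ r in x..y, (|f x| - (V y - V x)) = (y - x) * (|f x| - (V y - V x)) := by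
      rw [intervalIntegral.integral_const, smul_eq_mul]
    have : ∫ r in x..y, (|f x| - (V y - V x)) ≤ ∫ r in x..y, |f r| := by
      refine intervalIntegral.integral_mono_on hxy (by simp) (hii _ _) fun z hz => ?_
      have h2 := hVd x z hz.1
      have h3 := hVm hz.2
      have h4 := abs_sub_abs_le_abs_sub (f x) (f z)
      rw [abs_sub_comm] at h4
      linarith
    rw [e1] at this
    linarith
  have he1 : |E y - E x| ≤ 2 * K := by
    have := abs_sub (E y) (E x)
    linarith [hK x, hK y]
  have he2 : |E y - E x| ≤ Λ * (y - x) := by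
    have := hE y x
    rwa [abs_of_pos (by linarith : 0 < y - x)] at this
  have hS0 : 0 ≤ S y - S x := by
    rw [hSd]; exact intervalIntegral.integral_nonneg hxy fun _ _ => abs_nonneg _
  have h5 : |f x| * |E y - E x| ≤ Λ * (S y - S x) + 2 * K * (V y - V x) := by
    have hd : 0 < y - x := by linarith
    have h6 : |f x| ≤ (S y - S x) / (y - x) + (V y - V x) := by
      rw [← sub_le_iff_le_add, le_div_iff₀ hd]; linarith
    calc |f x| * |E y - E x| ≤ ((S y - S x) / (y - x) + (V y - V x)) * |E y - E x| := by gcongr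
      _ = (S y - S x) / (y - x) * |E y - E x| + (V y - V x) * |E y - E x| := by ring
      _ ≤ (S y - S x) / (y - x) * (Λ * (y - x)) + (V y - V x) * (2 * K) := by gcongr
      _ = _ := by field_simp
  have e : f y * E y - f x * E x = (f y - f x) * E y + f x * (E y - E x) := by ring
  rw [e]
  refine (abs_add_le _ _).trans ?_
  rw [abs_mul, abs_mul]
  have h7 : |f y - f x| * |E y| ≤ (V y - V x) * K := by
    gcongr
    · exact hVd x y hxy
    · exact hK y
  linarith

lemma abs_exp_neg_sub {a b B : ℝ} (ha : |a| ≤ B) (hb : |b| ≤ B) :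
    |Real.exp (-a) - Real.exp (-b)| ≤ Real.exp B * |a - b| := by
  have := Convex.norm_image_sub_le_of_norm_hasDerivWithin_le (f := fun z => Real.exp (-z))
    (f' := fun z => -Real.exp (-z)) (C := Real.exp B) (s := Icc (-B) B) (x := b) (y := a)
    (fun z _ => by simpa using (hasDerivAt_neg z).exp.hasDerivWithinAt)
    (fun z hz => by
      rw [norm_neg, Real.norm_eq_abs, abs_of_pos (Real.exp_pos _)]
      exact Real.exp_le_exp.2 (by linarith [hz.1])) (convex_Icc _ _) (abs_le.1 hb) (abs_le.1 ha)
  simpa [Real.norm_eq_abs] using this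

/-- transported density -/
def dens (w' X : ℝ → ℝ → ℝ) (t0 : ℝ) (u0 : ℝ → ℝ) (t x : ℝ) : ℝ :=
  u0 (Function.invFun (X t) x) * Real.exp (-IsFlow.lJ w' X t0 t (Function.invFun (X t) x))

namespace IsFlow
variable {w w' X : ℝ → ℝ → ℝ} {M L L2 t0 T : ℝ} {u0 : ℝ → ℝ}

lemma inv_left (hF : IsFlow t0 T w X) (h : NiceField w w' M L L2) {t : ℝ}
    (ht : t ∈ Icc t0 T) (y : ℝ) : Function.invFun (X t) (X t y) = y :=
  Function.leftInverse_invFun (hF.strictMono h ht).injective y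

lemma inv_right (hF : IsFlow t0 T w X) (h : NiceField w w' M L L2) {t : ℝ}
    (ht : t ∈ Icc t0 T) (x : ℝ) : X t (Function.invFun (X t) x) = x :=
  Function.rightInverse_invFun (hF.surj h ht) x

lemma dens_X (hF : IsFlow t0 T w X) (h : NiceField w w' M L L2) {t : ℝ}
    (ht : t ∈ Icc t0 T) (y : ℝ) :
    dens w' X t0 u0 t (X t y) = u0 y * Real.exp (-lJ w' X t0 t y) := by
  rw [dens, hF.inv_left h ht]

lemma inv_mono (hF : IsFlow t0 T w X) (h : NiceField w w' M L L2) {t : ℝ}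
    (ht : t ∈ Icc t0 T) : Monotone (Function.invFun (X t)) := by
  intro a b hab
  rw [← (hF.strictMono h ht).le_iff_le, hF.inv_right h ht, hF.inv_right h ht]
  exact hab

lemma jac (t y : ℝ) (g : ℝ) :
    |Real.exp (lJ w' X t0 t y)| • (g * (u0 y * Real.exp (-lJ w' X t0 t y)))
      = g * u0 y := by
  rw [abs_of_pos (Real.exp_pos _), Real.exp_neg, smul_eq_mul]
  have := (Real.exp_pos (lJ w' X t0 t y)).ne'
  field_simp

lemma cov (hF : IsFlow t0 T w X) (h : NiceField w w' M L L2) {t : ℝ}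
    (ht : t ∈ Icc t0 T) (g : ℝ → ℝ) :
    ∫ x, g x * dens w' X t0 u0 t x = ∫ y, g (X t y) * u0 y := by
  have := integral_image_eq_integral_abs_deriv_smul (f := X t)
    (f' := fun y => Real.exp (lJ w' X t0 t y)) (s := univ) MeasurableSet.univ
    (fun y _ => (hF.hasDeriv h y ht).hasDerivWithinAt) (hF.strictMono h ht).injective.injOn
    (fun x => g x * dens w' X t0 u0 t x)
  rw [image_univ, (hF.surj h ht).range_eq, setIntegral_univ, setIntegral_univ] at this
  rw [this]
  simp only [hF.dens_X h ht, jac]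

lemma cov_abs (hF : IsFlow t0 T w X) (h : NiceField w w' M L L2) {t : ℝ}
    (ht : t ∈ Icc t0 T) (u0 u1 : ℝ → ℝ) :
    ∫ x, |dens w' X t0 u0 t x - dens w' X t0 u1 t x| = ∫ y, |u0 y - u1 y| := by
  have := hF.cov (u0 := fun y => |u0 y - u1 y|) h ht (fun _ => 1)
  simp only [one_mul] at this
  rw [← this]
  congr 1; ext x
  simp only [dens]
  rw [← sub_mul, abs_mul, abs_of_pos (Real.exp_pos _)]

lemma dens_int (hF : IsFlow t0 T w X) (h : NiceField w w' M L L2) {t : ℝ}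
    (ht : t ∈ Icc t0 T) (hu : Integrable u0) : Integrable (dens w' X t0 u0 t) := by
  have := integrableOn_image_iff_integrableOn_abs_deriv_smul (f := X t)
    (f' := fun y => Real.exp (lJ w' X t0 t y)) (s := univ) MeasurableSet.univ
    (fun y _ => (hF.hasDeriv h y ht).hasDerivWithinAt) (hF.strictMono h ht).injective.injOn
    (fun x => 1 * dens w' X t0 u0 t x)
  rw [image_univ, (hF.surj h ht).range_eq, integrableOn_univ, integrableOn_univ] at this
  simp only [hF.dens_X h ht, jac] at this
  simp only [one_mul] at this
  exact this.2 hu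

lemma dens_bv (hF : IsFlow t0 T w X) (h : NiceField w w' M L L2) {t : ℝ}
    (ht : t ∈ Icc t0 T) (hu : Integrable u0) (hbv : BoundedVariationOn u0 univ) :
    BoundedVariationOn (dens w' X t0 u0 t) univ := by
  have hb : BoundedVariationOn (fun y => u0 y * Real.exp (-lJ w' X t0 t y)) univ := by
    refine bv_mul hbv hu (K := Real.exp (L * (T - t0)))
      (Λ := Real.exp (L * (T - t0)) * (L2 * Real.exp (L * (T - t0)) * (T - t0))) (fun y => ?_) fun x y => ?_
    · rw [abs_of_pos (Real.exp_pos _), Real.exp_le_exp]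
      linarith [(abs_le.1 (lJ_bdd (X := X) h y ht)).1]
    · refine (abs_exp_neg_sub (lJ_bdd (X := X) h x ht) (lJ_bdd (X := X) h y ht)).trans ?_
      rw [mul_assoc]
      gcongr
      exact hF.lJ_lipy h x y ht
  have := eVariationOn.comp_le_of_monotoneOn (fun y => u0 y * Real.exp (-lJ w' X t0 t y))
    (s := univ) (t := univ)
    (φ := Function.invFun (X t)) ((hF.inv_mono h ht).monotoneOn univ) (mapsTo_univ _ _)
  exact ne_top_of_le_ne_top hb this

lemma inv_lipt (hF : IsFlow t0 T w X) (h : NiceField w w' M L L2) {s t : ℝ}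
    (hs : s ∈ Icc t0 T) (ht : t ∈ Icc t0 T) (x : ℝ) :
    |Function.invFun (X t) x - Function.invFun (X s) x| ≤
      Real.exp (L * (T - t0)) * (M * |t - s|) := by
  refine (hF.lipinv h _ _ hs).trans ?_
  gcongr
  rw [hF.inv_right h hs]
  have := hF.lipt h (Function.invFun (X t) x) hs ht
  rwa [hF.inv_right h ht, abs_sub_comm] at this

lemma inv_tendsto (hF : IsFlow t0 T w X) (h : NiceField w w' M L L2) {s : ℝ}
    (hs : s ∈ Icc t0 T) (x : ℝ) :
    Tendsto (fun t => Function.invFun (X t) x) (𝓝[Icc t0 T] s) (𝓝 (Function.invFun (X s) x)) := by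
  rw [tendsto_iff_norm_sub_tendsto_zero]
  refine squeeze_zero' (Eventually.of_forall fun _ => norm_nonneg _)
    (g := fun t => Real.exp (L * (T - t0)) * (M * |t - s|)) ?_ ?_
  · filter_upwards [self_mem_nhdsWithin] with t ht using hF.inv_lipt h hs ht x
  · have : Continuous fun t => Real.exp (L * (T - t0)) * (M * |t - s|) := by fun_prop
    simpa using (this.tendsto s).mono_left nhdsWithin_le_nhds

lemma dens_tendsto (hF : IsFlow t0 T w X) (h : NiceField w w' M L L2) {s : ℝ}
    (hs : s ∈ Icc t0 T) (hu : Continuous u0) (x : ℝ) :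
    Tendsto (fun t => dens w' X t0 u0 t x) (𝓝[Icc t0 T] s) (𝓝 (dens w' X t0 u0 s x)) := by
  unfold dens
  have h1 := hF.inv_tendsto h hs x
  refine ((hu.tendsto _).comp h1).mul ((Real.continuous_exp.tendsto _).comp (Tendsto.neg ?_))
  rw [tendsto_iff_norm_sub_tendsto_zero]
  refine squeeze_zero' (Eventually.of_forall fun _ => norm_nonneg _)
    (g := fun t => L2 * Real.exp (L * (T - t0)) * (T - t0) *
      |Function.invFun (X t) x - Function.invFun (X s) x| + L * |t - s|) ?_ ?_
  · filter_upwards [self_mem_nhdsWithin] with t ht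
    have a1 := hF.lJ_lipy h (Function.invFun (X t) x) (Function.invFun (X s) x) ht
    have a2 := hF.lJ_lipt h (Function.invFun (X s) x) s t
    rw [Real.norm_eq_abs]
    exact (abs_sub_le _ _ _).trans (add_le_add a1 a2)
  · have c1 : Continuous fun t => L * |t - s| := by fun_prop
    have c2 := ((h1.sub_const (Function.invFun (X s) x)).abs.const_mul
      (L2 * Real.exp (L * (T - t0)) * (T - t0))).add ((c1.tendsto s).mono_left nhdsWithin_le_nhds)
    simpa using c2

lemma dens_L1_aux (hF : IsFlow t0 T w X) (h : NiceField w w' M L L2) {s : ℝ}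
    (hs : s ∈ Icc t0 T) (hu : Continuous u0) (hc : HasCompactSupport u0) :
    Tendsto (fun t => ∫ x, |dens w' X t0 u0 t x - dens w' X t0 u0 s x|) (𝓝[Icc t0 T] s) (𝓝 0) := by
  have hi : Integrable u0 := hu.integrable_of_hasCompactSupport hc
  obtain ⟨C, hC⟩ := hc.exists_bound_of_continuous hu
  obtain ⟨R, hR⟩ := hc.isCompact.isBounded.subset_closedBall (0:ℝ)
  have hC0 : 0 ≤ C := (norm_nonneg _).trans (hC 0)
  set R' := R + M * (T - t0) with hR'
  have hb : ∀ t ∈ Icc t0 T, ∀ x, |dens w' X t0 u0 t x| ≤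
      (Icc (-R') R').indicator (fun _ => C * Real.exp (L * (T - t0))) x := by
    intro t ht x
    obtain ⟨y, rfl⟩ := hF.surj h ht x
    rw [hF.dens_X h ht]
    by_cases hy : u0 y = 0
    · rw [hy]; simp only [zero_mul, abs_zero]
      exact indicator_nonneg (fun _ _ => by positivity) _
    · have : y ∈ Metric.closedBall (0:ℝ) R := hR (subset_tsupport _ hy)
      rw [mem_closedBall_zero_iff, Real.norm_eq_abs, abs_le] at this
      have h2 := abs_le.1 (hF.near h y ht)
      rw [indicator_of_mem (show X t y ∈ Icc (-R') R' from ⟨by linarith, by linarith⟩), abs_mul, abs_of_pos (Real.exp_pos _)]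
      gcongr
      · exact hC y
      · linarith [(abs_le.1 (lJ_bdd (X := X) h y ht)).1]
  have : (0:ℝ) = ∫ x : ℝ, (0:ℝ) := by simp
  rw [this]
  refine tendsto_integral_filter_of_dominated_convergence
    (fun x => (Icc (-R') R').indicator (fun _ => C * Real.exp (L * (T - t0))) x
      + (Icc (-R') R').indicator (fun _ => C * Real.exp (L * (T - t0))) x) ?_ ?_ ?_ ?_
  · filter_upwards [self_mem_nhdsWithin] with t ht
    exact ((hF.dens_int h ht hi).sub (hF.dens_int h hs hi)).abs.aestronglyMeasurable
  · filter_upwards [self_mem_nhdsWithin] with t ht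
    refine Eventually.of_forall fun x => ?_
    rw [Real.norm_eq_abs, abs_abs]
    refine (abs_sub _ _).trans (add_le_add (hb t ht x) (hb s hs x))
  · have : Integrable ((Icc (-R') R').indicator (fun _ : ℝ => C * Real.exp (L * (T - t0)))) :=
      (integrable_indicator_iff measurableSet_Icc).2 (integrableOn_const (by simp))
    exact this.add this
  · refine Eventually.of_forall fun x => ?_
    have := ((hF.dens_tendsto h hs hu x).sub_const (dens w' X t0 u0 s x)).abs
    simpa using this

lemma dens_L1 (hF : IsFlow t0 T w X) (h : NiceField w w' M L L2) {s : ℝ}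
    (hs : s ∈ Icc t0 T) (hu : Integrable u0) :
    Tendsto (fun t => ∫ x, |dens w' X t0 u0 t x - dens w' X t0 u0 s x|) (𝓝[Icc t0 T] s) (𝓝 0) := by
  rw [Metric.tendsto_nhds]
  intro ε hε
  obtain ⟨g, hgc, hg, hgcont, hgi⟩ := hu.exists_hasCompactSupport_integral_sub_le
    (show 0 < ε / 4 by positivity)
  have h1 := (Metric.tendsto_nhds.1 (hF.dens_L1_aux h hs hgcont hgc)) (ε / 4) (by positivity)
  filter_upwards [h1, self_mem_nhdsWithin] with t h1 ht
  rw [Real.dist_eq, sub_zero, abs_of_nonneg (integral_nonneg fun _ => abs_nonneg _)] at h1 ⊢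
  have a1 := hF.cov_abs h ht u0 g
  have a2 := hF.cov_abs h hs u0 g
  simp only [Real.norm_eq_abs] at hg
  have i1 : Integrable (fun x => |dens w' X t0 u0 t x - dens w' X t0 g t x|) :=
    ((hF.dens_int h ht hu).sub (hF.dens_int h ht hgi)).abs
  have i2 : Integrable (fun x => |dens w' X t0 g t x - dens w' X t0 g s x|) :=
    ((hF.dens_int h ht hgi).sub (hF.dens_int h hs hgi)).abs
  have i3 : Integrable (fun x => |dens w' X t0 u0 s x - dens w' X t0 g s x|) :=
    ((hF.dens_int h hs hu).sub (hF.dens_int h hs hgi)).abs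
  have i12 : Integrable (fun x => |dens w' X t0 u0 t x - dens w' X t0 g t x| + |dens w' X t0 g t x - dens w' X t0 g s x|) := i1.add i2
  calc ∫ x, |dens w' X t0 u0 t x - dens w' X t0 u0 s x|
      ≤ ∫ x, (|dens w' X t0 u0 t x - dens w' X t0 g t x| +
          |dens w' X t0 g t x - dens w' X t0 g s x| +
          |dens w' X t0 u0 s x - dens w' X t0 g s x|) := by
        refine integral_mono ((hF.dens_int h ht hu).sub (hF.dens_int h hs hu)).abs
          (i12.add i3) fun x => ?_
        simp only
        have b1 := abs_sub_le (dens w' X t0 u0 t x) (dens w' X t0 g t x) (dens w' X t0 u0 s x)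
        have b2 := abs_sub_le (dens w' X t0 g t x) (dens w' X t0 g s x) (dens w' X t0 u0 s x)
        rw [abs_sub_comm (dens w' X t0 g s x)] at b2
        linarith
    _ = (∫ x, |dens w' X t0 u0 t x - dens w' X t0 g t x|) +
          (∫ x, |dens w' X t0 g t x - dens w' X t0 g s x|) +
          ∫ x, |dens w' X t0 u0 s x - dens w' X t0 g s x| := by
        rw [integral_add i12 i3, integral_add i1 i2]
    _ < ε := by rw [a1, a2]; linarith

end IsFlow

/-- clamp to the interval -/
def clamp (t0 T t : ℝ) : ℝ := max t0 (min T t)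

lemma clamp_cont (t0 T : ℝ) : Continuous (clamp t0 T) := by unfold clamp; fun_prop
lemma clamp_mem {t0 T : ℝ} (h : t0 ≤ T) (t : ℝ) : clamp t0 T t ∈ Icc t0 T :=
  ⟨le_max_left _ _, max_le h (min_le_left _ _)⟩
lemma clamp_eq {t0 T t : ℝ} (h : t ∈ Icc t0 T) : clamp t0 T t = t := by
  unfold clamp; rw [min_eq_right h.2, max_eq_right h.1]

lemma derivs_of_smooth {φ : ℝ → ℝ → ℝ} (h : ContDiff ℝ (⊤ : ℕ∞) (Function.uncurry φ))
    (hc : HasCompactSupport (Function.uncurry φ)) :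
    (∀ t x, HasFDerivAt (Function.uncurry φ) (fderiv ℝ (Function.uncurry φ) (t, x)) (t, x)) ∧
    (∀ t x, deriv (fun s => φ s x) t = fderiv ℝ (Function.uncurry φ) (t, x) (1, 0)) ∧
    (∀ t x, deriv (fun y => φ t y) x = fderiv ℝ (Function.uncurry φ) (t, x) (0, 1)) ∧
    Continuous (fderiv ℝ (Function.uncurry φ)) ∧
    ∃ C, ∀ p, ‖fderiv ℝ (Function.uncurry φ) p‖ ≤ C := by
  have hd : ∀ t x, HasFDerivAt (Function.uncurry φ) (fderiv ℝ (Function.uncurry φ) (t, x)) (t, x) :=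
    fun t x => (h.differentiable (by simp)).differentiableAt.hasFDerivAt
  have hcont : Continuous (fderiv ℝ (Function.uncurry φ)) := h.continuous_fderiv (by simp)
  refine ⟨hd, fun t x => ?_, fun t x => ?_, hcont, ?_⟩
  · have := (hd t x).comp_hasDerivAt t ((hasDerivAt_id t).prodMk (hasDerivAt_const t x))
    exact this.deriv
  · have := (hd t x).comp_hasDerivAt x ((hasDerivAt_const x t).prodMk (hasDerivAt_id x))
    exact this.deriv
  · exact (hc.fderiv (𝕜 := ℝ)).exists_bound_of_continuous hcont

namespace IsFlow
variable {w w' X : ℝ → ℝ → ℝ} {M L L2 t0 T : ℝ} {u0 : ℝ → ℝ}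

lemma cont2 (hF : IsFlow t0 T w X) (h : NiceField w w' M L L2) (hT : t0 ≤ T) :
    Continuous (fun p : ℝ × ℝ => X (clamp t0 T p.1) p.2) := by
  refine continuous_prod_of_continuous_lipschitzWith' (fun p : ℝ × ℝ => X (clamp t0 T p.1) p.2)
    (Real.exp (L * (T - t0))).toNNReal (fun a => ?_) (fun b => (hF.cont b).comp (clamp_cont t0 T))
  refine LipschitzWith.of_dist_le_mul fun x y => ?_
  rw [Real.coe_toNNReal _ (Real.exp_pos _).le]
  simpa [Real.dist_eq] using hF.lipy h x y (clamp_mem hT a)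

lemma weak (hF : IsFlow t0 T w X) (h : NiceField w w' M L L2) (hT : t0 ≤ T)
    (hu : Integrable u0) : IsWeakSol t0 T w u0 (dens w' X t0 u0) := by
  intro φ hφ hφc hφT
  obtain ⟨hd, hdt, hdx, hcont, C, hC⟩ := derivs_of_smooth hφ hφc
  simp only [hdt, hdx]
  set D := fderiv ℝ (Function.uncurry φ) with hD
  set f : ℝ → ℝ → ℝ := fun t x => D (t, x) (1, 0) + w t x * D (t, x) (0, 1) with hf
  have hfc : Continuous (fun p : ℝ × ℝ => f p.1 p.2) := by
    have := h.cont2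
    have h1 : Continuous fun p : ℝ × ℝ => D p (1, 0) := hcont.clm_apply continuous_const
    have h2 : Continuous fun p : ℝ × ℝ => D p (0, 1) := hcont.clm_apply continuous_const
    exact h1.add (this.mul h2)
  have hC0 : 0 ≤ C := (norm_nonneg _).trans (hC (0, 0))
  have hfb : ∀ t x, |f t x| ≤ C + M * C := by
    intro t x
    have b1 : |D (t, x) (1, 0)| ≤ C := by
      have := (D (t, x)).le_opNorm ((1, 0) : ℝ × ℝ)
      simp [Prod.norm_def] at this
      exact this.trans (hC _)
    have b2 : |D (t, x) (0, 1)| ≤ C := by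
      have := (D (t, x)).le_opNorm ((0, 1) : ℝ × ℝ)
      simp [Prod.norm_def] at this
      exact this.trans (hC _)
    refine (abs_add_le _ _).trans (add_le_add b1 ?_)
    rw [abs_mul]
    exact mul_le_mul (h.bdd t x) b2 (abs_nonneg _) h.M0
  set g : ℝ → ℝ → ℝ := fun t y => f t (X (clamp t0 T t) y) with hg
  have hgc : Continuous (fun p : ℝ × ℝ => g p.1 p.2) :=
    hfc.comp (continuous_fst.prodMk (hF.cont2 h hT))
  have e1 : (∫ t in Icc t0 T, ∫ x, dens w' X t0 u0 t x * (D (t, x) (1, 0) + w t x * D (t, x) (0, 1)))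
      = ∫ t in Icc t0 T, ∫ y, g t y * u0 y := by
    refine setIntegral_congr_fun measurableSet_Icc fun t ht => ?_
    simp only [hg, clamp_eq ht]
    rw [← hF.cov h ht]
    simp only [hf, mul_comm]
  have hint : Integrable (fun p : ℝ × ℝ => g p.1 p.2 * u0 p.2)
      ((volume.restrict (Icc t0 T)).prod volume) := by
    have : Integrable (fun p : ℝ × ℝ => u0 p.2) ((volume.restrict (Icc t0 T)).prod volume) :=
      hu.comp_snd _
    exact this.bdd_mul hgc.aestronglyMeasurable (Eventually.of_forall fun p => hfb _ _)
  rw [e1, integral_integral_swap (f := fun t y => g t y * u0 y) hint, ← eq_neg_iff_add_eq_zero, ← integral_neg]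
  congr 1; ext y
  rw [integral_mul_const, integral_Icc_eq_integral_Ioc, ← intervalIntegral.integral_of_le hT]
  have : ∫ t in t0..T, g t y = φ T (X T y) - φ t0 (X t0 y) := by
    refine intervalIntegral.integral_eq_sub_of_hasDerivAt (f := fun t => φ t (X t y)) ?_ ?_
    · intro t ht
      rw [uIcc_of_le hT] at ht
      have := (hd t (X t y)).comp_hasDerivAt t ((hasDerivAt_id t).prodMk (hF.der y t ht))
      refine this.congr_deriv ?_
      simp only [hg, hf, clamp_eq ht]
      have e : ((1:ℝ), w t (X t y)) = (1, 0) + (w t (X t y)) • ((0:ℝ), (1:ℝ)) := by simp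
      rw [e, map_add, map_smul, smul_eq_mul]
    · exact (hgc.comp (Continuous.prodMk_left y)).intervalIntegrable _ _
  rw [this, hφT T le_rfl, hF.init]
  ring

end IsFlow

namespace W2infBound
variable {κ : ℝ → ℝ} {C : ℝ}

lemma C0 (h : W2infBound κ C) : 0 ≤ C := (abs_nonneg _).trans (h.2 0).1
lemma cont (h : W2infBound κ C) : Continuous κ := h.1.continuous
lemma dcont (h : W2infBound κ C) : Continuous (deriv κ) := h.1.continuous_deriv (by norm_num)
lemma hasDer (h : W2infBound κ C) (x : ℝ) : HasDerivAt κ (deriv κ x) x :=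
  (h.1.differentiable (by norm_num)).differentiableAt.hasDerivAt
lemma lip (h : W2infBound κ C) (x y : ℝ) : |κ x - κ y| ≤ C * |x - y| := by
  have := Convex.norm_image_sub_le_of_norm_hasDerivWithin_le (f := κ) (f' := deriv κ) (C := C)
    (s := univ) (x := y) (y := x) (fun z _ => (h.hasDer z).hasDerivWithinAt)
    (fun z _ => (h.2 z).2.1) convex_univ trivial trivial
  simpa using this
lemma dlip (h : W2infBound κ C) (x y : ℝ) : |deriv κ x - deriv κ y| ≤ C * |x - y| := by
  have h1 : ContDiff ℝ 1 (deriv κ) := by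
    have := h.1
    rw [show (2 : WithTop ℕ∞) = 1 + 1 by norm_num, contDiff_succ_iff_deriv] at this
    exact this.2.2
  have := Convex.norm_image_sub_le_of_norm_hasDerivWithin_le (f := deriv κ) (f' := deriv (deriv κ))
    (C := C) (s := univ) (x := y) (y := x)
    (fun z _ => ((h1.differentiable (by norm_num)).differentiableAt.hasDerivAt).hasDerivWithinAt)
    (fun z _ => (h.2 z).2.2) convex_univ trivial trivial
  simpa using this
end W2infBound

lemma int_bdd_mul {k r : ℝ → ℝ} {C : ℝ} (hk : ∀ z, |k z| ≤ C)
    (hr : Integrable r) : |∫ z, k z * r z| ≤ C * ∫ z, |r z| := by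
  rw [← integral_const_mul]
  refine norm_integral_le_of_norm_le (f := fun z => k z * r z) (hr.abs.const_mul C)
    (Eventually.of_forall fun z => ?_)
  rw [norm_mul]
  exact mul_le_mul_of_nonneg_right (hk z) (abs_nonneg _)

lemma intble_bdd_mul {k r : ℝ → ℝ} {C : ℝ} (hkm : Measurable k) (hk : ∀ z, |k z| ≤ C)
    (hr : Integrable r) : Integrable (fun z => k z * r z) :=
  hr.bdd_mul (c := C) hkm.aestronglyMeasurable (Eventually.of_forall hk)

section
variable {κ Ξ r : ℝ → ℝ} {C : ℝ}

lemma conv_int (h : W2infBound κ C) (hΞ : Measurable Ξ) (hr : Integrable r) (x : ℝ) :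
    Integrable fun z => κ (x - Ξ z) * r z :=
  intble_bdd_mul (h.cont.measurable.comp (measurable_const.sub hΞ)) (fun z => (h.2 _).1) hr

lemma conv_dint (h : W2infBound κ C) (hΞ : Measurable Ξ) (hr : Integrable r) (x : ℝ) :
    Integrable fun z => deriv κ (x - Ξ z) * r z :=
  intble_bdd_mul (h.dcont.measurable.comp (measurable_const.sub hΞ)) (fun z => (h.2 _).2.1) hr

lemma conv_bdd (h : W2infBound κ C) (hr : Integrable r) (x : ℝ) :
    |∫ z, κ (x - Ξ z) * r z| ≤ C * ∫ z, |r z| := int_bdd_mul (fun z => (h.2 _).1) hr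

lemma conv_dbdd (h : W2infBound κ C) (hr : Integrable r) (x : ℝ) :
    |∫ z, deriv κ (x - Ξ z) * r z| ≤ C * ∫ z, |r z| := int_bdd_mul (fun z => (h.2 _).2.1) hr

lemma conv_dlip (h : W2infBound κ C) (hΞ : Measurable Ξ) (hr : Integrable r) (x y : ℝ) :
    |(∫ z, deriv κ (x - Ξ z) * r z) - ∫ z, deriv κ (y - Ξ z) * r z|
      ≤ C * (∫ z, |r z|) * |x - y| := by
  rw [← integral_sub (conv_dint h hΞ hr x) (conv_dint h hΞ hr y)]
  simp only [← sub_mul]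
  refine (int_bdd_mul (C := C * |x - y|) (fun z => ?_) hr).trans (le_of_eq (by ring))
  simpa using h.dlip (x - Ξ z) (y - Ξ z)

lemma conv_der (h : W2infBound κ C) (hΞ : Measurable Ξ) (hr : Integrable r) (x : ℝ) :
    HasDerivAt (fun x => ∫ z, κ (x - Ξ z) * r z) (∫ z, deriv κ (x - Ξ z) * r z) x := by
  refine (hasDerivAt_integral_of_dominated_loc_of_deriv_le (F := fun x z => κ (x - Ξ z) * r z)
    (F' := fun x z => deriv κ (x - Ξ z) * r z) (bound := fun z => C * |r z|)
    (Metric.ball_mem_nhds x one_pos)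
    (Eventually.of_forall fun y => (conv_int h hΞ hr y).aestronglyMeasurable)
    (conv_int h hΞ hr x) (conv_dint h hΞ hr x).aestronglyMeasurable
    (Eventually.of_forall fun z y _ => ?_) (hr.abs.const_mul C)
    (Eventually.of_forall fun z y _ => ?_)).2
  · rw [norm_mul]
    exact mul_le_mul_of_nonneg_right (h.2 _).2.1 (abs_nonneg _)
  · have := (h.hasDer (y - Ξ z)).comp y ((hasDerivAt_id y).sub_const (Ξ z))
    simpa using this.mul_const (r z)

lemma conv_lip (h : W2infBound κ C) (hΞ : Measurable Ξ) (hr : Integrable r) (x y : ℝ) :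
    |(∫ z, κ (x - Ξ z) * r z) - ∫ z, κ (y - Ξ z) * r z|
      ≤ C * (∫ z, |r z|) * |x - y| := by
  rw [← integral_sub (conv_int h hΞ hr x) (conv_int h hΞ hr y)]
  simp only [← sub_mul]
  refine (int_bdd_mul (C := C * |x - y|) (fun z => ?_) hr).trans (le_of_eq (by ring))
  simpa using h.lip (x - Ξ z) (y - Ξ z)

lemma conv_lipΞ {Ξ' : ℝ → ℝ} {D : ℝ} (h : W2infBound κ C) (hΞ : Measurable Ξ)
    (hΞ' : Measurable Ξ') (hr : Integrable r) (hD : ∀ z, |Ξ z - Ξ' z| ≤ D) (x : ℝ) :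
    |(∫ z, κ (x - Ξ z) * r z) - ∫ z, κ (x - Ξ' z) * r z|
      ≤ C * (∫ z, |r z|) * D := by
  rw [← integral_sub (conv_int h hΞ hr x) (conv_int h hΞ' hr x)]
  simp only [← sub_mul]
  refine (int_bdd_mul (C := C * D) (fun z => ?_) hr).trans (le_of_eq (by ring))
  refine (h.lip (x - Ξ z) (x - Ξ' z)).trans ?_
  have := h.C0
  gcongr
  rw [abs_sub_comm]
  simpa using hD z

lemma conv_lipr {r' : ℝ → ℝ} (h : W2infBound κ C) (hΞ : Measurable Ξ)
    (hr : Integrable r) (hr' : Integrable r') (x : ℝ) :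
    |(∫ z, κ (x - Ξ z) * r z) - ∫ z, κ (x - Ξ z) * r' z|
      ≤ C * (∫ z, |r z - r' z|) := by
  rw [← integral_sub (conv_int h hΞ hr x) (conv_int h hΞ hr' x)]
  simp only [← mul_sub]
  exact int_bdd_mul (fun z => (h.2 _).1) (hr.sub hr')
end

/-- globally L1-continuous curve -/
structure L1c (u : ℝ → ℝ → ℝ) : Prop where
  int : ∀ t, Integrable (u t)
  cont : ∀ t, Tendsto (fun s => ∫ z, |u s z - u t z|) (𝓝 t) (𝓝 0)

lemma L1c.contInt {u : ℝ → ℝ → ℝ} (hu : L1c u) {α : Type*} [TopologicalSpace α]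
    [FirstCountableTopology α] {τ : α → ℝ} (hτ : Continuous τ) {g : α → ℝ → ℝ} {C : ℝ}
    (hgm : ∀ a, Measurable (g a)) (hgb : ∀ a z, |g a z| ≤ C)
    (hgc : ∀ z, Continuous fun a => g a z) : Continuous fun a => ∫ z, g a z * u (τ a) z := by
  rw [continuous_iff_continuousAt]
  intro a
  have hint : ∀ b c, Integrable fun z => g b z * u (τ c) z := fun b c =>
    intble_bdd_mul (hgm b) (hgb b) (hu.int _)
  have e : (fun b => ∫ z, g b z * u (τ b) z) = fun b =>
      (∫ z, g b z * (u (τ b) z - u (τ a) z)) + ∫ z, g b z * u (τ a) z := by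
    ext b
    rw [← integral_add]
    · congr 1; ext z; ring
    · exact intble_bdd_mul (hgm b) (hgb b) ((hu.int _).sub (hu.int _))
    · exact hint _ _
  have h1 : Tendsto (fun b => ∫ z, g b z * (u (τ b) z - u (τ a) z)) (𝓝 a) (𝓝 0) := by
    refine squeeze_zero_norm (a := fun b => C * ∫ z, |u (τ b) z - u (τ a) z|) (fun b => ?_) ?_
    · exact int_bdd_mul (hgb b) ((hu.int _).sub (hu.int _))
    · simpa using ((hu.cont (τ a)).comp (hτ.tendsto a)).const_mul C
  have h2 : Tendsto (fun b => ∫ z, g b z * u (τ a) z) (𝓝 a) (𝓝 (∫ z, g a z * u (τ a) z)) := by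
    refine tendsto_integral_filter_of_dominated_convergence (fun z => C * |u (τ a) z|)
      (Eventually.of_forall fun b => (hint b a).aestronglyMeasurable)
      (Eventually.of_forall fun b => Eventually.of_forall fun z => ?_)
      ((hu.int _).abs.const_mul C) (Eventually.of_forall fun z => ?_)
    · rw [norm_mul]; exact mul_le_mul_of_nonneg_right (hgb b z) (abs_nonneg _)
    · exact ((hgc z).tendsto a).mul_const _
  unfold ContinuousAt
  rw [e]
  simpa using h1.add h2

lemma weak_int {w w' u : ℝ → ℝ → ℝ} {M L L2 t0 T : ℝ} {u0 ψ : ℝ → ℝ}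
    (h : NiceField w w' M L L2) (hT : t0 < T) (hu : L1c u)
    (hw : IsWeakSol t0 T w u0 u) (hψ : ContDiff ℝ (⊤ : ℕ∞) ψ) (hψc : HasCompactSupport ψ)
    {t : ℝ} (ht : t ∈ Icc t0 T) :
    ∫ z, ψ z * u t z = (∫ z, ψ z * u0 z) + ∫ s in t0..t, ∫ z, (w s z * deriv ψ z) * u s z := by
  have hdc : Continuous (deriv ψ) := hψ.continuous_deriv (by norm_num)
  obtain ⟨C, hC⟩ := hψc.exists_bound_of_continuous hψ.continuous
  obtain ⟨C', hC'⟩ := hψc.deriv.exists_bound_of_continuous hdc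
  set A : ℝ → ℝ := fun t => ∫ z, ψ z * u t z with hA
  set B : ℝ → ℝ := fun t => ∫ z, (w t z * deriv ψ z) * u t z with hB
  have hwz : ∀ s, Continuous (w s) := fun s =>
    h.cont2.comp (continuous_const.prodMk continuous_id)
  have hbb : ∀ s z, |w s z * deriv ψ z| ≤ M * C' := fun s z => by
    rw [abs_mul]; exact mul_le_mul (h.bdd s z) (hC' z) (abs_nonneg _) h.M0
  have hAc : Continuous A := hu.contInt continuous_id (g := fun _ z => ψ z)
    (fun _ => hψ.continuous.measurable) (fun _ => hC) (fun _ => continuous_const)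
  have hBc : Continuous B := hu.contInt continuous_id (g := fun s z => w s z * deriv ψ z)
    (fun s => ((hwz s).mul hdc).measurable) hbb
    (fun z => (h.cont z).mul continuous_const)
  set A0 := ∫ z, ψ z * u0 z
  set H : ℝ → ℝ := fun t => A0 + ∫ s in t0..t, B s with hH
  have hHd : ∀ t, HasDerivAt H (B t) t := fun t =>
    (intervalIntegral.integral_hasDerivAt_right (hBc.intervalIntegrable _ _)
      (hBc.stronglyMeasurableAtFilter _ _) hBc.continuousAt).const_add A0
  have hHc : Continuous H := continuous_iff_continuousAt.2 fun t => (hHd t).continuousAt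
  -- the key identity
  have key : ∀ θ : ℝ → ℝ, ContDiff ℝ (⊤ : ℕ∞) θ → HasCompactSupport θ → (∀ t, T ≤ t → θ t = 0) →
      ∫ t in t0..T, deriv θ t * (A t - H t) = 0 := by
    intro θ hθ hθc hθT
    have hθd : ∀ s, HasDerivAt θ (deriv θ s) s := fun s =>
      (hθ.differentiable (by norm_num)).differentiableAt.hasDerivAt
    have hθdc : Continuous (deriv θ) := hθ.continuous_deriv (by norm_num)
    have := hw (fun t x => θ t * ψ x)
      ((hθ.comp contDiff_fst).mul (hψ.comp contDiff_snd))
      (by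
        refine HasCompactSupport.intro (hθc.isCompact.prod hψc.isCompact) fun p hp => ?_
        rw [mem_prod, not_and_or] at hp
        rcases hp with hp | hp
        · simp [Function.uncurry, image_eq_zero_of_notMem_tsupport hp]
        · simp [Function.uncurry, image_eq_zero_of_notMem_tsupport hp])
      (fun t ht x => by simp [hθT t ht])
    have e1 : ∀ t, (∫ x, u t x * (deriv (fun s => θ s * ψ x) t + w t x * deriv (fun y => θ t * ψ y) x))
        = deriv θ t * A t + θ t * B t := by
      intro t
      simp only [deriv_const_mul_field, deriv_mul_const_field, hA, hB]
      rw [← integral_const_mul, ← integral_const_mul, ← integral_add]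
      · congr 1; ext z; ring
      · exact (intble_bdd_mul hψ.continuous.measurable hC (hu.int t)).const_mul _
      · exact (intble_bdd_mul ((hwz t).mul hdc).measurable (hbb t) (hu.int t)).const_mul _
    have e2 : ∫ x, u0 x * (θ t0 * ψ x) = θ t0 * A0 := by
      rw [← integral_const_mul]; congr 1; ext z; ring
    simp only [e1, e2] at this
    rw [integral_Icc_eq_integral_Ioc, ← intervalIntegral.integral_of_le hT.le] at this
    have ibp : ∫ t in t0..T, (deriv θ t * H t + θ t * B t) = θ T * H T - θ t0 * H t0 :=
      intervalIntegral.integral_eq_sub_of_hasDerivAt (fun t _ => (hθd t).mul (hHd t))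
        (((hθdc.mul hHc).add (hθ.continuous.mul hBc)).intervalIntegrable _ _)
    have hH0 : H t0 = A0 := by simp [hH]
    rw [hθT T le_rfl, hH0] at ibp
    have : (∫ t in t0..T, (deriv θ t * A t + θ t * B t)) - (∫ t in t0..T, (deriv θ t * H t + θ t * B t)) = 0 := by
      rw [ibp]; linarith
    have c1 : Continuous fun t => deriv θ t * A t + θ t * B t :=
      (hθdc.mul hAc).add (hθ.continuous.mul hBc)
    have c2 : Continuous fun t => deriv θ t * H t + θ t * B t :=
      (hθdc.mul hHc).add (hθ.continuous.mul hBc)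
    rw [← intervalIntegral.integral_sub (c1.intervalIntegrable _ _)
      (c2.intervalIntegrable _ _)] at this
    rw [← this]
    congr 1; ext s; ring
  have ae : ∀ᵐ s, s ∈ Ioo t0 T → A s - H s = 0 := by
    refine isOpen_Ioo.ae_eq_zero_of_integral_contDiff_smul_eq_zero
      ((hAc.sub hHc).locallyIntegrable.locallyIntegrableOn _) fun g hg hgc hgs => ?_
    have hg0 : ∀ s, s ∉ Ioo t0 T → g s = 0 := fun s hs =>
      image_eq_zero_of_notMem_tsupport fun h' => hs (hgs h')
    set G : ℝ → ℝ := fun t => ∫ s in T..t, g s with hG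
    have hGd : ∀ t, HasDerivAt G (g t) t := fun t =>
      intervalIntegral.integral_hasDerivAt_right (hg.continuous.intervalIntegrable _ _)
      (hg.continuous.stronglyMeasurableAtFilter _ _) hg.continuous.continuousAt
    have hGs : ContDiff ℝ (⊤ : ℕ∞) G := by
      rw [contDiff_infty_iff_deriv]
      refine ⟨fun t => (hGd t).differentiableAt, ?_⟩
      have : deriv G = g := funext fun t => (hGd t).deriv
      rw [this]; exact hg
    have hGT : ∀ t, T ≤ t → G t = 0 := by
      intro t ht
      simp only [hG]
      rw [intervalIntegral.integral_congr (g := fun _ => 0)]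
      · simp
      · intro s hs
        rw [uIcc_of_le ht] at hs
        exact hg0 s fun h' => absurd h'.2 (not_lt.2 hs.1)
    have hχ : ContDiff ℝ (⊤ : ℕ∞) (fun t : ℝ => Real.smoothTransition (t - t0 + 2)) :=
      Real.smoothTransition.contDiff.comp ((contDiff_id.sub contDiff_const).add contDiff_const)
    have k := key (fun t => Real.smoothTransition (t - t0 + 2) * G t) (hχ.mul hGs)
      (HasCompactSupport.intro (isCompact_Icc (a := t0 - 2) (b := T)) fun t ht => by
        rw [mem_Icc, not_and_or, not_le, not_le] at ht
        rcases ht with ht | ht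
        · rw [Real.smoothTransition.zero_of_nonpos (by linarith), zero_mul]
        · rw [hGT t ht.le, mul_zero])
      (fun t ht => by rw [hGT t ht, mul_zero])
    rw [intervalIntegral.integral_congr (g := fun s => g s * (A s - H s))] at k
    · rw [intervalIntegral.integral_of_le hT.le] at k
      rw [setIntegral_eq_integral_of_forall_compl_eq_zero] at k
      · exact k
      · intro s hs
        rw [hg0 s fun h' => hs (Ioo_subset_Ioc_self h'), zero_mul]
    · intro s hs
      rw [uIcc_of_le hT.le] at hs
      have : (fun t => Real.smoothTransition (t - t0 + 2) * G t) =ᶠ[𝓝 s] G := by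
        filter_upwards [lt_mem_nhds (show t0 - 1 < s by linarith [hs.1])] with r hr
        rw [Real.smoothTransition.one_of_one_le (by linarith), one_mul]
      simp only
      rw [this.deriv_eq, (hGd s).deriv]
  have ae2 : A =ᵐ[volume.restrict (Icc t0 T)] H := by
    rw [restrict_Ioo_eq_restrict_Icc.symm, Filter.EventuallyEq, ae_restrict_iff' measurableSet_Ioo]
    filter_upwards [ae] with s hs h'
    linarith [hs h']
  exact Measure.eqOn_Icc_of_ae_eq volume hT.ne ae2 hAc.continuousOn hHc.continuousOn ht

lemma flow_kernel {w w' X u : ℝ → ℝ → ℝ} {M L L2 t0 T : ℝ} {u0 κ : ℝ → ℝ} {C R : ℝ}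
    (h : NiceField w w' M L L2) (hF : IsFlow t0 T w X) (hT : t0 < T) (hu : L1c u)
    (hw : IsWeakSol t0 T w u0 u) (hκ : ContDiff ℝ (⊤ : ℕ∞) κ) (hκC : W2infBound κ C)
    (hκ0 : ∀ x, x ≤ 0 → κ x = 0) (hκ1 : ∀ x, R ≤ x → κ x = 1)
    (a b : ℝ) {t : ℝ} (ht : t ∈ Icc t0 T) :
    ∫ z, (κ (X t b - z) - κ (X t a - z)) * u t z = (∫ z, (κ (b - z) - κ (a - z)) * u0 z)
      + ∫ s in t0..t, ((∫ z, ((w s (X s b) - w s z) * deriv κ (X s b - z)) * u s z)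
          - ∫ z, ((w s (X s a) - w s z) * deriv κ (X s a - z)) * u s z) := by
  have hwz : ∀ s, Continuous (w s) := fun s =>
    h.cont2.comp (continuous_const.prodMk continuous_id)
  have hψ : ∀ x c, ContDiff ℝ (⊤ : ℕ∞) fun z => κ (x - z) - κ (c - z) := fun x c =>
    (hκ.comp (contDiff_const.sub contDiff_id)).sub (hκ.comp (contDiff_const.sub contDiff_id))
  have hψc : ∀ x c, HasCompactSupport fun z => κ (x - z) - κ (c - z) := by
    intro x c
    refine HasCompactSupport.intro (isCompact_Icc (a := min x c - R) (b := max x c)) fun z hz => ?_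
    rw [mem_Icc, not_and_or, not_le, not_le] at hz
    rcases hz with hz | hz
    · rw [hκ1 _ (by linarith [min_le_left x c]), hκ1 _ (by linarith [min_le_right x c]), sub_self]
    · rw [hκ0 _ (by linarith [le_max_left x c]), hκ0 _ (by linarith [le_max_right x c]), sub_self]
  have hψd : ∀ x c z, deriv (fun z => κ (x - z) - κ (c - z)) z = deriv κ (c - z) - deriv κ (x - z) := by
    intro x c z
    have h1 : ∀ y, HasDerivAt (fun z => κ (y - z)) (- deriv κ (y - z)) z := fun y => by
      have := (hκC.hasDer (y - z)).comp z ((hasDerivAt_id z).const_sub y)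
      exact this.congr_deriv (by simp)
    have h2 : HasDerivAt (fun z => κ (x - z) - κ (c - z)) _ z := (h1 x).sub (h1 c)
    rw [h2.deriv]; ring
  set Φ : ℝ → ℝ → ℝ := fun t x => ∫ z, (κ (x - z) - κ (0 - z)) * u t z with hΦ
  set f1 : ℝ → ℝ → ℝ := fun t x => ∫ z, (w t z * (deriv κ (0 - z) - deriv κ (x - z))) * u t z with hf1
  set f2 : ℝ → ℝ → ℝ := fun t x => ∫ z, deriv κ (x - z) * u t z with hf2
  have hdk : ∀ x, |deriv κ x| ≤ C := fun x => (hκC.2 x).2.1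
  have hm : ∀ x, Measurable fun z => deriv κ (x - z) := fun x =>
    (hκC.dcont.comp (continuous_const.sub continuous_id)).measurable
  have hm0 : ∀ x, Measurable fun z => κ (x - z) := fun x =>
    (hκC.cont.comp (continuous_const.sub continuous_id)).measurable
  have hdb : ∀ x c z, |deriv κ (c - z) - deriv κ (x - z)| ≤ 2 * C := fun x c z => by
    have := abs_sub (deriv κ (c - z)) (deriv κ (x - z)); linarith [hdk (c - z), hdk (x - z)]
  have f1c : Continuous fun p : ℝ × ℝ => f1 p.1 p.2 := by
    refine hu.contInt continuous_fst
      (g := fun (p : ℝ × ℝ) z => w p.1 z * (deriv κ (0 - z) - deriv κ (p.2 - z)))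
      (C := M * (2 * C)) (fun p => ?_) (fun p z => ?_) (fun z => ?_)
    · exact (hwz p.1).measurable.mul ((hm 0).sub (hm p.2))
    · rw [abs_mul]; exact mul_le_mul (h.bdd _ _) (hdb _ _ _) (abs_nonneg _) h.M0
    · refine ((h.cont z).comp continuous_fst).mul (continuous_const.sub
        (hκC.dcont.comp (continuous_snd.sub continuous_const)))
  have f2c : Continuous fun p : ℝ × ℝ => f2 p.1 p.2 := by
    refine hu.contInt continuous_fst (g := fun (p : ℝ × ℝ) z => deriv κ (p.2 - z))
      (C := C) (fun p => hm p.2) (fun p z => hdk _) (fun z => ?_)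
    exact hκC.dcont.comp (continuous_snd.sub continuous_const)
  have intκ : ∀ x t, Integrable fun z => κ (x - z) * u t z := fun x t =>
    conv_int hκC measurable_id (hu.int t) x
  have Φeq : ∀ t x, Φ t x = (∫ z, κ (x - z) * u t z) - ∫ z, κ (0 - z) * u t z := by
    intro t x
    rw [← integral_sub (intκ _ _) (intκ _ _)]
    simp only [hΦ, sub_mul]
  have d2 : ∀ t x, HasDerivAt (fun x => Φ t x) (f2 t x) x := by
    intro t x
    have := (conv_der hκC measurable_id (hu.int t) x).sub_const (∫ z, κ (0 - z) * u t z)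
    simp only [Φeq]
    exact this
  have d1 : ∀ t ∈ Ioo t0 T, ∀ x, HasDerivAt (fun t => Φ t x) (f1 t x) t := by
    intro t ht x
    have hc : Continuous fun s => f1 s x := f1c.comp (continuous_id.prodMk continuous_const)
    have e : (fun t => Φ t x) =ᶠ[𝓝 t] fun t => (∫ z, (κ (x - z) - κ (0 - z)) * u0 z)
        + ∫ s in t0..t, f1 s x := by
      filter_upwards [Icc_mem_nhds ht.1 ht.2] with s hs
      have := weak_int h hT hu hw (hψ x 0) (hψc x 0) hs
      simp only [hψd] at this
      exact this
    refine HasDerivAt.congr_of_eventuallyEq ?_ e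
    exact (intervalIntegral.integral_hasDerivAt_right (hc.intervalIntegrable _ _)
      (hc.stronglyMeasurableAtFilter _ _) hc.continuousAt).const_add _
  -- continuity of Φ
  have Φc : Continuous fun p : ℝ × ℝ => Φ p.1 p.2 := by
    refine hu.contInt continuous_fst (g := fun (p : ℝ × ℝ) z => κ (p.2 - z) - κ (0 - z))
      (C := 2 * C) (fun p => (hm0 _).sub (hm0 _)) (fun p z => ?_) (fun z => ?_)
    · have := abs_sub (κ (p.2 - z)) (κ (0 - z)); linarith [(hκC.2 (p.2 - z)).1, (hκC.2 (0 - z)).1]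
    · exact (hκC.cont.comp (continuous_snd.sub continuous_const)).sub continuous_const
  set q : ℝ → ℝ → ℝ := fun y s => ∫ z, ((w s (X s y) - w s z) * deriv κ (X s y - z)) * u s z with hq
  set D : ℝ → ℝ := fun s => ∫ z, (w s z * deriv κ (0 - z)) * u s z with hD
  have intw : ∀ s x, Integrable fun z => (w s z * deriv κ (x - z)) * u s z := fun s x =>
    intble_bdd_mul ((hwz s).measurable.mul (hm x)) (C := M * C) (fun z => by
      rw [abs_mul]; exact mul_le_mul (h.bdd _ _) (hdk _) (abs_nonneg _) h.M0) (hu.int s)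
  have intd : ∀ s x, Integrable fun z => deriv κ (x - z) * u s z := fun s x =>
    conv_dint hκC measurable_id (hu.int s) x
  have qeq : ∀ s y, f1 s (X s y) + f2 s (X s y) * w s (X s y) = q y s + D s := by
    intro s y
    simp only [hf1, hf2, hq, hD]
    rw [← integral_mul_const, ← integral_add, ← integral_add]
    · congr 1; ext z; ring
    · have := ((intd s (X s y)).const_mul (w s (X s y))).sub (intw s (X s y))
      refine this.congr (Eventually.of_forall fun z => ?_)
      simp only [Pi.sub_apply]; ring
    · exact intw s 0
    · have := (intw s 0).sub (intw s (X s y))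
      refine this.congr (Eventually.of_forall fun z => ?_)
      simp only [Pi.sub_apply]; ring
    · exact (intd s (X s y)).mul_const _
  have qc : ∀ y, Continuous (q y) := by
    intro y
    refine hu.contInt continuous_id
      (g := fun s z => (w s (X s y) - w s z) * deriv κ (X s y - z)) (C := (2 * M) * C)
      (fun s => (measurable_const.sub (hwz s).measurable).mul (hm _)) (fun s z => ?_) (fun z => ?_)
    · rw [abs_mul]
      refine mul_le_mul ?_ (hdk _) (abs_nonneg _) (by linarith [h.M0])
      have := abs_sub (w s (X s y)) (w s z); linarith [h.bdd s (X s y), h.bdd s z]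
    · exact ((h.cont2.comp (continuous_id.prodMk (hF.cont y))).sub (h.cont z)).mul
        (hκC.dcont.comp ((hF.cont y).sub continuous_const))
  have der : ∀ y, ∀ s ∈ Ioo t0 T, HasDerivAt (fun s => Φ s (X s y)) (q y s + D s) s := by
    intro y s hs
    have st := hasStrictFDerivAt_uncurry_coprod (𝕜 := ℝ) (u := (s, X s y)) (f := Φ)
      (f₁ := fun t x => ContinuousLinearMap.toSpanSingleton ℝ (f1 t x))
      (f₂ := fun t x => ContinuousLinearMap.toSpanSingleton ℝ (f2 t x))
      (by
        have : ∀ᶠ v in 𝓝 (s, X s y), v.1 ∈ Ioo t0 T :=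
          continuous_fst.continuousAt.eventually (isOpen_Ioo.mem_nhds hs)
        filter_upwards [this] with v hv
        exact (d1 v.1 hv v.2).hasFDerivAt)
      (Eventually.of_forall fun v => (d2 v.1 v.2).hasFDerivAt)
      ((ContinuousLinearMap.toSpanSingletonCLE (𝕜 := ℝ) (E := ℝ)).continuous.comp f1c).continuousAt
      ((ContinuousLinearMap.toSpanSingletonCLE (𝕜 := ℝ) (E := ℝ)).continuous.comp f2c).continuousAt
    have := st.hasFDerivAt.comp_hasDerivAt s
      ((hasDerivAt_id s).prodMk (hF.der y s (Ioo_subset_Icc_self hs)))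
    rw [← qeq]
    refine this.congr_deriv ?_
    simp [Function.HasUncurry.uncurry, mul_comm]
  have fin := intervalIntegral.integral_eq_sub_of_hasDerivAt_of_le (a := t0) (b := t)
    (f := fun s => Φ s (X s b) - Φ s (X s a)) (f' := fun s => q b s - q a s) ht.1
    ((Φc.comp (continuous_id.prodMk (hF.cont b))).sub
      (Φc.comp (continuous_id.prodMk (hF.cont a)))).continuousOn
    (fun s hs => by
      have hs' : s ∈ Ioo t0 T := ⟨hs.1, hs.2.trans_le ht.2⟩
      refine ((der b s hs').sub (der a s hs')).congr_deriv ?_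
      ring)
    (((qc b).sub (qc a)).intervalIntegrable _ _)
  rw [fin, hF.init, hF.init]
  have e : ∀ s x y, Φ s x - Φ s y = ∫ z, (κ (x - z) - κ (y - z)) * u s z := by
    intro s x y
    rw [Φeq, Φeq]
    simp only [sub_mul]
    rw [integral_sub (intκ _ _) (intκ _ _)]
    ring
  rw [e, e]
  have := weak_int h hT hu hw (hψ b a) (hψc b a) (left_mem_Icc.2 hT.le)
  simp only [intervalIntegral.integral_same, add_zero] at this
  rw [this]; ring

lemma sT_deriv_zero {x : ℝ} (hx : x ∉ Icc (0:ℝ) 1) : deriv Real.smoothTransition x = 0 := by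
  rw [mem_Icc, not_and_or, not_le, not_le] at hx
  rcases hx with hx | hx
  · have : Real.smoothTransition =ᶠ[𝓝 x] fun _ => 0 := by
      filter_upwards [gt_mem_nhds hx] with y hy using Real.smoothTransition.zero_of_nonpos hy.le
    rw [this.deriv_eq]; simp
  · have : Real.smoothTransition =ᶠ[𝓝 x] fun _ => 1 := by
      filter_upwards [lt_mem_nhds hx] with y hy using Real.smoothTransition.one_of_one_le hy.le
    rw [this.deriv_eq]; simp

lemma sT_smooth : ContDiff ℝ (⊤ : ℕ∞) Real.smoothTransition := Real.smoothTransition.contDiff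

lemma sT_bound : ∃ C, 1 ≤ C ∧ W2infBound Real.smoothTransition C := by
  have h1 : ContDiff ℝ (⊤ : ℕ∞) (deriv Real.smoothTransition) :=
    (contDiff_infty_iff_deriv.1 sT_smooth).2
  have h2 : ContDiff ℝ (⊤ : ℕ∞) (deriv (deriv Real.smoothTransition)) :=
    (contDiff_infty_iff_deriv.1 h1).2
  have hc : HasCompactSupport (deriv Real.smoothTransition) :=
    HasCompactSupport.intro (isCompact_Icc (a := (0:ℝ)) (b := 1)) fun x hx => sT_deriv_zero hx
  obtain ⟨C1, hC1⟩ := hc.exists_bound_of_continuous h1.continuous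
  obtain ⟨C2, hC2⟩ := hc.deriv.exists_bound_of_continuous h2.continuous
  refine ⟨max 1 (max C1 C2), le_max_left _ _, Real.smoothTransition.contDiff (n := 2), fun x => ⟨?_, ?_, ?_⟩⟩
  · rw [abs_of_nonneg (Real.smoothTransition.nonneg x)]
    exact (Real.smoothTransition.le_one x).trans (le_max_left _ _)
  · exact (hC1 x).trans ((le_max_left _ _).trans (le_max_right _ _))
  · exact (hC2 x).trans ((le_max_right _ _).trans (le_max_right _ _))

/-- scaled transition -/
def sTm (m : ℕ) (x : ℝ) : ℝ := Real.smoothTransition (((m : ℝ) + 1) * x)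

lemma sTm_smooth (m : ℕ) : ContDiff ℝ (⊤ : ℕ∞) (sTm m) :=
  sT_smooth.comp (contDiff_const.mul contDiff_id)

lemma sTm_deriv (m : ℕ) (x : ℝ) :
    deriv (sTm m) x = (m + 1) * deriv Real.smoothTransition ((m + 1) * x) := by
  unfold sTm
  exact deriv_comp_mul_left _ _ _

lemma sTm_bound (m : ℕ) : ∃ C, W2infBound (sTm m) C := by
  obtain ⟨C, hC1, hC⟩ := sT_bound
  have hm : (1:ℝ) ≤ m + 1 := by have : (0:ℝ) ≤ m := m.cast_nonneg; linarith
  refine ⟨C * (m + 1)^2, (contDiff_infty.1 (sTm_smooth m) 2), fun x => ⟨?_, ?_, ?_⟩⟩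
  · refine (hC.2 _).1.trans ?_
    have h2 : (1:ℝ) ≤ ((m:ℝ) + 1)^2 := one_le_pow₀ hm
    nlinarith [hC.C0]
  · rw [sTm_deriv, abs_mul, abs_of_nonneg (by linarith)]
    have := (hC.2 ((m + 1) * x)).2.1
    calc _ ≤ ((m:ℝ) + 1) * C := by gcongr
      _ ≤ _ := by nlinarith [mul_nonneg hC.C0 (show (0:ℝ) ≤ m by linarith)]
  · have : deriv (sTm m) = fun x => (m + 1) * deriv Real.smoothTransition ((m + 1) * x) :=
      funext (sTm_deriv m)
    rw [this, deriv_const_mul_field, deriv_comp_mul_left ((m:ℝ)+1) (deriv Real.smoothTransition) x,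
      smul_eq_mul, abs_mul, abs_mul, abs_of_nonneg (show (0:ℝ) ≤ m + 1 by linarith)]
    have := (hC.2 ((m + 1) * x)).2.2
    calc _ ≤ ((m:ℝ) + 1) * ((m + 1) * C) := by gcongr
      _ = _ := by ring

lemma sTm_zero (m : ℕ) {x : ℝ} (hx : x ≤ 0) : sTm m x = 0 :=
  Real.smoothTransition.zero_of_nonpos (mul_nonpos_of_nonneg_of_nonpos (by positivity) hx)

lemma sTm_one (m : ℕ) {x : ℝ} (hx : 1 / ((m:ℝ) + 1) ≤ x) : sTm m x = 1 :=
  Real.smoothTransition.one_of_one_le (by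
    rw [div_le_iff₀ (by positivity)] at hx; linarith)

lemma sTm_abs (m : ℕ) (x : ℝ) : |sTm m x| ≤ 1 := by
  unfold sTm
  rw [abs_of_nonneg (Real.smoothTransition.nonneg _)]
  exact Real.smoothTransition.le_one _

lemma sTm_tendsto (x : ℝ) : Tendsto (fun m => sTm m x) atTop (𝓝 ((Ioi (0:ℝ)).indicator 1 x)) := by
  by_cases hx : 0 < x
  · rw [indicator_of_mem (show x ∈ Ioi (0:ℝ) from hx)]
    refine tendsto_const_nhds.congr' ?_
    filter_upwards [(tendsto_one_div_add_atTop_nhds_zero_nat (𝕜 := ℝ)).eventually (gt_mem_nhds hx)]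
      with m hm
    rw [sTm_one m hm.le]; rfl
  · rw [indicator_of_notMem (show x ∉ Ioi (0:ℝ) from hx)]
    refine tendsto_const_nhds.congr fun m => ?_
    rw [sTm_zero m (not_lt.1 hx)]

lemma sTm_dbound : ∃ C, 0 ≤ C ∧ ∀ m x, |x| * |deriv (sTm m) x| ≤ C := by
  obtain ⟨C, hC1, hC⟩ := sT_bound
  refine ⟨C, hC.C0, fun m x => ?_⟩
  have hm : (0:ℝ) ≤ m + 1 := by positivity
  rw [sTm_deriv, abs_mul, abs_of_nonneg hm]
  by_cases hx : ((m:ℝ) + 1) * x ∈ Icc (0:ℝ) 1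
  · have h1 := (hC.2 ((m + 1) * x)).2.1
    have h2 : ((m:ℝ) + 1) * |x| ≤ 1 := by
      rw [← abs_of_nonneg hm, ← abs_mul, abs_of_nonneg hx.1]; exact hx.2
    calc _ = (((m:ℝ) + 1) * |x|) * |deriv Real.smoothTransition ((m + 1) * x)| := by ring
      _ ≤ 1 * C := by gcongr
      _ = C := one_mul _
  · rw [sT_deriv_zero hx]; simpa using hC.C0

lemma sTm_dtendsto {x : ℝ} (hx : x ≠ 0) : ∀ᶠ m : ℕ in atTop, deriv (sTm m) x = 0 := by
  have : ∀ᶠ m : ℕ in atTop, 1 / ((m:ℝ) + 1) < |x| :=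
    (tendsto_one_div_add_atTop_nhds_zero_nat (𝕜 := ℝ)).eventually (gt_mem_nhds (abs_pos.2 hx))
  filter_upwards [this] with m hm
  rw [sTm_deriv, sT_deriv_zero, mul_zero]
  intro h
  rw [div_lt_iff₀ (by positivity)] at hm
  have h2 : |x| * ((m:ℝ) + 1) = ((m:ℝ) + 1) * x := by
    rw [← abs_of_nonneg h.1, abs_mul, abs_of_nonneg (show (0:ℝ) ≤ m + 1 by positivity)]; ring
  linarith [h.2]

lemma sTm_lim {r : ℝ → ℝ} (hr : Integrable r) (x y : ℝ) :
    Tendsto (fun m => ∫ z, (sTm m (x - z) - sTm m (y - z)) * r z) atTop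
      (𝓝 ((∫ z in Iio x, r z) - ∫ z in Iio y, r z)) := by
  have e : (∫ z in Iio x, r z) - ∫ z in Iio y, r z
      = ∫ z, ((Ioi (0:ℝ)).indicator 1 (x - z) - (Ioi (0:ℝ)).indicator 1 (y - z)) * r z := by
    have hx : ∀ x z, (Ioi (0:ℝ)).indicator 1 (x - z) * r z = (Iio x).indicator r z := by
      intro x z
      by_cases h : z < x
      · rw [indicator_of_mem (show x - z ∈ Ioi (0:ℝ) from sub_pos.2 h),
          indicator_of_mem (show z ∈ Iio x from h)]; simp
      · rw [indicator_of_notMem (show x - z ∉ Ioi (0:ℝ) from fun h' => h (sub_pos.1 h')),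
          indicator_of_notMem (show z ∉ Iio x from h)]; simp
    simp only [sub_mul, hx]
    rw [integral_sub (hr.indicator measurableSet_Iio) (hr.indicator measurableSet_Iio),
      integral_indicator measurableSet_Iio, integral_indicator measurableSet_Iio]
  rw [e]
  have hm : ∀ m x, Measurable fun z => sTm m (x - z) := fun m x =>
    ((sTm_smooth m).continuous.comp (continuous_const.sub continuous_id)).measurable
  have hb : ∀ m z, |sTm m (x - z) - sTm m (y - z)| ≤ 2 := fun m z => by
    have := abs_sub (sTm m (x - z)) (sTm m (y - z))
    linarith [sTm_abs m (x - z), sTm_abs m (y - z)]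
  refine tendsto_integral_of_dominated_convergence (fun z => 2 * |r z|)
    (fun m => (intble_bdd_mul ((hm m x).sub (hm m y)) (hb m) hr).aestronglyMeasurable)
    (hr.abs.const_mul 2) (fun m => Eventually.of_forall fun z => ?_) (Eventually.of_forall fun z => ?_)
  · rw [norm_mul]; exact mul_le_mul_of_nonneg_right (hb m z) (abs_nonneg _)
  · exact ((sTm_tendsto _).sub (sTm_tendsto _)).mul_const _

lemma L1c.normc {u : ℝ → ℝ → ℝ} (hu : L1c u) : Continuous fun t => ∫ z, |u t z| := by
  rw [continuous_iff_continuousAt]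
  intro t
  unfold ContinuousAt
  rw [tendsto_iff_norm_sub_tendsto_zero]
  refine squeeze_zero (fun _ => norm_nonneg _) (fun s => ?_) (hu.cont t)
  rw [← integral_sub (hu.int s).abs (hu.int t).abs]
  exact norm_integral_le_of_norm_le ((hu.int s).sub (hu.int t)).abs
    (Eventually.of_forall fun z => abs_abs_sub_abs_le _ _)

lemma ae_zero_of_Iio {f : ℝ → ℝ} (hf : Integrable f)
    (h : ∀ x y, (∫ z in Iio x, f z) = ∫ z in Iio y, f z) : f =ᵐ[volume] 0 := by
  filter_upwards [LocallyIntegrable.ae_hasDerivAt_integral hf.locallyIntegrable] with x hx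
  have h1 := hx 0
  have : (fun x => ∫ t in (0:ℝ)..x, f t) = fun _ => 0 := by
    ext y
    rw [← intervalIntegral.integral_Iic_sub_Iic hf.integrableOn hf.integrableOn,
      integral_Iic_eq_integral_Iio, integral_Iic_eq_integral_Iio, h y 0, sub_self]
  rw [this] at h1
  exact h1.unique (hasDerivAt_const x 0)

lemma flow_q_lim {w w' X u : ℝ → ℝ → ℝ} {M L L2 t0 T : ℝ}
    (h : NiceField w w' M L L2) (hF : IsFlow t0 T w X) (hu : L1c u) (y : ℝ) {t : ℝ} :
    Tendsto (fun m => ∫ s in t0..t, ∫ z, ((w s (X s y) - w s z) * deriv (sTm m) (X s y - z)) * u s z)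
      atTop (𝓝 0) := by
  obtain ⟨C, hC0, hC⟩ := sTm_dbound
  have hwz : ∀ s, Continuous (w s) := fun s =>
    h.cont2.comp (continuous_const.prodMk continuous_id)
  have hdc : ∀ m, Continuous (deriv (sTm m)) := fun m => (sTm_smooth m).continuous_deriv (by norm_num)
  have hb : ∀ m s z, |(w s (X s y) - w s z) * deriv (sTm m) (X s y - z)| ≤ L * C := by
    intro m s z
    rw [abs_mul]
    calc _ ≤ (L * |X s y - z|) * |deriv (sTm m) (X s y - z)| :=
          mul_le_mul_of_nonneg_right (h.lip _ _ _) (abs_nonneg _)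
      _ = L * (|X s y - z| * |deriv (sTm m) (X s y - z)|) := by ring
      _ ≤ L * C := mul_le_mul_of_nonneg_left (hC m _) h.L0
  have hm : ∀ m s, Measurable fun z => (w s (X s y) - w s z) * deriv (sTm m) (X s y - z) :=
    fun m s => (measurable_const.sub (hwz s).measurable).mul
      ((hdc m).comp (continuous_const.sub continuous_id)).measurable
  have qc : ∀ m, Continuous fun s => ∫ z, ((w s (X s y) - w s z) * deriv (sTm m) (X s y - z)) * u s z :=
    fun m => hu.contInt continuous_id
      (g := fun s z => (w s (X s y) - w s z) * deriv (sTm m) (X s y - z)) (hm m) (hb m) fun z =>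
        ((h.cont2.comp (continuous_id.prodMk (hF.cont y))).sub (h.cont z)).mul
        ((hdc m).comp ((hF.cont y).sub continuous_const))
  have := intervalIntegral.tendsto_integral_filter_of_dominated_convergence (μ := volume) (a := t0) (b := t)
    (l := atTop) (f := fun _ => (0:ℝ))
    (F := fun m s => ∫ z, ((w s (X s y) - w s z) * deriv (sTm m) (X s y - z)) * u s z)
    (fun s => (L * C) * ∫ z, |u s z|)
    (Eventually.of_forall fun m => (qc m).aestronglyMeasurable)
    (Eventually.of_forall fun m => Eventually.of_forall fun s _ => int_bdd_mul (hb m s) (hu.int s))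
    ((continuous_const.mul hu.normc).intervalIntegrable _ _)
    (Eventually.of_forall fun s _ => ?_)
  · simpa using this
  · have := tendsto_integral_of_dominated_convergence (μ := volume)
      (F := fun m z => ((w s (X s y) - w s z) * deriv (sTm m) (X s y - z)) * u s z)
      (f := fun _ => (0:ℝ)) (fun z => (L * C) * |u s z|)
      (fun m => (intble_bdd_mul (hm m s) (hb m s) (hu.int s)).aestronglyMeasurable)
      ((hu.int s).abs.const_mul _) (fun m => Eventually.of_forall fun z => by
        rw [norm_mul]; exact mul_le_mul_of_nonneg_right (hb m s z) (abs_nonneg _))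
      (Eventually.of_forall fun z => by
        refine tendsto_const_nhds.congr' ?_
        by_cases hz : X s y = z
        · exact Eventually.of_forall fun m => by simp [hz]
        · filter_upwards [sTm_dtendsto (sub_ne_zero.2 hz)] with m hm
          simp [hm])
    simpa using this

theorem linear_unique {w w' X u : ℝ → ℝ → ℝ} {M L L2 t0 T : ℝ} {u0 : ℝ → ℝ}
    (h : NiceField w w' M L L2) (hF : IsFlow t0 T w X) (hT : t0 < T) (hu : L1c u)
    (hu0 : Integrable u0) (hw : IsWeakSol t0 T w u0 u) {t : ℝ} (ht : t ∈ Icc t0 T) :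
    u t =ᵐ[volume] dens w' X t0 u0 t := by
  have key : ∀ a b, (∫ z in Iio (X t b), u t z) - (∫ z in Iio (X t a), u t z)
      = (∫ z in Iio b, u0 z) - ∫ z in Iio a, u0 z := by
    intro a b
    have l1 := sTm_lim (hu.int t) (X t b) (X t a)
    have l2 := (sTm_lim hu0 b a).add
      ((flow_q_lim h hF hu b (t := t)).sub (flow_q_lim h hF hu a (t := t)))
    rw [sub_zero, add_zero] at l2
    refine tendsto_nhds_unique l1 (l2.congr fun m => ?_)
    obtain ⟨C, hC⟩ := sTm_bound m
    have := flow_kernel h hF hT hu hw (sTm_smooth m) hC (fun x => sTm_zero m) (fun x => sTm_one m)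
      a b ht
    rw [this, intervalIntegral.integral_sub]
    all_goals
      have hwz : ∀ s, Continuous (w s) := fun s =>
        h.cont2.comp (continuous_const.prodMk continuous_id)
      refine Continuous.intervalIntegrable ?_ _ _
      refine hu.contInt continuous_id
        (g := fun s z => (w s (X s _) - w s z) * deriv (sTm m) (X s _ - z)) (C := (2 * M) * C)
        (fun s => (measurable_const.sub (hwz s).measurable).mul
          (hC.dcont.comp (continuous_const.sub continuous_id)).measurable) (fun s z => ?_) (fun z => ?_)
      · rw [abs_mul]
        refine mul_le_mul ?_ (hC.2 _).2.1 (abs_nonneg _) (by linarith [h.M0])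
        refine (abs_sub _ _).trans ?_
        linarith [h.bdd s (X s b), h.bdd s (X s a), h.bdd s z]
      · exact ((h.cont2.comp (continuous_id.prodMk (hF.cont _))).sub (h.cont z)).mul
          (hC.dcont.comp ((hF.cont _).sub continuous_const))
  have hd : Integrable (dens w' X t0 u0 t) := hF.dens_int h ht hu0
  have key2 : ∀ b, (∫ z in Iio (X t b), dens w' X t0 u0 t z) = ∫ z in Iio b, u0 z := by
    intro b
    have := hF.cov (u0 := u0) h ht ((Iio (X t b)).indicator 1)
    rw [← integral_indicator measurableSet_Iio, ← integral_indicator measurableSet_Iio]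
    convert this using 2 with z z
    · ext z
      by_cases hz : z ∈ Iio (X t b)
      · simp [hz]
      · simp [hz]
    · ext z
      have : X t z ∈ Iio (X t b) ↔ z ∈ Iio b := (hF.strictMono h ht).lt_iff_lt
      by_cases hz : z ∈ Iio b
      · rw [indicator_of_mem hz, indicator_of_mem (this.2 hz)]; simp
      · rw [indicator_of_notMem hz, indicator_of_notMem (fun h' => hz (this.1 h'))]; simp
  have := ae_zero_of_Iio ((hu.int t).sub hd) (fun x y => by
    obtain ⟨b, rfl⟩ := hF.surj h ht x
    obtain ⟨a, rfl⟩ := hF.surj h ht y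
    simp only [Pi.sub_apply]
    rw [integral_sub (hu.int t).integrableOn hd.integrableOn,
      integral_sub (hu.int t).integrableOn hd.integrableOn, key2, key2]
    linarith [key a b])
  filter_upwards [this] with z hz
  exact sub_eq_zero.1 hz

/-- regularity of the (time-clamped) speeds -/
structure VReg (n : ℕ) (v : ℝ → Fin n → ℝ → (Fin n → ℝ) → ℝ) (C : ℝ) : Prop where
  C0 : 0 ≤ C
  diff : ∀ t i, Differentiable ℝ (Function.uncurry (v t i))
  b0 : ∀ t i x, |v t i x 0| ≤ C
  d1 : ∀ t i p, ‖fderiv ℝ (Function.uncurry (v t i)) p‖ ≤ C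
  d2 : ∀ t i p q, ‖fderiv ℝ (Function.uncurry (v t i)) p - fderiv ℝ (Function.uncurry (v t i)) q‖
    ≤ C * ‖p - q‖
  tc : ∀ t, ∀ ε > 0, ∃ δ > 0, ∀ s, |s - t| < δ → ∀ i x p,
    |v s i x p - v t i x p| ≤ ε * (1 + ‖p‖)

lemma lin_growth {n : ℕ} {V : ℝ → (Fin n → ℝ) → ℝ} {C : ℝ} (hd : Differentiable ℝ (Function.uncurry V))
    (h0 : ∀ x, |V x 0| ≤ C) (h1 : ∀ p, ‖fderiv ℝ (Function.uncurry V) p‖ ≤ C) (x : ℝ) (p : Fin n → ℝ) :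
    |V x p| ≤ C * (1 + ‖p‖) := by
  have := Convex.norm_image_sub_le_of_norm_fderiv_le (𝕜 := ℝ) (f := Function.uncurry V) (C := C)
    (s := univ) (x := (x, 0)) (y := (x, p)) (fun z _ => hd z) (fun z _ => h1 z) convex_univ trivial trivial
  simp only [Function.uncurry_apply_pair, Prod.mk_sub_mk, sub_self, sub_zero, Real.norm_eq_abs,
    Prod.norm_mk, norm_zero, norm_nonneg, sup_of_le_right] at this
  have h2 := abs_sub_abs_le_abs_sub (V x p) (V x 0)
  linarith [h0 x]

lemma vreg_bdd {n : ℕ} {t0 T : ℝ} {v : ℝ → Fin n → ℝ → (Fin n → ℝ) → ℝ} (hv : VAssumption n t0 T v) :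
    ∃ C, ∀ t ∈ Icc t0 T, ∀ i, VBound n (v t i) C := by
  refine (isCompact_Icc (a := t0) (b := T)).induction_on (p := fun s => ∃ C, ∀ t ∈ s ∩ Icc t0 T, ∀ i, VBound n (v t i) C) ⟨0, by simp⟩ ?_ ?_ ?_ |>.imp ?_
  · rintro s s' hss ⟨C, hC⟩
    exact ⟨C, fun t ht => hC t ⟨hss ht.1, ht.2⟩⟩
  · rintro s s' ⟨C, hC⟩ ⟨C', hC'⟩
    have mono : ∀ {V : ℝ → (Fin n → ℝ) → ℝ} {C D : ℝ}, C ≤ D → VBound n V C → VBound n V D :=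
      fun h hV => ⟨hV.1, fun x => (hV.2.1 x).trans h, fun k h1 h3 p => (hV.2.2 k h1 h3 p).trans h⟩
    refine ⟨max C C', fun t ht i => ?_⟩
    rcases ht.1 with h | h
    · exact mono (le_max_left _ _) (hC t ⟨h, ht.2⟩ i)
    · exact mono (le_max_right _ _) (hC' t ⟨h, ht.2⟩ i)
  · intro t ht
    obtain ⟨δ, hδ, hd⟩ := hv.2 t ht 1 one_pos
    choose C hC using hv.1 t ht
    refine ⟨Metric.ball t δ, mem_nhdsWithin_of_mem_nhds (Metric.ball_mem_nhds t hδ), (∑ i, |C i|) + 1, ?_⟩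
    rintro s ⟨hs, hsI⟩ i
    rw [Metric.mem_ball, Real.dist_eq] at hs
    have h1 := hd s hsI hs i
    have hCi : C i ≤ ∑ i, |C i| := (le_abs_self _).trans
      (Finset.single_le_sum (f := fun i => |C i|) (fun _ _ => abs_nonneg _) (Finset.mem_univ i))
    obtain ⟨C1, hC1⟩ := hv.1 s hsI i
    refine ⟨hC1.1, fun x => ?_, fun k hk hk3 p => ?_⟩
    · have := abs_sub_abs_le_abs_sub (v s i x 0) (v t i x 0)
      linarith [h1.1 x, (hC i).2.1 x]
    · have := norm_sub_norm_le (iteratedFDeriv ℝ k (Function.uncurry (v s i)) p)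
        (iteratedFDeriv ℝ k (Function.uncurry (v t i)) p)
      linarith [h1.2 k hk hk3 p, (hC i).2.2 k hk hk3 p]
  · intro C hC t ht
    exact hC t ⟨ht, ht⟩

lemma vreg {n : ℕ} {t0 T : ℝ} (hT : t0 ≤ T) {v : ℝ → Fin n → ℝ → (Fin n → ℝ) → ℝ}
    (hv : VAssumption n t0 T v) : ∃ C, VReg n (fun t => v (clamp t0 T t)) C := by
  obtain ⟨C, hC⟩ := vreg_bdd hv
  have hcl := clamp_mem hT
  have hdf : ∀ t ∈ Icc t0 T, ∀ i, Differentiable ℝ (Function.uncurry (v t i)) := fun t ht i =>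
    (hC t ht i).1.differentiable (by norm_num)
  refine ⟨max C 0, le_max_right _ _, fun t i => hdf _ (hcl t) i,
    fun t i x => ((hC _ (hcl t) i).2.1 x).trans (le_max_left _ _), fun t i p => ?_, fun t i p q => ?_, ?_⟩
  · refine le_trans ?_ (le_max_left _ _)
    rw [← norm_iteratedFDeriv_one]
    exact (hC _ (hcl t) i).2.2 1 le_rfl (by norm_num) p
  · have hV := hC _ (hcl t) i
    have h2 : Differentiable ℝ (fderiv ℝ (Function.uncurry (v (clamp t0 T t) i))) :=
      (hV.1.fderiv_right (m := 2) (by norm_num)).differentiable (by norm_num)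
    refine Convex.norm_image_sub_le_of_norm_fderiv_le (𝕜 := ℝ) (s := univ) (fun z _ => h2 z)
      (fun z _ => ?_) convex_univ trivial trivial
    refine le_trans ?_ (le_max_left _ _)
    rw [← norm_iteratedFDeriv_one, norm_iteratedFDeriv_fderiv]
    exact hV.2.2 2 (by norm_num) (by norm_num) z
  · intro t ε hε
    obtain ⟨δ, hδ, hd⟩ := hv.2 _ (hcl t) ε hε
    obtain ⟨δ', hδ', hd'⟩ := Metric.continuousAt_iff.1 ((clamp_cont t0 T).continuousAt (x := t)) δ hδ
    refine ⟨δ', hδ', fun s hs i x p => ?_⟩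
    have h1 := hd _ (hcl s) (hd' (by simpa [Real.dist_eq] using hs)) i
    have hs1 := hdf _ (hcl s) i
    have ht1 := hdf _ (hcl t) i
    refine lin_growth (V := fun x p => v (clamp t0 T s) i x p - v (clamp t0 T t) i x p)
      (hs1.sub ht1) h1.1 (fun p => ?_) x p
    have := h1.2 1 le_rfl (by norm_num) p
    have e : fderiv ℝ (Function.uncurry fun x p => v (clamp t0 T s) i x p - v (clamp t0 T t) i x p) p
      = fderiv ℝ (Function.uncurry (v (clamp t0 T s) i)) p - fderiv ℝ (Function.uncurry (v (clamp t0 T t) i)) p :=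
      fderiv_sub (hs1 p) (ht1 p)
    rw [e]
    refine le_trans (ContinuousLinearMap.opNorm_le_bound _ (norm_nonneg _) fun z => ?_) this
    have h3 := ContinuousMultilinearMap.le_opNorm (iteratedFDeriv ℝ 1 (Function.uncurry (v (clamp t0 T s) i)) p
        - iteratedFDeriv ℝ 1 (Function.uncurry (v (clamp t0 T t) i)) p) (fun _ => z)
    simpa [iteratedFDeriv_one_apply] using h3

namespace VReg
variable {n : ℕ} {v : ℝ → Fin n → ℝ → (Fin n → ℝ) → ℝ} {C : ℝ}

lemma bdd (h : VReg n v C) (t : ℝ) (i : Fin n) (x : ℝ) (p : Fin n → ℝ) :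
    |v t i x p| ≤ C * (1 + ‖p‖) := lin_growth (h.diff t i) (h.b0 t i) (h.d1 t i) x p

lemma lip (h : VReg n v C) (t : ℝ) (i : Fin n) (x y : ℝ) (p q : Fin n → ℝ) :
    |v t i x p - v t i y q| ≤ C * (|x - y| + ‖p - q‖) := by
  have := Convex.norm_image_sub_le_of_norm_fderiv_le (𝕜 := ℝ) (f := Function.uncurry (v t i)) (C := C)
    (s := univ) (x := (y, q)) (y := (x, p)) (fun z _ => h.diff t i z) (fun z _ => h.d1 t i z)
    convex_univ trivial trivial
  refine this.trans (mul_le_mul_of_nonneg_left ?_ h.C0)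
  rw [Prod.mk_sub_mk, Prod.norm_mk]
  exact max_le_add_of_nonneg (norm_nonneg _) (norm_nonneg _)

lemma nice (h : VReg n v C) {c c' : ℝ → ℝ → Fin n → ℝ} {K : ℝ} (hK : 0 ≤ K) (i : Fin n)
    (hct : ∀ x, Continuous fun t => c t x)
    (hd : ∀ t x j, HasDerivAt (fun x => c t x j) (c' t x j) x)
    (hb : ∀ t x j, |c t x j| ≤ K) (hb' : ∀ t x j, |c' t x j| ≤ K)
    (hl : ∀ t x y j, |c' t x j - c' t y j| ≤ K * |x - y|) :
    NiceField (fun t x => v t i x (c t x))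
      (fun t x => fderiv ℝ (Function.uncurry (v t i)) (x, c t x) (1, c' t x))
      (C * (1 + K)) (C * (1 + K)) (C * (1 + K) * (1 + K) + C * K) := by
  have hC := h.C0
  have nb : ∀ t x, ‖c t x‖ ≤ K := fun t x => (pi_norm_le_iff_of_nonneg hK).2 fun j => hb t x j
  have nb' : ∀ t x, ‖c' t x‖ ≤ K := fun t x => (pi_norm_le_iff_of_nonneg hK).2 fun j => hb' t x j
  have nl : ∀ t x y, ‖c' t x - c' t y‖ ≤ K * |x - y| := fun t x y =>
    (pi_norm_le_iff_of_nonneg (by positivity)).2 fun j => hl t x y j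
  have hcd : ∀ t x, HasDerivAt (c t) (c' t x) x := fun t x => hasDerivAt_pi.2 fun j => hd t x j
  have nc : ∀ t x y, ‖c t x - c t y‖ ≤ K * |x - y| := fun t x y => by
    have := Convex.norm_image_sub_le_of_norm_hasDerivWithin_le (f := c t) (f' := c' t) (C := K)
      (s := univ) (x := y) (y := x) (fun z _ => (hcd t z).hasDerivWithinAt)
      (fun z _ => nb' t z) convex_univ trivial trivial
    simpa using this
  have n1 : ∀ t x, ‖((1:ℝ), c' t x)‖ ≤ 1 + K := fun t x => by
    rw [Prod.norm_mk, norm_one]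
    exact (max_le_add_of_nonneg zero_le_one (norm_nonneg _)).trans (by linarith [nb' t x])
  refine ⟨fun x => ?_, fun t x => ?_, fun t x => ?_, fun t x => ?_, fun t x y => ?_⟩
  · rw [continuous_iff_continuousAt]
    intro t
    have e : (fun s => v s i x (c s x)) = fun s => (v s i x (c s x) - v t i x (c s x)) + v t i x (c s x) := by
      ext s; ring
    have h1 : Tendsto (fun s => v s i x (c s x) - v t i x (c s x)) (𝓝 t) (𝓝 0) := by
      rw [Metric.tendsto_nhds]
      intro ε hε
      obtain ⟨δ, hδ, hh⟩ := h.tc t (ε / (2 * (1 + K))) (by positivity)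
      filter_upwards [Metric.ball_mem_nhds t hδ] with s hs
      rw [Metric.mem_ball, Real.dist_eq] at hs
      rw [Real.dist_eq, sub_zero]
      refine (hh s hs i x (c s x)).trans_lt ?_
      calc _ ≤ ε / (2 * (1 + K)) * (1 + K) := by gcongr; exact nb s x
        _ = ε / 2 := by field_simp
        _ < ε := by linarith
    have h2 : Continuous fun s => v t i x (c s x) :=
      (h.diff t i).continuous.comp (continuous_const.prodMk (hct x))
    unfold ContinuousAt
    rw [e]
    simpa using h1.add (h2.tendsto t)
  · refine (h.bdd t i x _).trans ?_
    gcongr; exact nb t x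
  · exact ((h.diff t i) (x, c t x)).hasFDerivAt.comp_hasDerivAt x ((hasDerivAt_id x).prodMk (hcd t x))
  · rw [← Real.norm_eq_abs]
    refine (ContinuousLinearMap.le_opNorm _ _).trans ?_
    exact mul_le_mul (h.d1 _ _ _) (n1 t x) (norm_nonneg _) hC
  · set D := fderiv ℝ (Function.uncurry (v t i))
    have e : D (x, c t x) (1, c' t x) - D (y, c t y) (1, c' t y)
        = (D (x, c t x) - D (y, c t y)) (1, c' t x) + D (y, c t y) (0, c' t x - c' t y) := by
      have : ((0:ℝ), c' t x - c' t y) = (1, c' t x) - (1, c' t y) := by simp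
      rw [this, map_sub, sub_apply]; ring
    rw [e]
    refine (abs_add_le _ _).trans ?_
    have p1 : ‖((x, c t x) : ℝ × (Fin n → ℝ)) - (y, c t y)‖ ≤ (1 + K) * |x - y| := by
      rw [Prod.mk_sub_mk, Prod.norm_mk]
      refine (max_le_add_of_nonneg (norm_nonneg _) (norm_nonneg _)).trans ?_
      rw [Real.norm_eq_abs]; linarith [nc t x y]
    have b1 : |(D (x, c t x) - D (y, c t y)) (1, c' t x)| ≤ (C * ((1 + K) * |x - y|)) * (1 + K) := by
      rw [← Real.norm_eq_abs]
      refine (ContinuousLinearMap.le_opNorm _ _).trans ?_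
      refine mul_le_mul ((h.d2 t i _ _).trans (mul_le_mul_of_nonneg_left p1 hC)) (n1 t x) (norm_nonneg _) (by positivity)
    have b2 : |D (y, c t y) (0, c' t x - c' t y)| ≤ C * (K * |x - y|) := by
      rw [← Real.norm_eq_abs]
      refine (ContinuousLinearMap.le_opNorm _ _).trans ?_
      refine mul_le_mul (h.d1 _ _ _) ?_ (norm_nonneg _) hC
      rw [Prod.norm_mk, norm_zero, max_eq_right (norm_nonneg _)]; exact nl t x y
    calc _ ≤ (C * ((1 + K) * |x - y|)) * (1 + K) + C * (K * |x - y|) := add_le_add b1 b2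
      _ = _ := by ring
end VReg

/-- the space of displacements -/
abbrev Dsp (n : ℕ) := BoundedContinuousFunction ℝ (Fin n → ℝ)

/-- regularity of a nonlocal operator -/
structure GReg (n : ℕ) (G : ℝ → Dsp n → Fin n → ℝ → Fin n → ℝ) (K : ℝ) : Prop where
  K0 : 0 ≤ K
  bdd : ∀ t Z i x, ‖G t Z i x‖ ≤ K
  lipx : ∀ t Z i x y, ‖G t Z i x - G t Z i y‖ ≤ K * |x - y|
  lipZ : ∀ t Z Z' i x, ‖G t Z i x - G t Z' i x‖ ≤ K * ‖Z - Z'‖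
  tc : ∀ t, ∀ ε > 0, ∃ δ > 0, ∀ s, |s - t| < δ → ∀ Z i x, ‖G s Z i x - G t Z i x‖ ≤ ε

lemma Dsp.coord_le {n : ℕ} (Z Z' : Dsp n) (y : ℝ) (i : Fin n) : |Z y i - Z' y i| ≤ ‖Z - Z'‖ := by
  have h1 := (Z - Z').norm_coe_le_norm y
  have h2 := norm_le_pi_norm ((Z - Z') y) i
  simp only [BoundedContinuousFunction.coe_sub, Pi.sub_apply, Real.norm_eq_abs] at h1 h2
  exact h2.trans h1

lemma exists_F {n : ℕ} {v : ℝ → Fin n → ℝ → (Fin n → ℝ) → ℝ} {C K : ℝ}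
    {G : ℝ → Dsp n → Fin n → ℝ → Fin n → ℝ} (hv : VReg n v C) (hG : GReg n G K) :
    ∃ F : ℝ → Dsp n → Dsp n,
      (∀ t Z y i, F t Z y i = v t i (y + Z y i) (G t Z i (y + Z y i))) ∧
      (∀ t Z, ‖F t Z‖ ≤ C * (1 + K)) ∧
      (∀ t Z Z', ‖F t Z - F t Z'‖ ≤ C * (1 + 2 * K) * ‖Z - Z'‖) ∧
      (∀ Z, Continuous fun t => F t Z) := by
  have hC := hv.C0
  have hK := hG.K0
  have hb : ∀ t (Z : Dsp n) y, ‖fun i => v t i (y + Z y i) (G t Z i (y + Z y i))‖ ≤ C * (1 + K) := by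
    intro t Z y
    refine (pi_norm_le_iff_of_nonneg (by positivity)).2 fun i => ?_
    refine (hv.bdd t i _ _).trans ?_
    have := hG.bdd t Z i (y + Z y i)
    gcongr
  have hc : ∀ t (Z : Dsp n), Continuous fun y => fun i => v t i (y + Z y i) (G t Z i (y + Z y i)) := by
    intro t Z
    refine continuous_pi fun i => ?_
    have h1 : Continuous fun x => G t Z i x := by
      refine (LipschitzWith.of_dist_le_mul (K := K.toNNReal) fun x y => ?_).continuous
      rw [Real.coe_toNNReal _ hK, dist_eq_norm, Real.dist_eq]
      exact hG.lipx t Z i x y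
    have h2 : Continuous fun y => y + Z y i :=
      continuous_id.add ((continuous_apply i).comp Z.continuous)
    exact (hv.diff t i).continuous.comp (h2.prodMk (h1.comp h2))
  refine ⟨fun t Z => BoundedContinuousFunction.ofNormedAddCommGroup _ (hc t Z) _ (hb t Z),
    fun t Z y i => rfl, fun t Z => ?_, fun t Z Z' => ?_, fun Z => ?_⟩
  · exact BoundedContinuousFunction.norm_ofNormedAddCommGroup_le _ (by positivity) _
  · refine (BoundedContinuousFunction.norm_le (by positivity)).2 fun y => ?_
    refine (pi_norm_le_iff_of_nonneg (by positivity)).2 fun i => ?_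
    show |v t i (y + Z y i) (G t Z i (y + Z y i)) - v t i (y + Z' y i) (G t Z' i (y + Z' y i))| ≤ _
    refine (hv.lip t i _ _ _ _).trans ?_
    have h1 : |y + Z y i - (y + Z' y i)| ≤ ‖Z - Z'‖ := by
      rw [add_sub_add_left_eq_sub]; exact Dsp.coord_le Z Z' y i
    have h2 := hG.lipx t Z i (y + Z y i) (y + Z' y i)
    have h3 := hG.lipZ t Z Z' i (y + Z' y i)
    have h4 := norm_sub_le_norm_sub_add_norm_sub (G t Z i (y + Z y i)) (G t Z i (y + Z' y i))
      (G t Z' i (y + Z' y i))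
    have h5 : K * |y + Z y i - (y + Z' y i)| ≤ K * ‖Z - Z'‖ := by gcongr
    have : |y + Z y i - (y + Z' y i)| + ‖G t Z i (y + Z y i) - G t Z' i (y + Z' y i)‖
      ≤ (1 + 2 * K) * ‖Z - Z'‖ := by linarith
    calc _ ≤ C * ((1 + 2 * K) * ‖Z - Z'‖) := by gcongr
      _ = _ := by ring
  · rw [continuous_iff_continuousAt]
    intro t
    rw [Metric.continuousAt_iff]
    intro ε hε
    obtain ⟨δ1, hδ1, h1⟩ := hv.tc t (ε / 4 / (1 + K)) (by positivity)
    obtain ⟨δ2, hδ2, h2⟩ := hG.tc t (ε / 4 / (1 + C)) (by positivity)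
    refine ⟨min δ1 δ2, lt_min hδ1 hδ2, fun {s} hs => ?_⟩
    rw [Real.dist_eq, lt_min_iff] at hs
    rw [dist_eq_norm]
    refine lt_of_le_of_lt ?_ (half_lt_self hε)
    refine (BoundedContinuousFunction.norm_le (by positivity)).2 fun y => ?_
    refine (pi_norm_le_iff_of_nonneg (by positivity)).2 fun i => ?_
    show |v s i (y + Z y i) (G s Z i (y + Z y i)) - v t i (y + Z y i) (G t Z i (y + Z y i))| ≤ _
    have a1 := h1 s hs.1 i (y + Z y i) (G s Z i (y + Z y i))
    have a2 := hv.lip t i (y + Z y i) (y + Z y i) (G s Z i (y + Z y i)) (G t Z i (y + Z y i))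
    have a3 := h2 s hs.2 Z i (y + Z y i)
    have a4 := hG.bdd s Z i (y + Z y i)
    have a5 := abs_sub_le (v s i (y + Z y i) (G s Z i (y + Z y i)))
      (v t i (y + Z y i) (G s Z i (y + Z y i))) (v t i (y + Z y i) (G t Z i (y + Z y i)))
    rw [sub_self, abs_zero, zero_add] at a2
    have a6 : ε / 4 / (1 + K) * (1 + ‖G s Z i (y + Z y i)‖) ≤ ε / 4 / (1 + K) * (1 + K) := by gcongr
    have a7 : C * ‖G s Z i (y + Z y i) - G t Z i (y + Z y i)‖ ≤ (1 + C) * (ε / 4 / (1 + C)) := by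
      gcongr; linarith
    rw [div_mul_cancel₀ _ (by positivity)] at a6
    rw [mul_div_cancel₀ _ (by positivity)] at a7
    linarith

/-- solution of the displacement ODE on `[t0,T]` -/
structure IsDisp {n : ℕ} (t0 T : ℝ) (v : ℝ → Fin n → ℝ → (Fin n → ℝ) → ℝ)
    (G : ℝ → Dsp n → Fin n → ℝ → Fin n → ℝ) (Z : ℝ → Dsp n) : Prop where
  init : Z t0 = 0
  cont : Continuous Z
  der : ∀ t ∈ Icc t0 T, ∃ D : Dsp n, HasDerivAt Z D t ∧
    ∀ y i, D y i = v t i (y + Z t y i) (G t (Z t) i (y + Z t y i))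

lemma exists_disp {n : ℕ} {v : ℝ → Fin n → ℝ → (Fin n → ℝ) → ℝ} {C K t0 T : ℝ} (hT : t0 ≤ T)
    {G : ℝ → Dsp n → Fin n → ℝ → Fin n → ℝ} (hv : VReg n v C) (hG : GReg n G K) :
    ∃ Z, IsDisp t0 T v G Z := by
  obtain ⟨F, hF, hFb, hFl, hFc⟩ := exists_F hv hG
  have hC := hv.C0
  have hK := hG.K0
  have hP : IsPicardLindelof F (tmin := t0 - 1) (tmax := T + 1) ⟨t0, by constructor <;> linarith⟩ 0
      (C * (1 + K) * (T + 1 - t0 + 1)).toNNReal 0 (C * (1 + K)).toNNReal (C * (1 + 2 * K)).toNNReal := by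
    refine ⟨fun t _ => ?_, fun Z _ => (hFc Z).continuousOn, fun t _ Z _ => ?_, ?_⟩
    · refine (LipschitzWith.of_dist_le_mul fun Z Z' => ?_).lipschitzOnWith
      rw [Real.coe_toNNReal _ (by positivity), dist_eq_norm, dist_eq_norm]
      exact hFl t Z Z'
    · rw [Real.coe_toNNReal _ (by positivity)]; exact hFb t Z
    · have h0 : 0 ≤ T + 1 - t0 + 1 := by linarith
      rw [Real.coe_toNNReal _ (by positivity), Real.coe_toNNReal _ (by positivity)]
      simp only [NNReal.coe_zero, sub_zero]
      gcongr
      refine max_le ?_ ?_ <;> linarith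
  obtain ⟨Z, hZ0, hZ⟩ := hP.exists_eq_forall_mem_Icc_hasDerivWithinAt₀
  simp only at hZ0
  have hle : t0 - 1 ≤ T + 1 := by linarith
  have hco : ContinuousOn Z (Icc (t0 - 1) (T + 1)) := fun t ht => (hZ t ht).continuousWithinAt
  refine ⟨fun t => Z (clamp (t0 - 1) (T + 1) t), ?_, ?_, ?_⟩
  · show Z (clamp (t0 - 1) (T + 1) t0) = 0
    rw [clamp_eq (by constructor <;> linarith), hZ0]
  · exact hco.comp_continuous (clamp_cont _ _) (clamp_mem hle)
  · intro t ht
    have ht' : t ∈ Icc (t0 - 1) (T + 1) := ⟨by linarith [ht.1], by linarith [ht.2]⟩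
    have hn : Icc (t0 - 1) (T + 1) ∈ 𝓝 t := Icc_mem_nhds (by linarith [ht.1]) (by linarith [ht.2])
    refine ⟨F t (Z t), ((hZ t ht').hasDerivAt hn).congr_of_eventuallyEq ?_, fun y i => ?_⟩
    · filter_upwards [hn] with s hs
      rw [clamp_eq hs]
    · simp only [clamp_eq ht', hF]

lemma IsDisp.unique {n : ℕ} {v : ℝ → Fin n → ℝ → (Fin n → ℝ) → ℝ} {C K t0 T : ℝ}
    {G : ℝ → Dsp n → Fin n → ℝ → Fin n → ℝ} (hv : VReg n v C) (hG : GReg n G K)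
    {Z Z' : ℝ → Dsp n} (h : IsDisp t0 T v G Z) (h' : IsDisp t0 T v G Z') : EqOn Z Z' (Icc t0 T) := by
  obtain ⟨F, hF, hFb, hFl, hFc⟩ := exists_F hv hG
  have hC := hv.C0
  have hK := hG.K0
  have key : ∀ Z, IsDisp t0 T v G Z → ∀ t ∈ Ico t0 T, HasDerivWithinAt Z (F t (Z t)) (Ici t) t := by
    intro Z h t ht
    obtain ⟨D, hD, hD'⟩ := h.der t (Ico_subset_Icc_self ht)
    have : D = F t (Z t) := by
      ext y i; rw [hD', hF]
    exact (this ▸ hD).hasDerivWithinAt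
  refine ODE_solution_unique_of_mem_Icc_right (v := F) (s := fun _ => univ) (K := (C * (1 + 2 * K)).toNNReal)
    (fun t _ => ?_) h.cont.continuousOn (key Z h) (fun _ _ => trivial)
    h'.cont.continuousOn (key Z' h') (fun _ _ => trivial) (by rw [h.init, h'.init])
  refine (LipschitzWith.of_dist_le_mul fun Z Z' => ?_).lipschitzOnWith
  rw [Real.coe_toNNReal _ (by positivity), dist_eq_norm, dist_eq_norm]
  exact hFl t Z Z'

lemma IsDisp.flow {n : ℕ} {v : ℝ → Fin n → ℝ → (Fin n → ℝ) → ℝ} {t0 T : ℝ}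
    {G : ℝ → Dsp n → Fin n → ℝ → Fin n → ℝ} {Z : ℝ → Dsp n} (h : IsDisp t0 T v G Z) (i : Fin n) :
    IsFlow t0 T (fun t x => v t i x (G t (Z t) i x)) (fun t y => y + Z t y i) := by
  refine ⟨fun y => ?_, fun y => ?_, fun y t ht => ?_⟩
  · simp [h.init]
  · have : Continuous fun t => Z t y := (BoundedContinuousFunction.evalCLM ℝ y).continuous.comp h.cont
    exact continuous_const.add ((continuous_apply i).comp this)
  · obtain ⟨D, hD, hD'⟩ := h.der t ht
    have h1 : HasDerivAt (fun s => Z s y) (D y) t :=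
      (BoundedContinuousFunction.evalCLM ℝ y : Dsp n →L[ℝ] (Fin n → ℝ)).hasFDerivAt.comp_hasDerivAt t hD
    have h2 := (hasDerivAt_pi.1 h1 i).const_add y
    rw [hD'] at h2
    exact h2

/-- nonlocal operator with kernel -/
def kerG {n : ℕ} (η : Fin n → Fin n → ℝ → ℝ) (Ξ : Dsp n → Fin n → ℝ → ℝ) (r : ℝ → Fin n → ℝ → ℝ) :
    ℝ → Dsp n → Fin n → ℝ → Fin n → ℝ :=
  fun t Z i x j => ∫ z, η i j (x - Ξ Z j z) * r t j z

/-- standing assumptions on the data of `kerG` -/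
structure KerData {n : ℕ} (η : Fin n → Fin n → ℝ → ℝ) (Ξ : Dsp n → Fin n → ℝ → ℝ)
    (r : ℝ → Fin n → ℝ → ℝ) (C B : ℝ) : Prop where
  C0 : 0 ≤ C
  B0 : 0 ≤ B
  eta : EtaBound n η C
  l1 : ∀ j, L1c (fun t => r t j)
  rB : ∀ t j, ∫ z, |r t j z| ≤ B
  meas : ∀ Z j, Measurable (Ξ Z j)
  lip : ∀ Z Z' j z, |Ξ Z j z - Ξ Z' j z| ≤ ‖Z - Z'‖

section
variable {n : ℕ} {η : Fin n → Fin n → ℝ → ℝ} {Ξ : Dsp n → Fin n → ℝ → ℝ}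
  {r : ℝ → Fin n → ℝ → ℝ} {C B : ℝ}

lemma KerData.reg (h : KerData η Ξ r C B) : GReg n (kerG η Ξ r) (C * B) := by
  have hC := h.C0
  have hB := h.B0
  refine ⟨by positivity, fun t Z i x => ?_, fun t Z i x y => ?_, fun t Z Z' i x => ?_, fun t ε hε => ?_⟩
  · refine (pi_norm_le_iff_of_nonneg (by positivity)).2 fun j => ?_
    refine (conv_bdd (h.eta i j) ((h.l1 j).int t) x).trans ?_
    have := h.rB t j
    gcongr
  · refine (pi_norm_le_iff_of_nonneg (by positivity)).2 fun j => ?_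
    refine (conv_lip (h.eta i j) (h.meas Z j) ((h.l1 j).int t) x y).trans ?_
    have := h.rB t j
    gcongr
  · refine (pi_norm_le_iff_of_nonneg (by positivity)).2 fun j => ?_
    refine (conv_lipΞ (h.eta i j) (h.meas Z j) (h.meas Z' j) ((h.l1 j).int t) (h.lip Z Z' j) x).trans ?_
    have := h.rB t j
    gcongr
  · have h1 : ∀ᶠ s in 𝓝 t, ∀ j, ∫ z, |r s j z - r t j z| < ε / (1 + C) :=
      eventually_all.2 fun j => ((h.l1 j).cont t).eventually_lt_const (by positivity)
    obtain ⟨δ, hδ, hd⟩ := Metric.eventually_nhds_iff.1 h1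
    refine ⟨δ, hδ, fun s hs Z i x => ?_⟩
    refine (pi_norm_le_iff_of_nonneg (by positivity)).2 fun j => ?_
    refine (conv_lipr (h.eta i j) (h.meas Z j) ((h.l1 j).int s) ((h.l1 j).int t) x).trans ?_
    have := hd (by rwa [Real.dist_eq]) j
    calc _ ≤ (1 + C) * (ε / (1 + C)) := by gcongr; linarith
      _ = ε := mul_div_cancel₀ _ (by positivity)

lemma KerData.nice (h : KerData η Ξ r C B) {v : ℝ → Fin n → ℝ → (Fin n → ℝ) → ℝ} {Cv : ℝ}
    (hv : VReg n v Cv) {Z : ℝ → Dsp n} (hZ : Continuous Z) (i : Fin n) :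
    ∃ w' M L L2, NiceField (fun t x => v t i x (kerG η Ξ r t (Z t) i x)) w' M L L2 := by
  have hC := h.C0
  have hB := h.B0
  have hG := h.reg
  have := hv.nice (K := C * B) (c := fun t x => kerG η Ξ r t (Z t) i x)
    (c' := fun t x j => ∫ z, deriv (η i j) (x - Ξ (Z t) j z) * r t j z) (by positivity) i ?_ ?_ ?_ ?_ ?_
  · exact ⟨_, _, _, _, this⟩
  · intro x
    rw [continuous_iff_continuousAt]
    intro t
    rw [Metric.continuousAt_iff]
    intro ε hε
    obtain ⟨δ, hδ, hd⟩ := hG.tc t (ε / 3) (by positivity)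
    obtain ⟨δ', hδ', hd'⟩ := Metric.continuousAt_iff.1 (hZ.continuousAt (x := t)) (ε / 3 / (1 + C * B)) (by positivity)
    refine ⟨min δ δ', lt_min hδ hδ', fun {s} hs => ?_⟩
    rw [lt_min_iff] at hs
    have a1 := hd s (by rw [← Real.dist_eq]; exact hs.1) (Z s) i x
    have a2 := hG.lipZ t (Z s) (Z t) i x
    have a3 := hd' hs.2
    rw [dist_eq_norm] at a3 ⊢
    have a4 : C * B * ‖Z s - Z t‖ ≤ (1 + C * B) * (ε / 3 / (1 + C * B)) := by gcongr; linarith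
    rw [mul_div_cancel₀ _ (by positivity)] at a4
    have a5 := norm_sub_le_norm_sub_add_norm_sub (kerG η Ξ r s (Z s) i x) (kerG η Ξ r t (Z s) i x)
      (kerG η Ξ r t (Z t) i x)
    linarith
  · intro t x j
    exact conv_der (h.eta i j) (h.meas (Z t) j) ((h.l1 j).int t) x
  · intro t x j
    exact (norm_le_pi_norm (kerG η Ξ r t (Z t) i x) j).trans (hG.bdd t (Z t) i x)
  · intro t x j
    refine (conv_dbdd (h.eta i j) ((h.l1 j).int t) x).trans ?_
    have := h.rB t j
    gcongr
  · intro t x y j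
    refine (conv_dlip (h.eta i j) (h.meas (Z t) j) ((h.l1 j).int t) x y).trans ?_
    have := h.rB t j
    gcongr
end

lemma convTerm_eq {n : ℕ} (η : Fin n → Fin n → ℝ → ℝ) (ρ : ℝ → Fin n → ℝ) (i : Fin n) (x : ℝ)
    (j : Fin n) : convTerm n η ρ i x j = ∫ z, η i j (x - z) * ρ z j := by
  unfold convTerm
  rw [← integral_sub_left_eq_self (fun z => η i j (x - z) * ρ z j) volume x]
  simp

lemma IsWeakSol.congr {t0 T : ℝ} {w w1 u u1 : ℝ → ℝ → ℝ} {u0 : ℝ → ℝ} (h : IsWeakSol t0 T w u0 u)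
    (hw : ∀ t ∈ Icc t0 T, ∀ x, w t x = w1 t x) (hu : ∀ t ∈ Icc t0 T, ∀ x, u t x = u1 t x) :
    IsWeakSol t0 T w1 u0 u1 := by
  intro φ h1 h2 h3
  rw [← h φ h1 h2 h3]
  congr 1
  refine setIntegral_congr_fun measurableSet_Icc fun t ht => ?_
  simp only [hw t ht, hu t ht]

lemma L1c_const {u : ℝ → ℝ} (hu : Integrable u) : L1c (fun _ => u) :=
  ⟨fun _ => hu, fun _ => by simp⟩

lemma ContL1.l1c {n : ℕ} {t0 T : ℝ} (hT : t0 ≤ T) {σ : ℝ → ℝ → Fin n → ℝ} (h : ContL1 n t0 T σ) (j : Fin n) :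
    L1c (fun t x => σ (clamp t0 T t) x j) := by
  refine ⟨fun t => (h.1 _ (clamp_mem hT t)).eval j, fun t => ?_⟩
  rw [Metric.tendsto_nhds]
  intro ε hε
  obtain ⟨δ, hδ, hd⟩ := h.2 _ (clamp_mem hT t) (ε / 2) (by positivity)
  have := Metric.continuousAt_iff.1 ((clamp_cont t0 T).continuousAt (x := t)) δ hδ
  obtain ⟨δ', hδ', hd'⟩ := this
  rw [Metric.eventually_nhds_iff]
  refine ⟨δ', hδ', fun s hs => ?_⟩
  have h1 := hd _ (clamp_mem hT s) (by rw [← Real.dist_eq]; exact hd' hs)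
  have h0 : 0 ≤ ∫ z, |σ (clamp t0 T s) z j - σ (clamp t0 T t) z j| := integral_nonneg fun z => abs_nonneg _
  rw [Real.dist_eq, sub_zero, abs_of_nonneg h0]
  refine lt_of_le_of_lt (le_trans ?_ h1) (half_lt_self hε)
  have hi := (h.1 _ (clamp_mem hT s)).sub (h.1 _ (clamp_mem hT t))
  refine integral_mono (hi.eval j).abs hi.norm fun z => ?_
  exact norm_le_pi_norm (σ (clamp t0 T s) z - σ (clamp t0 T t) z) j

theorem main_aux (n : ℕ) (t0 T : ℝ) (hT : t0 < T)
    (η : Fin n → Fin n → ℝ → ℝ) (hη : EtaAssumption n η)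
    (v : ℝ → Fin n → ℝ → (Fin n → ℝ) → ℝ) (hv : VAssumption n t0 T v)
    (ρ0 : ℝ → Fin n → ℝ) (hρ0 : L1BV n ρ0) :
    ∃ ρ : ℝ → ℝ → Fin n → ℝ,
      IsSol n t0 T η v ρ0 ρ ∧
      (∀ σ : ℝ → ℝ → Fin n → ℝ, IsSol n t0 T η v ρ0 σ →
        ∀ t ∈ Icc t0 T, ∀ᵐ x : ℝ ∂volume, σ t x = ρ t x) ∧
      (∀ t ∈ Icc t0 T, L1BV n (ρ t)) := by
  obtain ⟨Cv, hV⟩ := vreg hT.le hv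
  obtain ⟨C1, hC1⟩ := hη
  obtain ⟨C, hC0, hC⟩ : ∃ C, 0 ≤ C ∧ EtaBound n η C := by
    refine ⟨max C1 0, le_max_right _ _, fun i j => ⟨(hC1 i j).1, fun x => ?_⟩⟩
    have := (hC1 i j).2 x
    exact ⟨this.1.trans (le_max_left _ _), this.2.1.trans (le_max_left _ _),
      this.2.2.trans (le_max_left _ _)⟩
  set vh : ℝ → Fin n → ℝ → (Fin n → ℝ) → ℝ := fun t => v (clamp t0 T t) with hvh
  have hi0 : ∀ j, Integrable fun x => ρ0 x j := fun j => hρ0.1.eval j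
  -- closed system
  have hK : KerData η (fun (Z : Dsp n) j z => z + Z z j) (fun _ j z => ρ0 z j) C
      (∑ j, ∫ z, |ρ0 z j|) := by
    refine ⟨hC0, Finset.sum_nonneg fun j _ => integral_nonneg fun z => abs_nonneg _, hC,
      fun j => L1c_const (hi0 j), fun t j => ?_, fun Z j => ?_, fun Z Z' j z => ?_⟩
    · exact Finset.single_le_sum (f := fun j => ∫ z, |ρ0 z j|)
        (fun j _ => integral_nonneg fun z => abs_nonneg _) (Finset.mem_univ j)
    · have hz : Continuous fun z => z + Z z j :=
        continuous_id.add ((continuous_apply j).comp Z.continuous)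
      exact hz.measurable
    · rw [add_sub_add_left_eq_sub]; exact Dsp.coord_le Z Z' z j
  set G := kerG η (fun (Z : Dsp n) j z => z + Z z j) (fun _ j z => ρ0 z j) with hG
  obtain ⟨Z, hZ⟩ := exists_disp hT.le hV hK.reg
  choose w' M L L2 hN using fun i => hK.nice hV hZ.cont i
  have hFl := hZ.flow
  set X : Fin n → ℝ → ℝ → ℝ := fun i t y => y + Z t y i with hX
  set ρ : ℝ → ℝ → Fin n → ℝ := fun t x i => dens (w' i) (X i) t0 (fun x => ρ0 x i) t x with hρ
  have hconv : ∀ t ∈ Icc t0 T, ∀ i x, convTerm n η (ρ t) i x = G t (Z t) i x := by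
    intro t ht i x
    ext j
    rw [convTerm_eq]
    exact (hFl j).cov (hN j) ht (fun z => η i j (x - z))
  have hint : ∀ t ∈ Icc t0 T, Integrable (ρ t) := fun t ht =>
    Integrable.of_eval fun i => (hFl i).dens_int (hN i) ht (hi0 i)
  refine ⟨ρ, ⟨⟨hint, ?_⟩, fun i => ?_⟩, ?_, fun t ht => ⟨hint t ht, fun i => ?_⟩⟩
  · intro t ht ε hε
    have h1 : Tendsto (fun s => ∑ i, ∫ x, |ρ s x i - ρ t x i|) (𝓝[Icc t0 T] t) (𝓝 0) := by
      have := tendsto_finsetSum (Finset.univ : Finset (Fin n))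
        (fun i _ => (hFl i).dens_L1 (hN i) ht (hi0 i))
      simpa using this
    have h2 := h1.eventually_lt_const hε
    obtain ⟨δ, hδ, hd⟩ := Metric.mem_nhdsWithin_iff.1 h2
    refine ⟨δ, hδ, fun s hs hst => ?_⟩
    have h3 : ∑ i, ∫ x, |ρ s x i - ρ t x i| < ε := hd ⟨by rwa [Metric.mem_ball, Real.dist_eq], hs⟩
    refine le_trans ?_ h3.le
    have hi : ∀ i, Integrable fun x => |ρ s x i - ρ t x i| := fun i =>
      (((hint s hs).sub (hint t ht)).eval i).abs
    rw [← integral_finsetSum _ fun i _ => hi i]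
    refine integral_mono ((hint s hs).sub (hint t ht)).norm (integrable_finsetSum _ fun i _ => hi i)
      fun x => ?_
    refine (pi_norm_le_iff_of_nonneg (Finset.sum_nonneg fun i _ => abs_nonneg _)).2 fun i => ?_
    exact Finset.single_le_sum (f := fun i => |ρ s x i - ρ t x i|) (fun i _ => abs_nonneg _)
      (Finset.mem_univ i)
  · refine ((hFl i).weak (hN i) hT.le (hi0 i)).congr (fun t ht x => ?_) (fun t ht x => rfl)
    rw [hconv t ht]
    simp only [hvh, clamp_eq ht, hG]
  · intro σ hσ t ht
    -- frozen system
    have hl1 : ∀ j, L1c (fun t x => σ (clamp t0 T t) x j) := fun j => hσ.1.l1c hT.le j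
    obtain ⟨B, hB⟩ : ∃ B, ∀ t ∈ Icc t0 T, ∑ j, ∫ z, |σ (clamp t0 T t) z j| ≤ B := by
      have hc : Continuous fun t => ∑ j, ∫ z, |σ (clamp t0 T t) z j| :=
        continuous_finsetSum _ fun j _ => (hl1 j).normc
      obtain ⟨B, hB⟩ := (isCompact_Icc (a := t0) (b := T)).bddAbove_image hc.continuousOn
      exact ⟨B, fun t ht => hB (mem_image_of_mem _ ht)⟩
    have hK' : KerData η (fun (_ : Dsp n) _ z => z) (fun t j z => σ (clamp t0 T t) z j) C B := by
      refine ⟨hC0, ?_, hC, hl1, fun t j => ?_, fun _ _ => measurable_id, fun Z Z' j z => ?_⟩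
      · exact (Finset.sum_nonneg fun j _ => integral_nonneg fun z => abs_nonneg _).trans (hB t ht)
      · have := hB _ (clamp_mem hT.le t)
        rw [clamp_eq (clamp_mem hT.le t)] at this
        exact (Finset.single_le_sum (f := fun j => ∫ z, |σ (clamp t0 T t) z j|)
          (fun j _ => integral_nonneg fun z => abs_nonneg _) (Finset.mem_univ j)).trans this
      · simp
    set G' := kerG η (fun (_ : Dsp n) _ z => z) (fun t j z => σ (clamp t0 T t) z j) with hG'
    obtain ⟨Y, hY⟩ := exists_disp hT.le hV hK'.reg
    choose u' M' L' L2' hN' using fun i => hK'.nice hV hY.cont i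
    have hFl' := hY.flow
    have hconv' : ∀ t ∈ Icc t0 T, ∀ i x (W : Dsp n), convTerm n η (σ t) i x = G' t W i x := by
      intro t ht i x W
      ext j
      rw [convTerm_eq]
      simp only [hG', kerG, clamp_eq ht]
    have hwk : ∀ i, IsWeakSol t0 T (fun t x => vh t i x (G' t (Y t) i x)) (fun x => ρ0 x i)
        (fun t x => σ (clamp t0 T t) x i) := fun i => by
      refine (hσ.2 i).congr (fun t ht x => ?_) (fun t ht x => ?_)
      · rw [hconv' t ht i x (Y t)]
        simp only [hvh, clamp_eq ht]
      · simp only [clamp_eq ht]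
    have hae : ∀ t ∈ Icc t0 T, ∀ i, (fun x => σ (clamp t0 T t) x i) =ᵐ[volume]
        dens (u' i) (fun t y => y + Y t y i) t0 (fun x => ρ0 x i) t := fun t ht i =>
      linear_unique (hN' i) (hFl' i) hT (hl1 i) (hi0 i) (hwk i) ht
    have hGG : ∀ t ∈ Icc t0 T, ∀ i x, G' t (Y t) i x = G t (Y t) i x := by
      intro t ht i x
      ext j
      have h1 := (hFl' j).cov (u0 := fun x => ρ0 x j) (hN' j) ht (fun z => η i j (x - z))
      simp only [hG', hG, kerG]
      rw [← h1]
      refine integral_congr_ae ?_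
      filter_upwards [hae t ht j] with z hz
      rw [hz]
    have hY2 : IsDisp t0 T vh G Y := by
      refine ⟨hY.init, hY.cont, fun t ht => ?_⟩
      obtain ⟨D, hD, hD'⟩ := hY.der t ht
      refine ⟨D, hD, fun y i => ?_⟩
      rw [← hGG t ht]
      exact hD' y i
    have hYZ := hY2.unique hV hK.reg hZ
    have hfin : ∀ i, (fun x => σ (clamp t0 T t) x i) =ᵐ[volume]
        dens (w' i) (X i) t0 (fun x => ρ0 x i) t := fun i => by
      refine linear_unique (hN i) (hFl i) hT (hl1 i) (hi0 i) ?_ ht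
      refine (hwk i).congr (fun t ht x => ?_) (fun t ht x => rfl)
      rw [hGG t ht, hYZ ht]
    filter_upwards [ae_all_iff.2 hfin] with x hx
    ext i
    have := hx i
    simp only [clamp_eq ht] at this
    exact this
  · exact (hFl i).dens_bv (hN i) ht (hi0 i) (hρ0.2 i)

end Helpers

/-- Theorem 2.3, existence, uniqueness, L¹∩BV regularity:
under (η) and (v), for every `ρ0 ∈ (L¹ ∩ BV)(ℝ;ℝⁿ)` and `T > t0` the nonlocal system
admits a solution on `[t0,T]`, the solution is unique (up to a.e. equality at each time),
and it takes values in `(L¹ ∩ BV)(ℝ;ℝⁿ)`. -/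
theorem statement0 (n : ℕ) (hn : 1 ≤ n) (t0 T : ℝ) (ht0 : 0 ≤ t0) (hT : t0 < T)
    (η : Fin n → Fin n → ℝ → ℝ) (hη : EtaAssumption n η)
    (v : ℝ → Fin n → ℝ → (Fin n → ℝ) → ℝ) (hv : VAssumption n t0 T v)
    (ρ0 : ℝ → Fin n → ℝ) (hρ0 : L1BV n ρ0) :
    ∃ ρ : ℝ → ℝ → Fin n → ℝ,
      IsSol n t0 T η v ρ0 ρ ∧
      (∀ σ : ℝ → ℝ → Fin n → ℝ, IsSol n t0 T η v ρ0 σ →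
        ∀ t ∈ Icc t0 T, ∀ᵐ x : ℝ ∂volume, σ t x = ρ t x) ∧
      (∀ t ∈ Icc t0 T, L1BV n (ρ t)) := by
  exact main_aux n t0 T hT η hη v hv ρ0 hρ0
end
end

section
/- Let T > 0, Q̃ > 0 and let w, z: [0,T] × ℝ → ℝ be continuous, twice continuously differentiable in x, with sup_{t∈[0,T]}(‖·(t,·)‖_{L∞} + ‖∂_x ·(t,·)‖_{L∞} + ‖∂²_{xx} ·(t,·)‖_{L∞}) ≤ Q̃ for both w and z. Let ρ_o ∈ (L¹ ∩ BV)(ℝ; ℝ) and let ρ_w and ρ_z denote the Lagrangian solutions of the continuity equation with speeds w and z respectively, both with datum ρ_o. Then for every t ∈ [0,T]: ‖ρ_w(t) − ρ_z(t)‖_{L¹(ℝ)} ≤ (2 TV(ρ_o) + (Q̃ t / 2 + 1) ‖ρ_o‖_{L¹(ℝ)}) · t · e^{2 Q̃ t} · sup_{s∈[0,T]}(‖w(s,·) − z(s,·)‖_{L∞(ℝ)} + ‖∂_x w(s,·) − ∂_x z(s,·)‖_{L∞(ℝ)}). -/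
open MeasureTheory Set
open scoped ENNReal NNReal

lemma gron_fwd {f f' : ℝ → ℝ} {K ε a b : ℝ} (hab : a ≤ b) (hK : 0 < K) (hε : 0 ≤ ε)
    (hf : ∀ r ∈ Icc a b, HasDerivWithinAt f (f' r) (Icc a b) r)
    (hb : ∀ r ∈ Icc a b, |f' r| ≤ K * |f r| + ε) :
    |f b| ≤ (|f a| + ε * (b - a)) * Real.exp (K * (b - a)) := by
  have h := norm_le_gronwallBound_of_norm_deriv_right_le (f := f) (f' := f') (δ := |f a|) (K := K)
    (ε := ε) (a := a) (b := b) (fun r hr => (hf r hr).continuousWithinAt)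
    (fun r hr => by
      have := (hf r ⟨hr.1, hr.2.le⟩).mono (Icc_subset_Icc_left hr.1)
      exact this.mono_of_mem_nhdsWithin (Icc_mem_nhdsGE hr.2))
    le_rfl (fun r hr => hb r ⟨hr.1, hr.2.le⟩) b (right_mem_Icc.2 hab)
  rw [gronwallBound_of_K_ne_0 hK.ne', Real.norm_eq_abs] at h
  refine h.trans ?_
  rw [add_mul]
  refine add_le_add le_rfl ?_
  have h1 : Real.exp (K * (b - a)) - 1 ≤ K * (b - a) * Real.exp (K * (b - a)) := by
    have h2 := Real.add_one_le_exp (-(K * (b - a)))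
    have h3 : Real.exp (-(K * (b - a))) * Real.exp (K * (b - a)) = 1 := by
      rw [← Real.exp_add]; simp
    nlinarith [Real.exp_pos (K * (b - a))]
  calc ε / K * (Real.exp (K * (b - a)) - 1)
      ≤ ε / K * (K * (b - a) * Real.exp (K * (b - a))) := by gcongr
    _ = _ := by field_simp

lemma gron {f f' : ℝ → ℝ} {K ε T : ℝ} (hK : 0 < K) (hε : 0 ≤ ε)
    (hf : ∀ r ∈ Icc (0:ℝ) T, HasDerivWithinAt f (f' r) (Icc (0:ℝ) T) r)
    (hb : ∀ r ∈ Icc (0:ℝ) T, |f' r| ≤ K * |f r| + ε)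
    {s t : ℝ} (hs : s ∈ Icc (0:ℝ) T) (ht : t ∈ Icc (0:ℝ) T) :
    |f s| ≤ (|f t| + ε * |s - t|) * Real.exp (K * |s - t|) := by
  rcases le_total t s with h | h
  · rw [abs_of_nonneg (sub_nonneg.2 h)]
    have hsub : Icc t s ⊆ Icc 0 T := Icc_subset_Icc ht.1 hs.2
    exact gron_fwd h hK hε (fun r hr => (hf r (hsub hr)).mono hsub) (fun r hr => hb r (hsub hr))
  · rw [abs_sub_comm, abs_of_nonneg (sub_nonneg.2 h)]
    have hsub : Icc s t ⊆ Icc 0 T := Icc_subset_Icc hs.1 ht.2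
    have hneg : ∀ r ∈ Icc (-t) (-s), -r ∈ Icc s t := fun r hr => ⟨by linarith [hr.2], by linarith [hr.1]⟩
    have := gron_fwd (f := fun r => f (-r)) (f' := fun r => - f' (-r)) (a := -t) (b := -s)
      (by linarith) hK hε
      (fun r hr => by
        have h1 := ((hf (-r) (hsub (hneg r hr))).mono hsub).scomp r
          ((hasDerivAt_neg r).hasDerivWithinAt (s := Icc (-t) (-s))) hneg
        simpa [Function.comp_def] using h1)
      (fun r hr => by simpa using hb (-r) (hsub (hneg r hr)))
    simpa [sub_eq_add_neg, add_comm] using this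

structure IsFl (T Q : ℝ) (w : ℝ → ℝ → ℝ) (X : ℝ → ℝ → ℝ → ℝ) : Prop where
  hQ : 0 < Q
  hT : 0 < T
  smooth : ∀ t : ℝ, ContDiff ℝ 2 (w t)
  xcont : Continuous fun p : ℝ × ℝ => deriv (w p.1) p.2
  bd : ∀ t ∈ Icc (0:ℝ) T, ∀ x : ℝ, |w t x| + |deriv (w t) x| + |deriv (deriv (w t)) x| ≤ Q
  X0 : ∀ t0 ∈ Icc (0:ℝ) T, ∀ x0 : ℝ, X t0 t0 x0 = x0
  der : ∀ t0 ∈ Icc (0:ℝ) T, ∀ x0 : ℝ, ∀ t ∈ Icc (0:ℝ) T,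
      HasDerivWithinAt (fun s => X s t0 x0) (w t (X t t0 x0)) (Icc (0:ℝ) T) t

namespace IsFl
variable {T Q : ℝ} {w : ℝ → ℝ → ℝ} {X : ℝ → ℝ → ℝ → ℝ}

lemma bd1 (h : IsFl T Q w X) {t : ℝ} (ht : t ∈ Icc (0:ℝ) T) (x : ℝ) : |deriv (w t) x| ≤ Q := by
  have := h.bd t ht x
  have := abs_nonneg (w t x)
  have := abs_nonneg (deriv (deriv (w t)) x)
  linarith

lemma bd2 (h : IsFl T Q w X) {t : ℝ} (ht : t ∈ Icc (0:ℝ) T) (x : ℝ) :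
    |deriv (deriv (w t)) x| ≤ Q := by
  have := h.bd t ht x
  have := abs_nonneg (w t x)
  have := abs_nonneg (deriv (w t) x)
  linarith

lemma diff (h : IsFl T Q w X) (t : ℝ) : Differentiable ℝ (w t) :=
  (h.smooth t).differentiable (by norm_num)

lemma diff' (h : IsFl T Q w X) (t : ℝ) : Differentiable ℝ (deriv (w t)) := by
  have h1 : ContDiff ℝ (1 + 1) (w t) := by simpa [one_add_one_eq_two] using h.smooth t
  exact (contDiff_succ_iff_deriv.1 h1).2.2.differentiable (by norm_num)

lemma lip (h : IsFl T Q w X) {t : ℝ} (ht : t ∈ Icc (0:ℝ) T) (x y : ℝ) :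
    |w t y - w t x| ≤ Q * |y - x| :=
  Convex.norm_image_sub_le_of_norm_deriv_le (s := univ) (fun x _ => h.diff t x)
    (fun x _ => h.bd1 ht x) convex_univ (mem_univ _) (mem_univ _)

lemma lip' (h : IsFl T Q w X) {t : ℝ} (ht : t ∈ Icc (0:ℝ) T) (x y : ℝ) :
    |deriv (w t) y - deriv (w t) x| ≤ Q * |y - x| :=
  Convex.norm_image_sub_le_of_norm_deriv_le (s := univ) (fun x _ => h.diff' t x)
    (fun x _ => h.bd2 ht x) convex_univ (mem_univ _) (mem_univ _)

lemma taylor (h : IsFl T Q w X) {t : ℝ} (ht : t ∈ Icc (0:ℝ) T) (x y : ℝ) :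
    |w t y - w t x - deriv (w t) x * (y - x)| ≤ Q * |y - x| ^ 2 := by
  have := Convex.norm_image_sub_le_of_norm_hasDerivWithin_le (s := uIcc x y)
    (f := fun v => w t v - deriv (w t) x * v) (f' := fun v => deriv (w t) v - deriv (w t) x * 1)
    (x := x) (y := y) (C := Q * |y - x|)
    (fun v _ => ((h.diff t v).hasDerivAt.sub ((hasDerivAt_id v).const_mul _)).hasDerivWithinAt)
    (fun v hv => by
      rw [mul_one]
      refine (h.lip' ht x v).trans ?_
      have : |v - x| ≤ |y - x| := abs_sub_left_of_mem_uIcc hv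
      have := h.hQ
      gcongr) (convex_uIcc _ _) left_mem_uIcc right_mem_uIcc
  simp only [Real.norm_eq_abs] at this
  calc _ = |w t y - deriv (w t) x * y - (w t x - deriv (w t) x * x)| := by ring_nf
    _ ≤ _ := this
    _ = _ := by ring

lemma gr (h : IsFl T Q w X) {s t u v : ℝ} (hs : s ∈ Icc (0:ℝ) T) (ht : t ∈ Icc (0:ℝ) T)
    (hu : u ∈ Icc (0:ℝ) T) (hv : v ∈ Icc (0:ℝ) T) (x y : ℝ) :
    |X s u x - X s v y| ≤ |X t u x - X t v y| * Real.exp (Q * |s - t|) := by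
  have := gron (f := fun r => X r u x - X r v y) (ε := 0) h.hQ le_rfl
    (fun r hr => (h.der u hu x r hr).sub (h.der v hv y r hr))
    (fun r hr => by simpa using h.lip hr _ _) hs ht
  simpa using this

lemma flow (h : IsFl T Q w X) {r s t : ℝ} (hr : r ∈ Icc (0:ℝ) T) (hs : s ∈ Icc (0:ℝ) T)
    (ht : t ∈ Icc (0:ℝ) T) (x : ℝ) : X r s (X s t x) = X r t x := by
  have := h.gr hr hs hs ht (X s t x) x
  rw [h.X0 s hs, sub_self, abs_zero, zero_mul] at this
  linarith [abs_nonpos_iff.1 this]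

lemma lipX (h : IsFl T Q w X) {s t : ℝ} (hs : s ∈ Icc (0:ℝ) T) (ht : t ∈ Icc (0:ℝ) T) (x y : ℝ) :
    |X s t x - X s t y| ≤ |x - y| * Real.exp (Q * |s - t|) := by
  simpa [h.X0 t ht] using h.gr hs ht ht ht x y

lemma bij (h : IsFl T Q w X) {s t : ℝ} (hs : s ∈ Icc (0:ℝ) T) (ht : t ∈ Icc (0:ℝ) T) :
    Function.Bijective (X s t) := by
  refine Function.bijective_iff_has_inverse.2 ⟨X t s, fun x => ?_, fun x => ?_⟩
  · rw [h.flow ht hs ht, h.X0 t ht]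
  · rw [h.flow hs ht hs, h.X0 s hs]

lemma psi_cont (h : IsFl T Q w X) {t : ℝ} (ht : t ∈ Icc (0:ℝ) T) (x : ℝ) :
    ContinuousOn (fun r => deriv (w r) (X r t x)) (Icc 0 T) := by
  have h1 : ContinuousOn (fun r => (r, X r t x)) (Icc 0 T) :=
    continuousOn_id.prodMk (fun r hr => (h.der t ht x r hr).continuousWithinAt)
  exact h.xcont.comp_continuousOn h1

lemma psi_int (h : IsFl T Q w X) {t : ℝ} (ht : t ∈ Icc (0:ℝ) T) (x : ℝ) {a b : ℝ}
    (ha : a ∈ Icc (0:ℝ) T) (hb : b ∈ Icc (0:ℝ) T) :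
    IntervalIntegrable (fun r => deriv (w r) (X r t x)) volume a b :=
  ((h.psi_cont ht x).mono (uIcc_subset_Icc ha hb)).intervalIntegrable

lemma hasDeriv (h : IsFl T Q w X) {s t : ℝ} (hs : s ∈ Icc (0:ℝ) T) (ht : t ∈ Icc (0:ℝ) T) (x : ℝ) :
    HasDerivAt (X s t) (Real.exp (-∫ r in s..t, deriv (w r) (X r t x))) x := by
  have hT := h.hT.le
  have hQ := h.hQ
  set ψ : ℝ → ℝ := IccExtend hT (fun r : Icc (0:ℝ) T => deriv (w r) (X r t x)) with hψ
  have ψc : Continuous ψ := by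
    apply Continuous.Icc_extend'
    exact continuousOn_iff_continuous_domRestrict.1 (h.psi_cont ht x)
  have ψe : ∀ r ∈ Icc (0:ℝ) T, ψ r = deriv (w r) (X r t x) := fun r hr => by
    rw [hψ, IccExtend_of_mem hT _ hr]
  have ψb : ∀ r, |ψ r| ≤ Q := fun r => h.bd1 (projIcc 0 T hT r).2 _
  have e1 : (∫ r in s..t, deriv (w r) (X r t x)) = ∫ r in s..t, ψ r :=
    intervalIntegral.integral_congr (fun r hr => (ψe r (uIcc_subset_Icc hs ht hr)).symm)
  rw [e1, ← intervalIntegral.integral_symm]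
  set I : ℝ → ℝ := fun r => ∫ q in t..r, ψ q with hI
  have dI : ∀ r, HasDerivAt I (ψ r) r := fun r => (ψc.integral_hasStrictDerivAt t r).hasDerivAt
  have It : I t = 0 := by simp [hI]
  have Ib : ∀ r ∈ Icc (0:ℝ) T, |I r| ≤ Q * T := fun r hr => by
    refine (intervalIntegral.norm_integral_le_of_norm_le_const (f := ψ) (C := Q) (fun q _ => ψb q)).trans ?_
    gcongr
    rw [abs_le]; constructor <;> linarith [hr.1, hr.2, ht.1, ht.2]
  set E := Real.exp (Q * T) with hE
  set C := E * (Q * E ^ 2 * E * T) with hC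
  have key : ∀ y, |X s t y - X s t x - (y - x) * Real.exp (I s)| ≤ C * |y - x| ^ 2 := by
    intro y
    set D : ℝ → ℝ := fun r => X r t y - X r t x with hD
    have Db : ∀ r ∈ Icc (0:ℝ) T, |D r| ≤ |y - x| * E := fun r hr => by
      refine (h.lipX hr ht y x).trans ?_
      refine mul_le_mul_of_nonneg_left (Real.exp_le_exp.2 (mul_le_mul_of_nonneg_left ?_ hQ.le)) (abs_nonneg _)
      rw [abs_le]; constructor <;> linarith [hr.1, hr.2, ht.1, ht.2]
    have dF : ∀ r ∈ Icc (0:ℝ) T, HasDerivWithinAt (fun r => D r * Real.exp (-I r))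
        ((w r (X r t y) - w r (X r t x)) * Real.exp (-I r) + D r * (Real.exp (-I r) * -ψ r))
        (Icc 0 T) r := fun r hr =>
      ((h.der t ht y r hr).sub (h.der t ht x r hr)).mul (dI r).neg.exp.hasDerivWithinAt
    have F := Convex.norm_image_sub_le_of_norm_hasDerivWithin_le (C := Q * (|y - x| * E) ^ 2 * E) dF
      (fun r hr => by
        have : (w r (X r t y) - w r (X r t x)) * Real.exp (-I r) + D r * (Real.exp (-I r) * -ψ r)
          = (w r (X r t y) - w r (X r t x) - deriv (w r) (X r t x) * (X r t y - X r t x)) * Real.exp (-I r) := by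
          rw [ψe r hr, hD]; ring
        rw [this, norm_mul, Real.norm_eq_abs, Real.norm_eq_abs, Real.abs_exp]
        gcongr
        · refine (h.taylor hr _ _).trans ?_
          gcongr
          exact Db r hr
        · exact Real.exp_le_exp.2 (by linarith [neg_abs_le (I r), Ib r hr])) (convex_Icc 0 T) ht hs
    have Dt : D t = y - x := by simp [hD, h.X0 t ht]
    simp only [It, Dt, neg_zero, Real.exp_zero, mul_one, Real.norm_eq_abs] at F
    have : X s t y - X s t x - (y - x) * Real.exp (I s)
        = Real.exp (I s) * (D s * Real.exp (-I s) - (y - x)) := by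
      rw [Real.exp_neg]; field_simp [hD]
      try ring
    rw [this, abs_mul, Real.abs_exp]
    have h1 : Real.exp (I s) ≤ E := Real.exp_le_exp.2 ((le_abs_self _).trans (Ib s hs))
    have h2 : |s - t| ≤ T := by
      rw [abs_le]; constructor <;> linarith [hs.1, hs.2, ht.1, ht.2]
    calc _ ≤ E * (Q * (|y - x| * E) ^ 2 * E * T) := by
          gcongr
          exact F.trans (by gcongr)
      _ = _ := by rw [hC]; ring
  rw [hasDerivAt_iff_isLittleO]
  refine (Asymptotics.IsBigO.of_bound C (Filter.Eventually.of_forall fun y => ?_)).trans_isLittleO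
    (Asymptotics.isLittleO_pow_sub_sub x (m := 2) (by norm_num))
  simpa using key y

end IsFl

lemma comp_XY {T Q : ℝ} {w z : ℝ → ℝ → ℝ} {X Y : ℝ → ℝ → ℝ → ℝ} {δ1 : ℝ}
    (hX : IsFl T Q w X) (hY : IsFl T Q z Y)
    (hδ1 : ∀ s ∈ Icc (0:ℝ) T, ∀ x : ℝ, |w s x - z s x| ≤ δ1) {s t : ℝ}
    (hs : s ∈ Icc (0:ℝ) T) (ht : t ∈ Icc (0:ℝ) T) (x : ℝ) :
    |X s t x - Y s t x| ≤ δ1 * |s - t| * Real.exp (Q * |s - t|) := by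
  have hδ : 0 ≤ δ1 := (abs_nonneg _).trans (hδ1 s hs 0)
  have := gron (f := fun r => X r t x - Y r t x) (ε := δ1) hX.hQ hδ
    (fun r hr => (hX.der t ht x r hr).sub (hY.der t ht x r hr))
    (fun r hr => by
      have h1 := hX.lip hr (Y r t x) (X r t x)
      have h2 := hδ1 r hr (Y r t x)
      calc _ = |(w r (X r t x) - w r (Y r t x)) + (w r (Y r t x) - z r (Y r t x))| := by ring_nf
        _ ≤ _ := abs_add_le _ _
        _ ≤ _ := add_le_add h1 h2) hs ht
  simpa [hX.X0 t ht, hY.X0 t ht] using this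

lemma var_fun {ρ0 : ℝ → ℝ} (hbv : BoundedVariationOn ρ0 Set.univ) :
    ∃ V : ℝ → ℝ, Monotone V ∧ (∀ x, 0 ≤ V x) ∧ (∀ x, V x ≤ (eVariationOn ρ0 univ).toReal) ∧
      ∀ p q, p ≤ q → |ρ0 p - ρ0 q| ≤ V q - V p := by
  have fin : ∀ s : Set ℝ, eVariationOn ρ0 s ≠ ⊤ := fun s =>
    ne_top_of_le_ne_top hbv (eVariationOn.mono _ (subset_univ s))
  refine ⟨fun x => (eVariationOn ρ0 (Iic x)).toReal, fun a b hab => ?_, fun x => ENNReal.toReal_nonneg,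
    fun x => ?_, fun p q hpq => ?_⟩
  · exact ENNReal.toReal_mono (fin _) (eVariationOn.mono _ (Iic_subset_Iic.2 hab))
  · exact ENNReal.toReal_mono (fin _) (eVariationOn.mono _ (subset_univ _))
  · have h1 := eVariationOn.add_le_union ρ0 (s := Iic p) (t := Icc p q)
      (fun x hx y hy => le_trans hx hy.1)
    rw [Iic_union_Icc_eq_Iic hpq] at h1
    have h2 := eVariationOn.edist_le ρ0 (s := Icc p q) (left_mem_Icc.2 hpq) (right_mem_Icc.2 hpq)
    have h3 := ENNReal.toReal_mono (fin _) h1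
    rw [ENNReal.toReal_add (fin _) (fin _)] at h3
    have h4 := ENNReal.toReal_mono (fin _) h2
    rw [← dist_edist, Real.dist_eq] at h4
    linarith

lemma var_shift {V : ℝ → ℝ} {M d : ℝ} (hV : Monotone V) (h0 : ∀ x, 0 ≤ V x) (hM : ∀ x, V x ≤ M)
    (hd : 0 ≤ d) :
    Integrable (fun y => V (y + d) - V (y - d)) ∧ ∫ y, (V (y + d) - V (y - d)) ≤ 2 * d * M := by
  have ii : ∀ a b, IntervalIntegrable V volume a b := fun a b => hV.intervalIntegrable
  have i1 : ∀ a b, IntervalIntegrable (fun y => V (y + d)) volume a b := fun a b =>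
    Monotone.intervalIntegrable (fun x y hxy => hV (by linarith))
  have i2 : ∀ a b, IntervalIntegrable (fun y => V (y - d)) volume a b := fun a b =>
    Monotone.intervalIntegrable (fun x y hxy => hV (by linarith))
  have key : ∀ R : ℝ, (∫ y in (-R)..R, (V (y + d) - V (y - d))) ≤ 2 * d * M := by
    intro R
    rw [intervalIntegral.integral_sub (i1 _ _) (i2 _ _), intervalIntegral.integral_comp_add_right,
      intervalIntegral.integral_comp_sub_right]
    have e1 := intervalIntegral.integral_add_adjacent_intervals (ii (-R - d) (-R + d)) (ii (-R + d) (R + d))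
    have e2 := intervalIntegral.integral_add_adjacent_intervals (ii (-R - d) (R - d)) (ii (R - d) (R + d))
    have n1 : 0 ≤ ∫ y in (-R - d)..(-R + d), V y :=
      intervalIntegral.integral_nonneg (by linarith) (fun u _ => h0 u)
    have n2 : (∫ y in (R - d)..(R + d), V y) ≤ ∫ y in (R - d)..(R + d), M :=
      intervalIntegral.integral_mono_on (by linarith) (ii _ _) (by simp) (fun u _ => hM u)
    rw [intervalIntegral.integral_const, smul_eq_mul] at n2
    linarith
  have nn : ∀ y, 0 ≤ V (y + d) - V (y - d) := fun y => sub_nonneg.2 (hV (by linarith))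
  have int : Integrable (fun y => V (y + d) - V (y - d)) :=
    integrable_of_intervalIntegral_norm_bounded (l := Filter.atTop) (a := fun R : ℝ => -R)
      (b := fun R => R) (2 * d * M) (fun R => ((i1 (-R) R).sub (i2 (-R) R)).1)
      Filter.tendsto_neg_atTop_atBot Filter.tendsto_id
      (Filter.Eventually.of_forall fun R => by
        simp only [Real.norm_eq_abs, abs_of_nonneg (nn _)]; exact key R)
  refine ⟨int, le_of_tendsto (intervalIntegral_tendsto_integral int
    Filter.tendsto_neg_atTop_atBot Filter.tendsto_id) (Filter.Eventually.of_forall key)⟩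

lemma cov_int {A a : ℝ → ℝ} (hA : ∀ x, HasDerivAt A (Real.exp (a x)) x) (hb : Function.Bijective A)
    {g : ℝ → ℝ} (hg : Integrable g) : Integrable (fun x => g (A x) * Real.exp (a x)) := by
  have := (integrableOn_image_iff_integrableOn_abs_deriv_smul (s := univ) MeasurableSet.univ
    (fun x _ => (hA x).hasDerivWithinAt) hb.1.injOn g).1 hg.integrableOn
  simpa [mul_comm] using this

lemma cov_eq {A a : ℝ → ℝ} (hA : ∀ x, HasDerivAt A (Real.exp (a x)) x) (hb : Function.Bijective A)
    (g : ℝ → ℝ) : ∫ x, g (A x) * Real.exp (a x) = ∫ x, g x := by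
  have := (integral_image_eq_integral_abs_deriv_smul (s := univ) MeasurableSet.univ
    (fun x _ => (hA x).hasDerivWithinAt) hb.1.injOn g)
  rw [image_univ, hb.2.range_eq] at this
  simpa [mul_comm] using this.symm

lemma abs_exp_sub (v : ℝ) : |Real.exp v - 1| ≤ |v| * Real.exp |v| := by
  have h3 : Real.exp (-v) * Real.exp v = 1 := by rw [← Real.exp_add]; simp
  rcases le_total 0 v with h | h
  · rw [abs_of_nonneg h, abs_of_nonneg (by linarith [Real.one_le_exp h])]
    have h2 := Real.add_one_le_exp (-v)
    nlinarith [Real.exp_pos v]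
  · rw [abs_of_nonpos h, abs_of_nonpos (by linarith [Real.exp_le_one_iff.2 h])]
    have h2 := Real.add_one_le_exp v
    have : 1 ≤ Real.exp (-v) := Real.one_le_exp (by linarith)
    nlinarith

lemma step {ρ0 : ℝ → ℝ} (hρ0 : Integrable ρ0 volume) (hbv : BoundedVariationOn ρ0 Set.univ)
    {A a B b : ℝ → ℝ} (hA : ∀ x, HasDerivAt A (Real.exp (a x)) x) (hAb : Function.Bijective A)
    (hB : ∀ x, HasDerivAt B (Real.exp (b x)) x) (hBb : Function.Bijective B)
    {d η : ℝ} (hd : ∀ x, |A x - B x| ≤ d) (hη : ∀ x, |a x - b x| ≤ η) :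
    ∫ x, |ρ0 (A x) * Real.exp (a x) - ρ0 (B x) * Real.exp (b x)| ≤
      2 * d * (eVariationOn ρ0 univ).toReal + η * Real.exp η * ∫ x, |ρ0 x| := by
  obtain ⟨V, hV, h0, hM, hVV⟩ := var_fun hbv
  have hd0 : 0 ≤ d := (abs_nonneg _).trans (hd 0)
  have hη0 : 0 ≤ η := (abs_nonneg _).trans (hη 0)
  obtain ⟨s1, s2⟩ := var_shift hV h0 hM hd0
  have j1 := cov_int hA hAb s1
  have j2 := (cov_int hB hBb hρ0.abs).mul_const (η * Real.exp η)
  have := integral_mono_of_nonneg (μ := volume)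
    (f := fun x => |ρ0 (A x) * Real.exp (a x) - ρ0 (B x) * Real.exp (b x)|)
    (Filter.Eventually.of_forall fun x => abs_nonneg _) (j1.add j2)
    (Filter.Eventually.of_forall fun x => by
      have k1 : |ρ0 (A x) - ρ0 (B x)| ≤ V (A x + d) - V (A x - d) := by
        have := abs_le.1 (hd x)
        rcases le_total (A x) (B x) with h | h
        · have := hVV _ _ h
          have := hV (show B x ≤ A x + d by linarith)
          have := hV (show A x - d ≤ A x by linarith)
          linarith
        · have := hVV _ _ h
          rw [abs_sub_comm] at this
          have := hV (show A x ≤ A x + d by linarith)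
          have := hV (show A x - d ≤ B x by linarith)
          linarith
      have k2 : |Real.exp (a x) - Real.exp (b x)| ≤ Real.exp (b x) * (η * Real.exp η) := by
        have : Real.exp (a x) - Real.exp (b x) = Real.exp (b x) * (Real.exp (a x - b x) - 1) := by
          rw [mul_sub, ← Real.exp_add]; simp
        rw [this, abs_mul, Real.abs_exp]
        gcongr
        refine (abs_exp_sub _).trans ?_
        have := hη x
        gcongr
      calc _ = |(ρ0 (A x) - ρ0 (B x)) * Real.exp (a x) + ρ0 (B x) * (Real.exp (a x) - Real.exp (b x))| := by
            ring_nf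
        _ ≤ _ := abs_add_le _ _
        _ = |ρ0 (A x) - ρ0 (B x)| * Real.exp (a x) + |ρ0 (B x)| * |Real.exp (a x) - Real.exp (b x)| := by
            rw [abs_mul, abs_mul, Real.abs_exp]
        _ ≤ (V (A x + d) - V (A x - d)) * Real.exp (a x) + |ρ0 (B x)| * (Real.exp (b x) * (η * Real.exp η)) := by
            gcongr
        _ = _ := by simp only [Pi.add_apply]; ring)
  refine this.trans ?_
  rw [integral_add' j1 j2, integral_mul_const, cov_eq hB hBb (fun x => |ρ0 x|),
    cov_eq hA hAb (fun y => V (y + d) - V (y - d))]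
  linarith

lemma main_step {T Q : ℝ} {w z : ℝ → ℝ → ℝ} {X Y : ℝ → ℝ → ℝ → ℝ} {δ1 δ2 : ℝ}
    (hX : IsFl T Q w X) (hY : IsFl T Q z Y)
    (hδ1 : ∀ s ∈ Icc (0:ℝ) T, ∀ x : ℝ, |w s x - z s x| ≤ δ1)
    (hδ2 : ∀ s ∈ Icc (0:ℝ) T, ∀ x : ℝ, |deriv (w s) x - deriv (z s) x| ≤ δ2)
    {t s s' : ℝ} (h0s : 0 ≤ s) (hss : s ≤ s') (hst : s' ≤ t) (htT : t ≤ T) (x : ℝ) :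
    |Y 0 s (X s t x) - Y 0 s' (X s' t x)| ≤ δ1 * (s' - s) * Real.exp (Q * t) ∧
    |(-(∫ r in (0:ℝ)..s, deriv (z r) (Y r s (X s t x))) - ∫ r in s..t, deriv (w r) (X r t x))
      - (-(∫ r in (0:ℝ)..s', deriv (z r) (Y r s' (X s' t x))) - ∫ r in s'..t, deriv (w r) (X r t x))|
      ≤ (s' - s) * (t * Q * Real.exp (Q * t) * δ1 + δ2 + Q * δ1 * (s' - s) * Real.exp (Q * t)) := by
  have m0 : (0:ℝ) ∈ Icc (0:ℝ) T := ⟨le_rfl, by linarith⟩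
  have ms : s ∈ Icc (0:ℝ) T := ⟨h0s, by linarith⟩
  have ms' : s' ∈ Icc (0:ℝ) T := ⟨by linarith, by linarith⟩
  have mt : t ∈ Icc (0:ℝ) T := ⟨by linarith, by linarith⟩
  have hQ := hX.hQ
  have hδ : 0 ≤ δ1 := (abs_nonneg _).trans (hδ1 s ms 0)
  set m := X s' t x with hm
  set p := Y s s' m with hp
  have e1 : X s t x = X s s' m := (hX.flow ms ms' mt x).symm
  have ey : ∀ r ∈ Icc (0:ℝ) T, Y r s' m = Y r s p := fun r hr => (hY.flow hr ms ms' m).symm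
  have dXY : ∀ r ∈ Icc s s', |X r s' m - Y r s' m| ≤ δ1 * (s' - s) * Real.exp (Q * (s' - s)) := by
    intro r hr
    refine (comp_XY hX hY hδ1 ⟨by linarith [hr.1], by linarith [hr.2]⟩ ms' m).trans ?_
    have : |r - s'| ≤ s' - s := by rw [abs_le]; constructor <;> linarith [hr.1, hr.2]
    gcongr
  have q0 : |X s t x - p| ≤ δ1 * (s' - s) * Real.exp (Q * (s' - s)) := by
    rw [e1]; exact dXY s ⟨le_rfl, hss⟩
  have hYr : ∀ r ∈ Icc (0:ℝ) s, |Y r s (X s t x) - Y r s p| ≤ δ1 * (s' - s) * Real.exp (Q * t) := by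
    intro r hr
    refine (hY.lipX ⟨hr.1, by linarith [hr.2]⟩ ms _ _).trans ?_
    have h1 : |r - s| ≤ s := by rw [abs_le]; constructor <;> linarith [hr.1, hr.2]
    calc _ ≤ δ1 * (s' - s) * Real.exp (Q * (s' - s)) * Real.exp (Q * s) := by gcongr
      _ = δ1 * (s' - s) * Real.exp (Q * s') := by
        rw [mul_assoc, ← Real.exp_add]; ring_nf
      _ ≤ _ := mul_le_mul_of_nonneg_left (Real.exp_le_exp.2 (mul_le_mul_of_nonneg_left hst hQ.le))
        (mul_nonneg hδ (by linarith))
  refine ⟨by rw [ey 0 m0]; exact hYr 0 ⟨le_rfl, h0s⟩, ?_⟩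
  have f1 := intervalIntegral.integral_add_adjacent_intervals (hX.psi_int mt x ms ms') (hX.psi_int mt x ms' mt)
  have f2 := intervalIntegral.integral_add_adjacent_intervals (hY.psi_int ms' m m0 ms) (hY.psi_int ms' m ms ms')
  have f3 : ∫ r in (0:ℝ)..s, deriv (z r) (Y r s' m) = ∫ r in (0:ℝ)..s, deriv (z r) (Y r s p) :=
    intervalIntegral.integral_congr (fun r hr => by
      rw [ey r (uIcc_subset_Icc m0 ms hr)])
  have f4 := intervalIntegral.integral_sub (hY.psi_int ms (X s t x) m0 ms) (hY.psi_int ms p m0 ms)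
  have f5 := intervalIntegral.integral_sub (hX.psi_int mt x ms ms') (hY.psi_int ms' m ms ms')
  have b1 := intervalIntegral.norm_integral_le_of_norm_le_const (a := 0) (b := s)
    (f := fun r => deriv (z r) (Y r s (X s t x)) - deriv (z r) (Y r s p))
    (C := Q * (δ1 * (s' - s) * Real.exp (Q * t))) (fun r hr => by
      rw [uIoc_of_le h0s] at hr
      refine (hY.lip' ⟨hr.1.le, by linarith [hr.2]⟩ _ _).trans ?_
      have := hYr r ⟨hr.1.le, hr.2⟩
      gcongr)
  have b2 := intervalIntegral.norm_integral_le_of_norm_le_const (a := s) (b := s')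
    (f := fun r => deriv (w r) (X r t x) - deriv (z r) (Y r s' m))
    (C := δ2 + Q * (δ1 * (s' - s) * Real.exp (Q * t))) (fun r hr => by
      rw [uIoc_of_le hss] at hr
      have mr : r ∈ Icc (0:ℝ) T := ⟨by linarith [hr.1], by linarith [hr.2]⟩
      rw [← hX.flow mr ms' mt x, ← hm]
      have h1 := hδ2 r mr (X r s' m)
      have h2 := hY.lip' mr (Y r s' m) (X r s' m)
      have h3 := dXY r ⟨hr.1.le, hr.2⟩
      have h4 : Real.exp (Q * (s' - s)) ≤ Real.exp (Q * t) :=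
        Real.exp_le_exp.2 (mul_le_mul_of_nonneg_left (by linarith) hQ.le)
      have h5 : |X r s' m - Y r s' m| ≤ δ1 * (s' - s) * Real.exp (Q * t) :=
        h3.trans (mul_le_mul_of_nonneg_left h4 (mul_nonneg hδ (by linarith)))
      have h6 := mul_le_mul_of_nonneg_left h5 hQ.le
      calc _ ≤ |deriv (w r) (X r s' m) - deriv (z r) (X r s' m)|
            + |deriv (z r) (X r s' m) - deriv (z r) (Y r s' m)| := abs_sub_le _ _ _
        _ ≤ _ := by linarith)
  rw [f4, sub_zero, abs_of_nonneg h0s, Real.norm_eq_abs] at b1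
  rw [f5, abs_of_nonneg (sub_nonneg.2 hss), Real.norm_eq_abs] at b2
  rw [← f1, ← f2, f3]
  have b3 : Q * (δ1 * (s' - s) * Real.exp (Q * t)) * s ≤ Q * (δ1 * (s' - s) * Real.exp (Q * t)) * t := by
    have : 0 ≤ s' - s := by linarith
    have : s ≤ t := by linarith
    gcongr
  rw [abs_le] at b1 b2 ⊢
  constructor <;> linarith [b1.1, b1.2, b2.1, b2.2]

theorem statement18 (T Qt : ℝ) (hT : 0 < T) (hQ : 0 < Qt)
    (w z : ℝ → ℝ → ℝ)
    (hw_cont : Continuous (Function.uncurry w))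
    (hz_cont : Continuous (Function.uncurry z))
    (hw_smooth : ∀ t : ℝ, ContDiff ℝ 2 (w t))
    (hz_smooth : ∀ t : ℝ, ContDiff ℝ 2 (z t))
    (hwx_cont : Continuous fun p : ℝ × ℝ => deriv (w p.1) p.2)
    (hzx_cont : Continuous fun p : ℝ × ℝ => deriv (z p.1) p.2)
    (hwQ : ∀ t ∈ Icc (0:ℝ) T, ∀ x : ℝ,
      |w t x| + |deriv (w t) x| + |deriv (deriv (w t)) x| ≤ Qt)
    (hzQ : ∀ t ∈ Icc (0:ℝ) T, ∀ x : ℝ,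
      |z t x| + |deriv (z t) x| + |deriv (deriv (z t)) x| ≤ Qt)
    (X Y : ℝ → ℝ → ℝ → ℝ)
    (hX0 : ∀ t0 ∈ Icc (0:ℝ) T, ∀ x0 : ℝ, X t0 t0 x0 = x0)
    (hY0 : ∀ t0 ∈ Icc (0:ℝ) T, ∀ x0 : ℝ, Y t0 t0 x0 = x0)
    (hX : ∀ t0 ∈ Icc (0:ℝ) T, ∀ x0 : ℝ, ∀ t ∈ Icc (0:ℝ) T,
      HasDerivWithinAt (fun s => X s t0 x0) (w t (X t t0 x0)) (Icc (0:ℝ) T) t)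
    (hY : ∀ t0 ∈ Icc (0:ℝ) T, ∀ x0 : ℝ, ∀ t ∈ Icc (0:ℝ) T,
      HasDerivWithinAt (fun s => Y s t0 x0) (z t (Y t t0 x0)) (Icc (0:ℝ) T) t)
    (ρ0 : ℝ → ℝ) (hρ0 : Integrable ρ0 volume)
    (hbv : BoundedVariationOn ρ0 Set.univ)
    (δ1 δ2 : ℝ)
    (hδ1 : ∀ s ∈ Icc (0:ℝ) T, ∀ x : ℝ, |w s x - z s x| ≤ δ1)
    (hδ2 : ∀ s ∈ Icc (0:ℝ) T, ∀ x : ℝ, |deriv (w s) x - deriv (z s) x| ≤ δ2) :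
    ∀ t ∈ Icc (0:ℝ) T,
      (∫ x : ℝ,
          |ρ0 (X 0 t x) * Real.exp (-∫ s in (0:ℝ)..t, deriv (w s) (X s t x))
            - ρ0 (Y 0 t x) * Real.exp (-∫ s in (0:ℝ)..t, deriv (z s) (Y s t x))|)
        ≤ (2 * (eVariationOn ρ0 Set.univ).toReal
              + (Qt * t / 2 + 1) * ∫ x : ℝ, |ρ0 x|)
            * t * Real.exp (2 * Qt * t) * (δ1 + δ2) := by
  intro t mt
  have FX : IsFl T Qt w X := ⟨hQ, hT, hw_smooth, hwx_cont, hwQ, hX0, hX⟩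
  have FY : IsFl T Qt z Y := ⟨hQ, hT, hz_smooth, hzx_cont, hzQ, hY0, hY⟩
  have m0 : (0:ℝ) ∈ Icc (0:ℝ) T := ⟨le_rfl, hT.le⟩
  have hd1 : 0 ≤ δ1 := (abs_nonneg _).trans (hδ1 0 m0 0)
  have hd2 : 0 ≤ δ2 := (abs_nonneg _).trans (hδ2 0 m0 0)
  have ht0 := mt.1
  set V := (eVariationOn ρ0 Set.univ).toReal with hV
  have hV0 : 0 ≤ V := ENNReal.toReal_nonneg
  set L := ∫ x : ℝ, |ρ0 x| with hL
  have hL0 : 0 ≤ L := integral_nonneg fun _ => abs_nonneg _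
  set E := Real.exp (Qt * t) with hE
  set A : ℝ → ℝ → ℝ := fun s x => Y 0 s (X s t x) with hA
  set a : ℝ → ℝ → ℝ := fun s x => -(∫ r in (0:ℝ)..s, deriv (z r) (Y r s (X s t x)))
    - ∫ r in s..t, deriv (w r) (X r t x) with ha
  set G : ℝ → ℝ → ℝ := fun s x => ρ0 (A s x) * Real.exp (a s x) with hG
  set c : ℝ → ℝ := fun τ => t * Qt * E * δ1 + δ2 + Qt * δ1 * τ * E with hc
  set φ : ℝ → ℝ := fun τ => 2 * δ1 * E * V + c τ * Real.exp (τ * c τ) * L with hφ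
  have mem : ∀ s ∈ Icc (0:ℝ) t, s ∈ Icc (0:ℝ) T := fun s hs => ⟨hs.1, hs.2.trans mt.2⟩
  have dA : ∀ s ∈ Icc (0:ℝ) t, ∀ x, HasDerivAt (A s) (Real.exp (a s x)) x := by
    intro s hs x
    have := (FY.hasDeriv m0 (mem s hs) (X s t x)).comp x (FX.hasDeriv (mem s hs) mt x)
    rw [← Real.exp_add, ← sub_eq_add_neg] at this
    exact this
  have bA : ∀ s ∈ Icc (0:ℝ) t, Function.Bijective (A s) := fun s hs =>
    (FY.bij m0 (mem s hs)).comp (FX.bij (mem s hs) mt)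
  have iG : ∀ s ∈ Icc (0:ℝ) t, Integrable (G s) := fun s hs => cov_int (dA s hs) (bA s hs) hρ0
  have stp : ∀ s s', 0 ≤ s → s ≤ s' → s' ≤ t → ∫ x, |G s x - G s' x| ≤ (s' - s) * φ (s' - s) := by
    intro s s' h1 h2 h3
    have ms : s ∈ Icc (0:ℝ) t := ⟨h1, h2.trans h3⟩
    have ms' : s' ∈ Icc (0:ℝ) t := ⟨h1.trans h2, h3⟩
    have := step hρ0 hbv (dA s ms) (bA s ms) (dA s' ms') (bA s' ms')
      (fun x => (main_step FX FY hδ1 hδ2 h1 h2 h3 mt.2 x).1)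
      (fun x => (main_step FX FY hδ1 hδ2 h1 h2 h3 mt.2 x).2)
    refine this.trans (le_of_eq ?_)
    simp only [hφ, hc]
    ring
  have tel : ∀ τ, 0 ≤ τ → ∀ k : ℕ, k * τ ≤ t → ∫ x, |G 0 x - G (k * τ) x| ≤ k * (τ * φ τ) := by
    intro τ hτ k
    induction k with
    | zero => intro _; simp
    | succ k ih =>
      intro hk
      push_cast at hk ⊢
      have k0 : 0 ≤ (k:ℝ) * τ := by positivity
      have k1 : (k:ℝ) * τ ≤ (k + 1) * τ := by nlinarith
      have h1 := ih (k1.trans hk)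
      have h2 := stp _ _ k0 k1 hk
      rw [show ((k:ℝ) + 1) * τ - k * τ = τ by ring] at h2
      have i0 := iG 0 ⟨le_rfl, ht0⟩
      have i1 := iG (k * τ) ⟨k0, k1.trans hk⟩
      have i2 := iG ((k + 1) * τ) ⟨k0.trans k1, hk⟩
      have h3 : ∫ x, |G 0 x - G ((k + 1) * τ) x| ≤
          ∫ x, (|G 0 x - G (k * τ) x| + |G (k * τ) x - G ((k + 1) * τ) x|) :=
        integral_mono (i0.sub i2).abs ((i0.sub i1).abs.add (i1.sub i2).abs)
          (fun x => abs_sub_le _ _ _)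
      have h4 : ∫ x, (|G 0 x - G (k * τ) x| + |G (k * τ) x - G ((k + 1) * τ) x|) =
          (∫ x, |G 0 x - G (k * τ) x|) + ∫ x, |G (k * τ) x - G ((k + 1) * τ) x| :=
        integral_add (i0.sub i1).abs (i1.sub i2).abs
      rw [h4] at h3
      linarith
  have eq : (∫ x : ℝ,
          |ρ0 (X 0 t x) * Real.exp (-∫ s in (0:ℝ)..t, deriv (w s) (X s t x))
            - ρ0 (Y 0 t x) * Real.exp (-∫ s in (0:ℝ)..t, deriv (z s) (Y s t x))|)
      = ∫ x, |G 0 x - G t x| := by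
    congr 1; ext x
    simp [hG, hA, ha, hY0 0 m0, hX0 t mt]
  rw [eq]
  have fin : ∀ n : ℕ, ∫ x, |G 0 x - G t x| ≤ t * φ (t / ((n:ℝ) + 1)) := by
    intro n
    have hn : (n:ℝ) + 1 ≠ 0 := by positivity
    have e : ((n + 1 : ℕ) : ℝ) * (t / ((n:ℝ) + 1)) = t := by push_cast; field_simp
    have := tel (t / ((n:ℝ) + 1)) (by positivity) (n + 1) e.le
    rwa [e, ← mul_assoc, e] at this
  have lim : Filter.Tendsto (fun n : ℕ => t * φ (t / ((n:ℝ) + 1))) Filter.atTop (nhds (t * φ 0)) := by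
    have cφ : Continuous φ := by simp only [hφ, hc]; fun_prop
    have h0 : Filter.Tendsto (fun n : ℕ => t / ((n:ℝ) + 1)) Filter.atTop (nhds 0) := by
      have := (tendsto_one_div_add_atTop_nhds_zero_nat (𝕜 := ℝ)).const_mul t
      simpa [div_eq_mul_inv] using this
    exact ((cφ.tendsto 0).comp h0).const_mul t
  refine (ge_of_tendsto lim (Filter.Eventually.of_forall fin)).trans ?_
  have e2 : Real.exp (2 * Qt * t) = E * E := by rw [hE, ← Real.exp_add]; ring_nf
  rw [e2]
  simp only [hφ, hc, mul_zero, zero_mul, add_zero, Real.exp_zero, mul_one]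
  have hu : 0 ≤ Qt * t := by positivity
  have E1 : 1 + Qt * t ≤ E := by linarith [Real.add_one_le_exp (Qt * t)]
  have E1' : 1 ≤ E := by linarith
  have EE : E ≤ E * E := by nlinarith
  have k1 : t * Qt * E ≤ (Qt * t / 2 + 1) * (E * E) := by
    have : Qt * t ≤ (Qt * t / 2 + 1) * E := by nlinarith
    nlinarith
  have k2 : 1 ≤ (Qt * t / 2 + 1) * (E * E) := by nlinarith
  have g1 : 2 * δ1 * E * V ≤ 2 * V * (E * E) * (δ1 + δ2) := by
    calc 2 * δ1 * E * V = 2 * V * E * δ1 := by ring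
      _ ≤ 2 * V * (E * E) * (δ1 + δ2) := by
        gcongr
        linarith
  have g2 : (t * Qt * E * δ1 + δ2) * L ≤ (Qt * t / 2 + 1) * (E * E) * (δ1 + δ2) * L := by
    refine mul_le_mul_of_nonneg_right ?_ hL0
    have := mul_le_mul_of_nonneg_right k1 hd1
    have := mul_le_mul_of_nonneg_right k2 hd2
    linarith
  calc _ ≤ t * (2 * V * (E * E) * (δ1 + δ2) + (Qt * t / 2 + 1) * (E * E) * (δ1 + δ2) * L) :=
        mul_le_mul_of_nonneg_left (add_le_add g1 g2) ht0
    _ = _ := by ring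
end
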